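/- Let G be a finite connected subcubic simple graph on n vertices and m edges such that G does not contain two vertex-disjoint cycles each of length less than five, G contains no induced subdivision of any member of the family 𝓕, and G is not isomorphic to K₄. Then φ(G) ≤ (2m − n + 5)/7. -/

import Mathlib

open SimpleGraph

/-- The minimum size of a feedback vertex set of `G`. -/
noncomputable def phi {V : Type} (G : SimpleGraph V) : ℕ :=
  sInf {n : ℕ | ∃ S : Finset V, S.card = n ∧ (G.induce ((S : Set V)ᶜ)).IsAcyclic}

/-- The graph obtained from `H` by subdividing the edge `uv` once: delete the edge `uv`
and add a new vertex (`none`) adjacent exactly to `u` and `v`. -/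
def subdivideEdge {V : Type} (H : SimpleGraph V) (u v : V) : SimpleGraph (Option V) :=
  SimpleGraph.fromRel (fun x y =>
    (∃ p q : V, x = some p ∧ y = some q ∧ H.Adj p q ∧ s(p, q) ≠ s(u, v)) ∨
    (x = none ∧ (y = some u ∨ y = some v)))

/-- `a` has degree exactly two in `H`. -/
def HasDegreeTwo {V : Type} (H : SimpleGraph V) (a : V) : Prop :=
  ∃ x y : V, x ≠ y ∧ H.Adj a x ∧ H.Adj a y ∧ ∀ z : V, H.Adj a z → z = x ∨ z = y

/-- The operation `∘` applied with two distinct edges `u₁v₁`, `u₂v₂` and a degree-two vertex `a`: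
subdivide both edges (new vertices `inr 0`, `inr 1`), then add a new vertex `inr 2` adjacent to
`a` and the two subdivision vertices. -/
def circOpTwo {V : Type} (H : SimpleGraph V) (u₁ v₁ u₂ v₂ a : V) : SimpleGraph (V ⊕ Fin 3) :=
  SimpleGraph.fromRel (fun x y =>
    (∃ p q : V, x = Sum.inl p ∧ y = Sum.inl q ∧ H.Adj p q ∧
      s(p, q) ≠ s(u₁, v₁) ∧ s(p, q) ≠ s(u₂, v₂)) ∨
    (x = Sum.inr 0 ∧ (y = Sum.inl u₁ ∨ y = Sum.inl v₁)) ∨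
    (x = Sum.inr 1 ∧ (y = Sum.inl u₂ ∨ y = Sum.inl v₂)) ∨
    (x = Sum.inr 2 ∧ (y = Sum.inl a ∨ y = Sum.inr 0 ∨ y = Sum.inr 1)))

/-- The operation `∘` applied with `e₁ = e₂ = uv` and a degree-two vertex `a`: subdivide the
edge `uv` twice (replacing it by the path `u, inr 0, inr 1, v`), then add a new vertex `inr 2`
adjacent to `a` and the two subdivision vertices. -/
def circOpOne {V : Type} (H : SimpleGraph V) (u v a : V) : SimpleGraph (V ⊕ Fin 3) :=
  SimpleGraph.fromRel (fun x y =>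
    (∃ p q : V, x = Sum.inl p ∧ y = Sum.inl q ∧ H.Adj p q ∧ s(p, q) ≠ s(u, v)) ∨
    (x = Sum.inr 0 ∧ (y = Sum.inl u ∨ y = Sum.inr 1)) ∨
    (x = Sum.inr 1 ∧ y = Sum.inl v) ∨
    (x = Sum.inr 2 ∧ (y = Sum.inl a ∨ y = Sum.inr 0 ∨ y = Sum.inr 1)))

/-- `G` is obtained from `H` by one application of the operation `∘` at the degree-two
vertex `a`, using two (not necessarily distinct) edges of `H`. -/
def IsCircOp {V : Type} (H : SimpleGraph V) (a : V) (G : SimpleGraph (V ⊕ Fin 3)) : Prop :=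
  (∃ u₁ v₁ u₂ v₂ : V, H.Adj u₁ v₁ ∧ H.Adj u₂ v₂ ∧ s(u₁, v₁) ≠ s(u₂, v₂) ∧
      G = circOpTwo H u₁ v₁ u₂ v₂ a) ∨
  (∃ u v : V, H.Adj u v ∧ G = circOpOne H u v a)

/-- Membership (up to isomorphism) in the family `F_{i,j}`. -/
inductive IsInF : ∀ (i j : ℕ) {V : Type}, SimpleGraph V → Prop
  | cycle (i : ℕ) (hi : 3 ≤ i) : IsInF i 0 (SimpleGraph.cycleGraph i)
  | k4 : IsInF 1 1 (⊤ : SimpleGraph (Fin 4))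
  | subdiv {i j : ℕ} {V : Type} {H : SimpleGraph V} {u v : V}
      (huv : H.Adj u v) (hH : IsInF i j H) : IsInF (i + 1) j (subdivideEdge H u v)
  | op {i j : ℕ} {V : Type} {H : SimpleGraph V} {a : V} {G : SimpleGraph (V ⊕ Fin 3)}
      (ha : HasDegreeTwo H a) (hG : IsCircOp H a G) (hH : IsInF i j H) : IsInF i (j + 1) G
  | iso {i j : ℕ} {V W : Type} {H : SimpleGraph V} {G : SimpleGraph W}
      (e : Nonempty (G ≃g H)) (hH : IsInF i j H) : IsInF i j G

/-- `G` is a graph obtained from `H` by repeatedly (possibly zero times) subdividing edges. -/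
inductive IsSubdivisionOf : ∀ {V : Type}, SimpleGraph V → ∀ {W : Type}, SimpleGraph W → Prop
  | refl {V : Type} (G : SimpleGraph V) : IsSubdivisionOf G G
  | step {V W : Type} {H : SimpleGraph V} {G : SimpleGraph W} {u v : W}
      (huv : G.Adj u v) (h : IsSubdivisionOf H G) : IsSubdivisionOf H (subdivideEdge G u v)

/-- `G` contains an induced subdivision of `H`: some induced subgraph of `G` is isomorphic
to a graph obtained from `H` by repeatedly subdividing edges. -/
def ContainsInducedSubdivision {V W : Type} (G : SimpleGraph V) (H : SimpleGraph W) : Prop :=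
  ∃ (s : Set V) (U : Type) (K : SimpleGraph U),
    IsSubdivisionOf H K ∧ Nonempty (G.induce s ≃g K)

/-- The family `𝓕`: members of `F_{4,2} ∪ F_{4,3}` of girth at least five, together with
members `H` of `F_{3,2} ∪ F_{3,3}` having an edge `e` such that `H − e` has girth at least
five. -/
def InFamilyF {W : Type} (H : SimpleGraph W) : Prop :=
  ((IsInF 4 2 H ∨ IsInF 4 3 H) ∧ 5 ≤ H.girth) ∨
  ((IsInF 3 2 H ∨ IsInF 3 3 H) ∧ ∃ e ∈ H.edgeSet, 5 ≤ (H.deleteEdges {e}).girth)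

/-- `G` contains two vertex-disjoint cycles, each of length less than five. -/
def HasTwoDisjointShortCycles {V : Type} (G : SimpleGraph V) : Prop :=
  ∃ (u v : V) (c₁ : G.Walk u u) (c₂ : G.Walk v v), c₁.IsCycle ∧ c₂.IsCycle ∧
    c₁.length < 5 ∧ c₂.length < 5 ∧ ∀ x : V, x ∈ c₁.support → x ∉ c₂.support

namespace OT
open Finset

variable {ε : Type}

/-- number of edges inside a vertex set -/
def ein (E : Finset ε) (s t : ε → ℕ) (Z : Finset ℕ) : ℕ :=
  (E.filter fun e => s e ∈ Z ∧ t e ∈ Z).card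

def rz (r : ℕ) (Z : Finset ℕ) : ℕ := if r ∈ Z then 0 else 1

def Conn (X : Finset ℕ) (E : Finset ε) (s t : ε → ℕ) : Prop :=
  ∀ Z ⊆ X, Z.Nonempty → Z ≠ X → ∃ e ∈ E, (s e ∈ Z ∧ t e ∉ Z) ∨ (s e ∉ Z ∧ t e ∈ Z)

/-- cut condition gives a rank function -/
lemma exists_rank (X : Finset ℕ) (E : Finset ε) (hd tl : ε → ℕ) (r : ℕ) (hr : r ∈ X)
    (htl : ∀ e ∈ E, tl e ∈ X)
    (hcut : ∀ Z ⊆ X, Z.Nonempty → r ∉ Z → ∃ e ∈ E, hd e ∈ Z ∧ tl e ∉ Z) :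
    ∃ rk : ℕ → ℕ, ∀ v ∈ X, v ≠ r → ∃ e ∈ E, hd e = v ∧ rk (tl e) < rk v := by
  classical
  have key : ∀ k, k ≤ X.card → 1 ≤ k → ∃ R ⊆ X, r ∈ R ∧ R.card = k ∧
      ∃ rk : ℕ → ℕ, ∀ v ∈ R, v ≠ r → ∃ e ∈ E, hd e = v ∧ tl e ∈ R ∧ rk (tl e) < rk v := by
    intro k
    induction k with
    | zero => intro _ h; omega
    | succ k ih =>
      intro hk _
      rcases Nat.eq_zero_or_pos k with rfl | hpos
      · exact ⟨{r}, by simpa using hr, by simp, by simp, fun _ => 0, by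
          intro v hv hvr; simp at hv; exact absurd hv hvr⟩
      · obtain ⟨R, hRX, hrR, hRc, rk, hrk⟩ := ih (by omega) hpos
        have hne : (X \ R).Nonempty := by
          rw [← Finset.card_pos, Finset.card_sdiff_of_subset hRX]; omega
        obtain ⟨e, heE, h1, h2⟩ := hcut (X \ R) Finset.sdiff_subset hne (by simp [hrR])
        simp only [mem_sdiff, not_and, not_not] at h1 h2
        have htR := h2 (htl e heE)
        refine ⟨insert (hd e) R, by
          intro x hx; rcases mem_insert.1 hx with rfl | hx
          · exact h1.1
          · exact hRX hx, by simp [hrR], by rw [card_insert_of_notMem h1.2, hRc],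
          fun v => if v = hd e then R.sup rk + 1 else rk v, ?_⟩
        intro v hv hvr
        have htne : tl e ≠ hd e := fun h => h1.2 (h ▸ htR)
        by_cases hve : v = hd e
        · refine ⟨e, heE, hve.symm, by simp [htR], ?_⟩
          simp only [hve, htne, if_true, if_false]
          exact Nat.lt_succ_of_le (Finset.le_sup htR)
        · have hvR : v ∈ R := by simpa [hve] using hv
          obtain ⟨e', he', h3, h4, h5⟩ := hrk v hvR hvr
          refine ⟨e', he', h3, by simp [h4], ?_⟩
          have : tl e' ≠ hd e := fun h => h1.2 (h ▸ h4)
          simpa [hve, this] using h5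
  obtain ⟨R, hRX, _, hc, rk, hrk⟩ := key X.card le_rfl (Finset.card_pos.2 ⟨r, hr⟩)
  have : R = X := Finset.eq_of_subset_of_card_le hRX hc.ge
  subst this
  exact ⟨rk, fun v hv hvr => by
    obtain ⟨e, a, b, _, c⟩ := hrk v hv hvr; exact ⟨e, a, b, c⟩⟩

lemma orient_exact (X : Finset ℕ) (E : Finset ε) (s t : ε → ℕ) (r : ℕ) (u : ℕ → ℕ)
    (hr : r ∈ X) (hE : ∀ e ∈ E, s e ∈ X ∧ t e ∈ X)
    (hu : ∀ Z ⊆ X, Z.Nonempty → ein E s t Z + rz r Z ≤ ∑ v ∈ Z, u v)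
    (hsum : ∑ v ∈ X, u v = E.card) :
    ∃ hd tl : ε → ℕ, ∃ rk : ℕ → ℕ,
      (∀ e ∈ E, (hd e = s e ∧ tl e = t e) ∨ (hd e = t e ∧ tl e = s e)) ∧
      (∀ v ∈ X, v ≠ r → ∃ e ∈ E, hd e = v ∧ rk (tl e) < rk v) ∧
      (∀ v ∈ X, (E.filter fun e => hd e = v).card = u v) := by
  classical
  let slots : {e // e ∈ E} → Finset (ℕ × ℕ) := fun e =>
    ({s e.1} : Finset ℕ) ×ˢ range (u (s e.1)) ∪ ({t e.1} : Finset ℕ) ×ˢ range (u (t e.1))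
  have hall : ∀ F : Finset {e // e ∈ E}, F.card ≤ (F.biUnion slots).card := by
    intro F
    rcases F.eq_empty_or_nonempty with rfl | hF
    · simp
    let Z := F.image (fun e => s e.1) ∪ F.image (fun e => t e.1)
    have hZX : Z ⊆ X := by
      intro x hx
      simp only [Z, mem_union, mem_image] at hx
      rcases hx with ⟨e, _, rfl⟩ | ⟨e, _, rfl⟩
      · exact (hE e.1 e.2).1
      · exact (hE e.1 e.2).2
    have hZn : Z.Nonempty := by
      obtain ⟨e, he⟩ := hF
      exact ⟨s e.1, by simp only [Z, mem_union, mem_image]; exact Or.inl ⟨e, he, rfl⟩⟩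
    have h1 : F.card ≤ ein E s t Z := by
      rw [← Finset.card_map ⟨Subtype.val, Subtype.val_injective⟩]
      apply Finset.card_le_card
      intro x hx
      simp only [mem_map, Function.Embedding.coeFn_mk] at hx
      obtain ⟨e, he, rfl⟩ := hx
      simp only [mem_filter, Z, mem_union, mem_image]
      exact ⟨e.2, Or.inl ⟨e, he, rfl⟩, Or.inr ⟨e, he, rfl⟩⟩
    have h2 : (Z.biUnion fun v => ({v} : Finset ℕ) ×ˢ range (u v)).card = ∑ v ∈ Z, u v := by
      rw [Finset.card_biUnion]
      · simp
      · intro x _ y _ hxy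
        simp only [Function.onFun]
        rw [Finset.disjoint_left]
        rintro ⟨a, b⟩ h1 h2
        simp only [mem_product, mem_singleton] at h1 h2
        exact hxy (h1.1.symm.trans h2.1)
    have h3 : (Z.biUnion fun v => ({v} : Finset ℕ) ×ˢ range (u v)) ⊆ F.biUnion slots := by
      rintro ⟨a, b⟩ h
      simp only [Z, mem_biUnion, mem_union, mem_image, mem_product, mem_singleton] at h
      obtain ⟨v, hv, rfl, hb⟩ := h
      simp only [mem_biUnion, slots, mem_union, mem_product, mem_singleton]
      rcases hv with ⟨e, he, rfl⟩ | ⟨e, he, rfl⟩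
      · exact ⟨e, he, Or.inl ⟨rfl, hb⟩⟩
      · exact ⟨e, he, Or.inr ⟨rfl, hb⟩⟩
    have h4 := hu Z hZX hZn
    have h5 := Finset.card_le_card h3
    omega
  obtain ⟨f, hfi, hf⟩ := (Finset.all_card_le_biUnion_card_iff_exists_injective slots).1 hall
  let hd : ε → ℕ := fun e => if h : e ∈ E then (f ⟨e, h⟩).1 else 0
  let tl : ε → ℕ := fun e => if hd e = s e then t e else s e
  have hor : ∀ e ∈ E, (hd e = s e ∧ tl e = t e) ∨ (hd e = t e ∧ tl e = s e) := by
    intro e he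
    have := hf ⟨e, he⟩
    simp only [slots, mem_union, mem_product, mem_singleton] at this
    have hh : hd e = (f ⟨e, he⟩).1 := by simp [hd, he]
    by_cases hs : hd e = s e
    · left; exact ⟨hs, by simp [tl, hs]⟩
    · right
      refine ⟨?_, by simp [tl, hs]⟩
      rcases this with h | h
      · exact absurd (hh.trans h.1) hs
      · exact hh.trans h.1
  have hle : ∀ v ∈ X, (E.filter fun e => hd e = v).card ≤ u v := by
    intro v _
    have : (E.filter fun e => hd e = v).card ≤ (range (u v)).card := by
      apply Finset.card_le_card_of_injOn (fun e => if h : e ∈ E then (f ⟨e, h⟩).2 else 0)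
      · intro e he
        obtain ⟨heE, hev⟩ := mem_filter.1 (mem_coe.1 he)
        have h1 := hf ⟨e, heE⟩
        have hh : hd e = (f ⟨e, heE⟩).1 := by simp [hd, heE]
        simp only [slots, mem_union, mem_product, mem_singleton] at h1
        simp only [heE, dif_pos, coe_range, Set.mem_Iio]
        rcases h1 with h | h
        · rw [← hev, hh, h.1]; exact mem_range.1 h.2
        · rw [← hev, hh, h.1]; exact mem_range.1 h.2
      · intro e he e' he' hee
        have he := mem_filter.1 (mem_coe.1 he)
        have he' := mem_filter.1 (mem_coe.1 he')
        simp only [he.1, he'.1, dif_pos] at hee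
        have hh : hd e = (f ⟨e, he.1⟩).1 := by simp [hd, he.1]
        have hh' : hd e' = (f ⟨e', he'.1⟩).1 := by simp [hd, he'.1]
        have : f ⟨e, he.1⟩ = f ⟨e', he'.1⟩ := Prod.ext (by rw [← hh, ← hh', he.2, he'.2]) hee
        simpa using hfi this
    simpa using this
  have hmap : ∀ e ∈ E, hd e ∈ X := by
    intro e he
    rcases hor e he with h | h
    · rw [h.1]; exact (hE e he).1
    · rw [h.1]; exact (hE e he).2
  have hsum2 : ∑ v ∈ X, (E.filter fun e => hd e = v).card = E.card :=
    (Finset.card_eq_sum_card_fiberwise hmap).symm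
  have heq : ∀ v ∈ X, (E.filter fun e => hd e = v).card = u v :=
    (Finset.sum_eq_sum_iff_of_le hle).1 (hsum2.trans hsum.symm)
  have hcut : ∀ Z ⊆ X, Z.Nonempty → r ∉ Z → ∃ e ∈ E, hd e ∈ Z ∧ tl e ∉ Z := by
    intro Z hZ hZn hrZ
    by_contra hcon
    push Not at hcon
    have h1 := hu Z hZ hZn
    have h2 : ∑ v ∈ Z, u v = (E.filter fun e => hd e ∈ Z).card := by
      rw [Finset.card_eq_sum_card_fiberwise (f := hd) (t := Z)]
      · apply Finset.sum_congr rfl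
        intro v hv
        rw [← heq v (hZ hv)]
        congr 1
        ext e
        simp only [mem_filter]
        constructor
        · rintro ⟨a, b⟩; exact ⟨⟨a, b ▸ hv⟩, b⟩
        · rintro ⟨⟨a, _⟩, b⟩; exact ⟨a, b⟩
      · intro e he; simpa using (mem_filter.1 he).2
    have h3 : (E.filter fun e => hd e ∈ Z) ⊆ E.filter fun e => s e ∈ Z ∧ t e ∈ Z := by
      intro e he
      simp only [mem_filter] at he ⊢
      have h4 := hcon e he.1 he.2
      refine ⟨he.1, ?_⟩
      rcases hor e he.1 with h | h
      · exact ⟨h.1 ▸ he.2, h.2 ▸ h4⟩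
      · exact ⟨h.2 ▸ h4, h.1 ▸ he.2⟩
    have h5 := Finset.card_le_card h3
    simp only [rz, hrZ, if_false] at h1
    unfold ein at h1
    omega
  have htl : ∀ e ∈ E, tl e ∈ X := by
    intro e he
    rcases hor e he with h | h
    · rw [h.2]; exact (hE e he).2
    · rw [h.2]; exact (hE e he).1
  obtain ⟨rk, hrk⟩ := exists_rank X E hd tl r hr htl hcut
  exact ⟨hd, tl, rk, hor, hrk, heq⟩

lemma tight_union (E : Finset ε) (s t : ε → ℕ) (r : ℕ) (u : ℕ → ℕ) (X Z W : Finset ℕ)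
    (hu : ∀ Z ⊆ X, Z.Nonempty → ein E s t Z + rz r Z ≤ ∑ v ∈ Z, u v)
    (hZ : Z ⊆ X) (hW : W ⊆ X) (hZt : ein E s t Z + rz r Z = ∑ v ∈ Z, u v)
    (hWt : ein E s t W + rz r W = ∑ v ∈ W, u v)
    (hZn : Z.Nonempty)
    (hj : (Z ∩ W).Nonempty ∨ ∃ e ∈ E, (s e ∈ Z ∧ t e ∈ W) ∨ (s e ∈ W ∧ t e ∈ Z)) :
    ein E s t (Z ∪ W) + rz r (Z ∪ W) = ∑ v ∈ Z ∪ W, u v := by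
  classical
  have hun := hu (Z ∪ W) (Finset.union_subset hZ hW) (hZn.mono subset_union_left)
  have hmod : ∑ v ∈ Z ∪ W, u v + ∑ v ∈ Z ∩ W, u v = ∑ v ∈ Z, u v + ∑ v ∈ W, u v :=
    Finset.sum_union_inter
  have hrr : rz r (Z ∪ W) + rz r (Z ∩ W) = rz r Z + rz r W := by
    unfold rz; simp only [mem_union, mem_inter]
    by_cases h1 : r ∈ Z <;> by_cases h2 : r ∈ W <;> simp [h1, h2]
  set A := E.filter fun e => s e ∈ Z ∧ t e ∈ Z with hA
  set B := E.filter fun e => s e ∈ W ∧ t e ∈ W with hB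
  have hAB : (A ∪ B).card + (A ∩ B).card = A.card + B.card := Finset.card_union_add_card_inter A B
  have hsub : A ∪ B ⊆ E.filter fun e => s e ∈ Z ∪ W ∧ t e ∈ Z ∪ W := by
    intro e he
    simp only [hA, hB, mem_union, mem_filter] at he ⊢
    tauto
  have hinter : A ∩ B = E.filter fun e => s e ∈ Z ∩ W ∧ t e ∈ Z ∩ W := by
    ext e
    simp only [hA, hB, mem_inter, mem_filter]
    tauto
  have hc1 := Finset.card_le_card hsub
  by_cases hinter' : (Z ∩ W).Nonempty
  · have h1 := hu (Z ∩ W) (Finset.inter_subset_left.trans hZ) hinter'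
    have hZ2 : A.card + rz r Z = ∑ v ∈ Z, u v := hZt
    have hW2 : B.card + rz r W = ∑ v ∈ W, u v := hWt
    have h12 : (A ∩ B).card + rz r (Z ∩ W) ≤ ∑ v ∈ Z ∩ W, u v := by
      rw [hinter]; exact h1
    unfold ein at hun ⊢
    omega
  · rcases hj with h | ⟨e, heE, he⟩
    · exact absurd h hinter'
    have hemp : Z ∩ W = ∅ := Finset.not_nonempty_iff_eq_empty.1 hinter'
    have hdis : ∀ x, x ∈ Z → x ∈ W → False := fun x h1 h2 => by
      have : x ∈ Z ∩ W := mem_inter.2 ⟨h1, h2⟩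
      rw [hemp] at this; simp at this
    have hlt : (A ∪ B).card < (E.filter fun e => s e ∈ Z ∪ W ∧ t e ∈ Z ∪ W).card := by
      apply Finset.card_lt_card
      refine ⟨hsub, fun hcon => ?_⟩
      have : e ∈ A ∪ B := hcon (by
        simp only [mem_filter, mem_union]; refine ⟨heE, ?_⟩; tauto)
      simp only [hA, hB, mem_union, mem_filter] at this
      rcases he with he | he <;> rcases this with h | h
      · exact hdis _ h.2.2 he.2
      · exact hdis _ he.1 h.2.1
      · exact hdis _ h.2.1 he.1
      · exact hdis _ he.2 h.2.2
    have hABe : (A ∩ B).card = 0 := by rw [hinter, hemp]; simp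
    have hr0 : rz r (Z ∩ W) = 1 := by rw [hemp]; simp [rz]
    rw [hemp] at hmod
    simp only [sum_empty] at hmod
    have hZ2 : A.card + rz r Z = ∑ v ∈ Z, u v := hZt
    have hW2 : B.card + rz r W = ∑ v ∈ W, u v := hWt
    unfold ein at hun ⊢
    omega

lemma orient_ub (X : Finset ℕ) (E : Finset ε) (s t : ε → ℕ) (r : ℕ)
    (hr : r ∈ X) (hE : ∀ e ∈ E, s e ∈ X ∧ t e ∈ X) (hconn : Conn X E s t) :
    ∀ (N : ℕ) (u : ℕ → ℕ), ∑ v ∈ X, u v = N →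
    (∀ Z ⊆ X, Z.Nonempty → ein E s t Z + rz r Z ≤ ∑ v ∈ Z, u v) →
    ∃ u' : ℕ → ℕ, (∀ v, u' v ≤ u v) ∧
      (∀ Z ⊆ X, Z.Nonempty → ein E s t Z + rz r Z ≤ ∑ v ∈ Z, u' v) ∧
      ∑ v ∈ X, u' v = E.card := by
  classical
  have hXE : ein E s t X = E.card := by
    unfold ein; congr 1; exact Finset.filter_true_of_mem fun e he => hE e he
  have hXr : rz r X = 0 := by simp [rz, hr]
  intro N
  induction N with
  | zero =>
    intro u hN hu
    refine ⟨u, fun _ => le_rfl, hu, ?_⟩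
    have := hu X subset_rfl ⟨r, hr⟩
    omega
  | succ N ih =>
    intro u hN hu
    by_cases hsum : ∑ v ∈ X, u v = E.card
    · exact ⟨u, fun _ => le_rfl, hu, hsum⟩
    by_cases hex : ∃ v ∈ X, 0 < u v ∧
        ∀ Z ⊆ X, Z.Nonempty → ein E s t Z + rz r Z ≤ ∑ w ∈ Z, (if w = v then u w - 1 else u w)
    · obtain ⟨v, hv, hpos, hZ⟩ := hex
      have hdec : ∑ w ∈ X, (if w = v then u w - 1 else u w) = N := by
        have h1 := Finset.add_sum_erase X u hv
        have h2 := Finset.add_sum_erase X (fun w => if w = v then u w - 1 else u w) hv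
        have h3 : ∑ w ∈ X.erase v, (if w = v then u w - 1 else u w) = ∑ w ∈ X.erase v, u w :=
          Finset.sum_congr rfl fun w hw => by simp [Finset.ne_of_mem_erase hw]
        simp only [if_true] at h2
        omega
      obtain ⟨u', h1, h2, h3⟩ := ih _ hdec hZ
      exact ⟨u', fun w => (h1 w).trans (by split_ifs <;> omega), h2, h3⟩
    · exfalso
      push Not at hex
      have htight : ∀ v ∈ X, ∃ Z ⊆ X, v ∈ Z ∧ ein E s t Z + rz r Z = ∑ w ∈ Z, u w := by
        intro v hv
        rcases Nat.eq_zero_or_pos (u v) with h0 | hpos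
        · refine ⟨{v}, by simpa using hv, by simp, ?_⟩
          have := hu {v} (by simpa using hv) (by simp)
          simp only [sum_singleton] at this ⊢
          omega
        · obtain ⟨Z, hZX, hZn, hlt⟩ := hex v hv hpos
          have h0 := hu Z hZX hZn
          have hvZ : v ∈ Z := by
            by_contra hvZ
            have : ∑ w ∈ Z, (if w = v then u w - 1 else u w) = ∑ w ∈ Z, u w :=
              Finset.sum_congr rfl fun w hw => by
                have : w ≠ v := fun h => hvZ (h ▸ hw)
                simp [this]
            omega
          refine ⟨Z, hZX, hvZ, ?_⟩
          have h1 := Finset.add_sum_erase Z u hvZ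
          have h2 := Finset.add_sum_erase Z (fun w => if w = v then u w - 1 else u w) hvZ
          have h3 : ∑ w ∈ Z.erase v, (if w = v then u w - 1 else u w) = ∑ w ∈ Z.erase v, u w :=
            Finset.sum_congr rfl fun w hw => by simp [Finset.ne_of_mem_erase hw]
          simp only [if_true] at h2
          omega
      let fam := X.powerset.filter fun Z => Z.Nonempty ∧ ein E s t Z + rz r Z = ∑ w ∈ Z, u w
      have hfn : fam.Nonempty := by
        obtain ⟨Z, h1, h2, h3⟩ := htight r hr
        exact ⟨Z, by simp only [fam, mem_filter, mem_powerset]; exact ⟨h1, ⟨r, h2⟩, h3⟩⟩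
      obtain ⟨Z, hZf, hmax⟩ := Finset.exists_max_image fam Finset.card hfn
      simp only [fam, mem_filter, mem_powerset] at hZf hmax
      obtain ⟨hZX, hZn, hZt⟩ := hZf
      by_cases hZeq : Z = X
      · subst hZeq; omega
      · obtain ⟨e, heE, he⟩ := hconn Z hZX hZn hZeq
        have : ∃ y ∈ X, y ∉ Z ∧ ((s e ∈ Z ∧ t e = y) ∨ (s e = y ∧ t e ∈ Z)) := by
          rcases he with h | h
          · exact ⟨t e, (hE e heE).2, h.2, Or.inl ⟨h.1, rfl⟩⟩
          · exact ⟨s e, (hE e heE).1, h.1, Or.inr ⟨rfl, h.2⟩⟩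
        obtain ⟨y, hyX, hyZ, hy⟩ := this
        obtain ⟨W, hWX, hyW, hWt⟩ := htight y hyX
        have hU := tight_union E s t r u X Z W hu hZX hWX hZt hWt hZn (Or.inr ⟨e, heE, by
          rcases hy with ⟨a, b⟩ | ⟨a, b⟩
          · exact Or.inl ⟨a, b ▸ hyW⟩
          · exact Or.inr ⟨a ▸ hyW, b⟩⟩)
        have hle := hmax (Z ∪ W) ⟨union_subset hZX hWX, hZn.mono subset_union_left, hU⟩
        have hlt : Z.card < (Z ∪ W).card := Finset.card_lt_card
          ⟨subset_union_left, fun h => hyZ (h (mem_union_right _ hyW))⟩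
        omega
end OT

namespace OT
open Finset

variable {ε : Type}

def eIn (E : Finset ε) (s t : ε → ℕ) (p : ℕ → ℕ) (c : ℕ) : ℕ :=
  (E.filter fun e => p (s e) = c ∧ p (t e) = c).card

def tot (X : Finset ℕ) (τ : ℕ → ℕ) (p : ℕ → ℕ) (c : ℕ) : ℕ :=
  ∑ v ∈ X.filter (fun v => p v = c), τ v

def rho (r : ℕ) (p : ℕ → ℕ) (c : ℕ) : ℕ := if p r = c then 0 else 1

def need (X : Finset ℕ) (E : Finset ε) (s t : ε → ℕ) (τ : ℕ → ℕ) (r : ℕ) (p : ℕ → ℕ) (c : ℕ) : ℕ :=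
  rho r p c + (eIn E s t p c + tot X τ p c + rho r p c) % 2

def cross (E : Finset ε) (s t : ε → ℕ) (p : ℕ → ℕ) : ℕ :=
  (E.filter fun e => p (s e) ≠ p (t e)).card

def SN (X : Finset ℕ) (E : Finset ε) (s t : ε → ℕ) (τ : ℕ → ℕ) (r : ℕ) (p : ℕ → ℕ) : ℕ :=
  ∑ c ∈ X.image p, need X E s t τ r p c

def Cond (X : Finset ℕ) (E : Finset ε) (s t : ε → ℕ) (τ : ℕ → ℕ) (r d : ℕ) : Prop :=
  ∀ p : ℕ → ℕ, SN X E s t τ r p ≤ cross E s t p + d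

def Good (X : Finset ℕ) (E : Finset ε) (s t : ε → ℕ) (τ : ℕ → ℕ) (r d : ℕ) : Prop :=
  ∃ hd tl : ε → ℕ, ∃ rk : ℕ → ℕ,
    (∀ e ∈ E, (hd e = s e ∧ tl e = t e) ∨ (hd e = t e ∧ tl e = s e)) ∧
    (∀ v ∈ X, v ≠ r → ∃ e ∈ E, hd e = v ∧ rk (tl e) < rk v) ∧
    (X.filter fun v => (E.filter fun e => hd e = v).card % 2 ≠ τ v % 2).card ≤ d

lemma sum_eIn (X : Finset ℕ) (E : Finset ε) (s t : ε → ℕ) (hE : ∀ e ∈ E, s e ∈ X ∧ t e ∈ X)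
    (p : ℕ → ℕ) : ∑ c ∈ X.image p, eIn E s t p c + cross E s t p = E.card := by
  classical
  have h1 : (E.filter fun e => p (s e) = p (t e)).card = ∑ c ∈ X.image p, eIn E s t p c := by
    rw [Finset.card_eq_sum_card_fiberwise (f := fun e => p (s e)) (t := X.image p)]
    · apply Finset.sum_congr rfl
      intro c _
      unfold eIn
      congr 1
      ext e
      simp only [mem_filter]
      constructor
      · rintro ⟨⟨a, b⟩, c⟩; exact ⟨a, c, b ▸ c⟩
      · rintro ⟨a, b, c⟩; exact ⟨⟨a, b.trans c.symm⟩, b⟩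
    · intro e he
      have := (mem_filter.1 (mem_coe.1 he)).1
      exact mem_coe.2 (mem_image_of_mem p (hE e this).1)
  rw [← h1]
  exact Finset.card_filter_add_card_filter_not _

lemma sum_tot (X : Finset ℕ) (τ p : ℕ → ℕ) : ∑ c ∈ X.image p, tot X τ p c = ∑ v ∈ X, τ v := by
  unfold tot
  exact Finset.sum_fiberwise_of_maps_to (fun v hv => mem_image_of_mem p hv) _

lemma parity (X : Finset ℕ) (E : Finset ε) (s t : ε → ℕ) (hE : ∀ e ∈ E, s e ∈ X ∧ t e ∈ X)
    (τ : ℕ → ℕ) (r : ℕ) (p : ℕ → ℕ) :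
    (SN X E s t τ r p + cross E s t p) % 2 = (E.card + ∑ v ∈ X, τ v) % 2 := by
  have h1 : (SN X E s t τ r p) % 2 = (∑ c ∈ X.image p, (eIn E s t p c + tot X τ p c)) % 2 := by
    unfold SN
    rw [Finset.sum_nat_mod, Finset.sum_nat_mod (X.image p) 2 fun c => (eIn E s t p c + tot X τ p c)]
    congr 1
    apply Finset.sum_congr rfl
    intro c _
    unfold need
    omega
  rw [Finset.sum_add_distrib, sum_tot] at h1
  have h2 := sum_eIn X E s t hE p
  omega

lemma need_congr (X : Finset ℕ) (E : Finset ε) (s t : ε → ℕ) (hE : ∀ e ∈ E, s e ∈ X ∧ t e ∈ X)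
    (τ : ℕ → ℕ) (r : ℕ) (hr : r ∈ X) (p q : ℕ → ℕ) (c c' : ℕ)
    (h : ∀ x ∈ X, p x = c ↔ q x = c') :
    need X E s t τ r p c = need X E s t τ r q c' := by
  have h1 : eIn E s t p c = eIn E s t q c' := by
    unfold eIn; congr 1
    apply Finset.filter_congr
    intro e he
    rw [h _ (hE e he).1, h _ (hE e he).2]
  have h2 : tot X τ p c = tot X τ q c' := by
    unfold tot
    congr 1
    apply Finset.filter_congr
    intro x hx
    rw [h _ hx]
  have h3 : rho r p c = rho r q c' := by
    unfold rho; simp only [h r hr]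
  unfold need
  rw [h1, h2, h3]

lemma caseA (X : Finset ℕ) (E : Finset ε) (s t : ε → ℕ) (hE : ∀ e ∈ E, s e ∈ X ∧ t e ∈ X)
    (τ : ℕ → ℕ) (r : ℕ) (hr : r ∈ X) (hconn : Conn X E s t) (d : ℕ)
    (hC : Cond X E s t τ r d) (p : ℕ → ℕ) (hinj : Set.InjOn p X)
    (heq : SN X E s t τ r p = cross E s t p + d) : Good X E s t τ r d := by
  classical
  have hid : SN X E s t τ r id = cross E s t id + d := by
    have h1 : SN X E s t τ r p = SN X E s t τ r id := by
      unfold SN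
      rw [Finset.sum_image hinj, Finset.sum_image (by simp)]
      apply Finset.sum_congr rfl
      intro v hv
      apply need_congr X E s t hE τ r hr p id
      intro x hx
      exact ⟨fun h => hinj hx hv h, fun h => by rw [show x = v from h]⟩
    have h2 : cross E s t p = cross E s t id := by
      unfold cross
      congr 1
      apply Finset.filter_congr
      intro e he
      exact not_congr ⟨fun h => hinj (hE e he).1 (hE e he).2 h, fun h => by
        rw [show s e = t e from h]⟩
    rw [← h1, ← h2, heq]
  set nd := fun v => need X E s t τ r id v with hnd
  have hsn : SN X E s t τ r id = ∑ v ∈ X, nd v := by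
    unfold SN; rw [Finset.image_id]
  have hse := sum_eIn X E s t hE id
  rw [Finset.image_id] at hse
  set u := fun v => nd v + eIn E s t id v with hu
  have hus : ∑ v ∈ X, u v = E.card + d := by
    simp only [hu, Finset.sum_add_distrib]
    omega
  have hub : ∀ Z ⊆ X, Z.Nonempty → ein E s t Z + rz r Z ≤ ∑ v ∈ Z, u v := by
    intro Z hZ hZn
    obtain ⟨z, hz⟩ := hZn
    set q : ℕ → ℕ := fun x => if x ∈ Z then z else x with hq
    have hqz : ∀ x, q x = z ↔ x ∈ Z := by
      intro x
      by_cases hx : x ∈ Z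
      · simp [hq, hx]
      · simp only [hq, hx, if_false, iff_false]
        rintro rfl; exact hx hz
    have hqo : ∀ y, y ∉ Z → ∀ x, q x = y ↔ x = y := by
      intro y hy x
      by_cases hx : x ∈ Z
      · simp only [hq, hx, if_true]
        exact ⟨fun h => absurd (h ▸ hz) hy, fun h => absurd (h ▸ hx) hy⟩
      · simp [hq, hx]
    have himg : X.image q = insert z (X \ Z) := by
      ext y
      simp only [mem_image, mem_insert, mem_sdiff]
      constructor
      · rintro ⟨x, hx, rfl⟩
        by_cases hxZ : x ∈ Z
        · left; exact (hqz x).2 hxZ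
        · right; rw [(hqo x hxZ x).2 rfl]; exact ⟨hx, hxZ⟩
      · rintro (rfl | ⟨h1, h2⟩)
        · exact ⟨y, hZ hz, (hqz y).2 hz⟩
        · exact ⟨y, h1, (hqo y h2 y).2 rfl⟩
    have hSN : SN X E s t τ r q = need X E s t τ r q z + ∑ v ∈ X \ Z, nd v := by
      unfold SN
      rw [himg, Finset.sum_insert (by simp [hz])]
      congr 1
      apply Finset.sum_congr rfl
      intro v hv
      exact need_congr X E s t hE τ r hr q id v v fun x _ => hqo v (mem_sdiff.1 hv).2 x
    have hrz : rz r Z ≤ need X E s t τ r q z := by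
      unfold need rho rz
      simp only [hqz]
      omega
    have hsd : ∑ v ∈ X \ Z, nd v + ∑ v ∈ Z, nd v = ∑ v ∈ X, nd v := Finset.sum_sdiff hZ
    -- edges
    have hcr : cross E s t q + (E.filter fun e => (s e ∈ Z ∧ t e ∈ Z) ∧ s e ≠ t e).card
        = cross E s t id := by
      unfold cross
      rw [← Finset.card_union_of_disjoint]
      · congr 1
        ext e
        simp only [mem_union, mem_filter, id]
        constructor
        · rintro (⟨a, b⟩ | ⟨a, b, c⟩)
          · exact ⟨a, fun h => b (by rw [h])⟩
          · exact ⟨a, c⟩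
        · rintro ⟨a, b⟩
          by_cases h1 : s e ∈ Z <;> by_cases h2 : t e ∈ Z
          · right; exact ⟨a, ⟨h1, h2⟩, b⟩
          · left; refine ⟨a, ?_⟩; rw [(hqz _).2 h1]; exact fun h => h2 ((hqz _).1 h.symm)
          · left; refine ⟨a, ?_⟩; rw [(hqz _).2 h2]; exact fun h => h1 ((hqz _).1 h)
          · left; refine ⟨a, ?_⟩; simpa [hq, h1, h2] using b
      · rw [Finset.disjoint_left]
        intro e h1 h2
        simp only [mem_filter] at h1 h2
        exact h1.2 (by rw [(hqz _).2 h2.2.1.1, (hqz _).2 h2.2.1.2])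
    have hei : ein E s t Z = (E.filter fun e => (s e ∈ Z ∧ t e ∈ Z) ∧ s e ≠ t e).card
        + ∑ v ∈ Z, eIn E s t id v := by
      unfold ein
      rw [← Finset.card_filter_add_card_filter_not (s := E.filter fun e => s e ∈ Z ∧ t e ∈ Z)
        (fun e => s e ≠ t e), Finset.filter_filter]
      congr 1
      rw [Finset.card_eq_sum_card_fiberwise (f := s) (t := Z)]
      · apply Finset.sum_congr rfl
        intro v hv
        unfold eIn
        congr 1
        ext e
        simp only [mem_filter, not_not, id]
        constructor
        · rintro ⟨⟨⟨a, _⟩, b⟩, c⟩; exact ⟨a, c, b ▸ c⟩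
        · rintro ⟨a, b, c⟩; exact ⟨⟨⟨a, b ▸ hv, c ▸ hv⟩, b.trans c.symm⟩, b⟩
      · intro e he
        have := mem_filter.1 (mem_coe.1 he)
        exact mem_coe.2 (mem_filter.1 this.1).2.1
    have hCq := hC q
    have hsu : ∑ v ∈ Z, u v = ∑ v ∈ Z, nd v + ∑ v ∈ Z, eIn E s t id v := by
      simp only [hu, Finset.sum_add_distrib]
    omega
  obtain ⟨u', hle, hub', hs'⟩ := orient_ub X E s t r hr hE hconn _ u rfl hub
  obtain ⟨hd, tl, rk, h1, h2, h3⟩ := orient_exact X E s t r u' hr hE hub' hs'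
  refine ⟨hd, tl, rk, h1, h2, ?_⟩
  have h4 : (X.filter fun v => (E.filter fun e => hd e = v).card % 2 ≠ τ v % 2).card
      ≤ ∑ v ∈ X, (u v - u' v) := by
    rw [Finset.card_filter]
    apply Finset.sum_le_sum
    intro v hv
    split_ifs with hne
    · rw [h3 v hv] at hne
      have h5 : u v % 2 = τ v % 2 := by
        simp only [hu, hnd, need]
        have : tot X τ id v = τ v := by
          unfold tot
          have : X.filter (fun w => id w = v) = {v} := by
            ext x; simp only [mem_filter, mem_singleton, id]
            exact ⟨fun h => h.2, fun h => ⟨h ▸ hv, h⟩⟩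
          rw [this, Finset.sum_singleton]
        rw [this]
        omega
      have h6 := hle v
      have : u' v ≠ u v := fun h => hne (by rw [h, h5])
      omega
    · omega
  have h5 : ∑ v ∈ X, (u v - u' v) + ∑ v ∈ X, u' v = ∑ v ∈ X, u v := by
    rw [← Finset.sum_add_distrib]
    exact Finset.sum_congr rfl fun v _ => Nat.sub_add_cancel (hle v)
  omega

end OT

namespace OT
open Finset

variable {ε : Type}

lemma conn_of_cond0 (X : Finset ℕ) (E : Finset ε) (s t : ε → ℕ)
    (τ : ℕ → ℕ) (r : ℕ) (hC : Cond X E s t τ r 0) : Conn X E s t := by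
  classical
  intro Z hZ hZn hne
  have h1 := hC (fun x => if x ∈ Z then 1 else 0)
  obtain ⟨z, hz⟩ := hZn
  obtain ⟨y, hyX, hyZ⟩ : ∃ y ∈ X, y ∉ Z := by
    by_contra h
    push Not at h
    exact hne (Finset.Subset.antisymm hZ h)
  have h2 : 0 < SN X E s t τ r (fun x => if x ∈ Z then 1 else 0) := by
    unfold SN
    by_cases hr : r ∈ Z
    · apply Finset.sum_pos'
      · intros; omega
      · refine ⟨0, mem_image.2 ⟨y, hyX, by simp [hyZ]⟩, ?_⟩
        unfold need rho; simp [hr]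
    · apply Finset.sum_pos'
      · intros; omega
      · refine ⟨1, mem_image.2 ⟨z, hZ hz, by simp [hz]⟩, ?_⟩
        unfold need rho; simp [hr]
  have h3 : 0 < cross E s t (fun x => if x ∈ Z then 1 else 0) := by omega
  obtain ⟨e, he⟩ := Finset.card_pos.1 h3
  have he' := mem_filter.1 he
  refine ⟨e, he'.1, ?_⟩
  by_cases h4 : s e ∈ Z <;> by_cases h5 : t e ∈ Z <;> simp_all

lemma part_cond (X : Finset ℕ) (E : Finset ε) (s t : ε → ℕ) (hE : ∀ e ∈ E, s e ∈ X ∧ t e ∈ X)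
    (τ : ℕ → ℕ) (r : ℕ) (hr : r ∈ X) (d : ℕ)
    (p : ℕ → ℕ) (heq : SN X E s t τ r p = cross E s t p + d)
    (hmax : ∀ q : ℕ → ℕ, (X.image p).card < (X.image q).card →
      SN X E s t τ r q + 2 ≤ cross E s t q + d)
    (c : ℕ) (hc : c ∈ X.image p) (en : ℕ → ℕ) (fl : ℕ) (rc : ℕ) (hrc : rc ∈ X) (hprc : p rc = c)
    (hroot : c = p r → rc = r) (hen : c ≠ p r → 1 ≤ en rc)
    (hneed : need X E s t τ r p c = ∑ v ∈ X.filter (fun v => p v = c), en v + fl)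
    (hpar : (eIn E s t p c + tot X τ p c + ∑ v ∈ X.filter (fun v => p v = c), en v + fl) % 2 = 0) :
    Cond (X.filter fun v => p v = c) (E.filter fun e => p (s e) = c ∧ p (t e) = c) s t
      (fun v => τ v + en v + if v = rc then fl else 0) rc 0 := by
  classical
  intro q
  set Xc := X.filter fun v => p v = c with hXc
  set Ec := E.filter fun e => p (s e) = c ∧ p (t e) = c with hEc
  set τ' := fun v => τ v + en v + if v = rc then fl else 0 with hτ'
  have hrcX : rc ∈ Xc := mem_filter.2 ⟨hrc, hprc⟩
  have hEcX : ∀ e ∈ Ec, s e ∈ Xc ∧ t e ∈ Xc := by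
    intro e he
    have := mem_filter.1 he
    exact ⟨mem_filter.2 ⟨(hE e this.1).1, this.2.1⟩, mem_filter.2 ⟨(hE e this.1).2, this.2.2⟩⟩
  have htot : ∀ k, tot Xc τ' q k = tot Xc τ q k + ∑ v ∈ Xc.filter (fun v => q v = k), en v +
      if q rc = k then fl else 0 := by
    intro k
    unfold tot
    simp only [hτ', Finset.sum_add_distrib]
    congr 1
    rw [Finset.sum_ite_eq']
    simp [hrcX]
  have hensum : ∑ k ∈ Xc.image q, ∑ v ∈ Xc.filter (fun v => q v = k), en v = ∑ v ∈ Xc, en v :=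
    Finset.sum_fiberwise_of_maps_to (fun v hv => mem_image_of_mem q hv) _
  by_cases hconst : (Xc.image q).card ≤ 1
  · have himg : Xc.image q = {q rc} := by
      symm
      apply Finset.eq_of_subset_of_card_le
      · simpa using ⟨rc, hrcX, rfl⟩
      · simpa using hconst
    have hall : ∀ v ∈ Xc, q v = q rc := by
      intro v hv
      have : q v ∈ Xc.image q := mem_image_of_mem q hv
      rw [himg] at this; simpa using this
    have h0 : SN Xc Ec s t τ' rc q = 0 := by
      unfold SN
      rw [himg, Finset.sum_singleton]
      unfold need
      rw [htot]
      have hf : Xc.filter (fun v => q v = q rc) = Xc := Finset.filter_true_of_mem hall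
      have h1 : eIn Ec s t q (q rc) = eIn E s t p c := by
        unfold eIn
        rw [Finset.filter_true_of_mem]
        intro e he
        exact ⟨hall _ (hEcX e he).1, hall _ (hEcX e he).2⟩
      have h2 : tot Xc τ q (q rc) = tot X τ p c := by
        unfold tot
        rw [hf]
      rw [h1, h2, hf]
      simp only [rho, if_true]
      omega
    omega
  · push Not at hconst
    set P : ℕ → ℕ := fun v => Nat.pair (p v) (if p v = c then q v else 0) with hP
    have hPc : ∀ v k, P v = Nat.pair c k ↔ p v = c ∧ q v = k := by
      intro v k
      simp only [hP, Nat.pair_eq_pair]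
      constructor
      · rintro ⟨h1, h2⟩; simp only [h1, if_true] at h2; exact ⟨h1, h2⟩
      · rintro ⟨h1, h2⟩; simp [h1, h2]
    have hPo : ∀ v c', c' ≠ c → (P v = Nat.pair c' 0 ↔ p v = c') := by
      intro v c' hcc
      simp only [hP, Nat.pair_eq_pair]
      constructor
      · exact fun h => h.1
      · intro h; rw [h]; simp [hcc]
    have himg : X.image P = ((X.image p).erase c).image (fun c' => Nat.pair c' 0) ∪
        (Xc.image q).image (fun k => Nat.pair c k) := by
      ext y
      simp only [mem_union, mem_image, mem_erase]
      constructor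
      · rintro ⟨v, hv, rfl⟩
        by_cases h : p v = c
        · right
          exact ⟨q v, ⟨v, mem_filter.2 ⟨hv, h⟩, rfl⟩, ((hPc v (q v)).2 ⟨h, rfl⟩).symm⟩
        · left
          exact ⟨p v, ⟨h, v, hv, rfl⟩, ((hPo v (p v) h).2 rfl).symm⟩
      · rintro (⟨c', ⟨h1, v, hv, rfl⟩, rfl⟩ | ⟨k, ⟨v, hv, rfl⟩, rfl⟩)
        · exact ⟨v, hv, (hPo v _ h1).2 rfl⟩
        · have := mem_filter.1 hv
          exact ⟨v, this.1, (hPc v _).2 ⟨this.2, rfl⟩⟩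
    have hdisj : Disjoint (((X.image p).erase c).image (fun c' => Nat.pair c' 0))
        ((Xc.image q).image (fun k => Nat.pair c k)) := by
      rw [Finset.disjoint_left]
      intro y h1 h2
      obtain ⟨c', h3, h4⟩ := mem_image.1 h1
      obtain ⟨k, h5, h6⟩ := mem_image.1 h2
      rw [← h4] at h6
      exact (mem_erase.1 h3).1 (Nat.pair_eq_pair.1 h6).1.symm
    have hi1 : Set.InjOn (fun c' => Nat.pair c' 0) (((X.image p).erase c : Finset ℕ) : Set ℕ) :=
      fun a _ b _ h => (Nat.pair_eq_pair.1 h).1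
    have hi2 : Set.InjOn (fun k => Nat.pair c k) ((Xc.image q : Finset ℕ) : Set ℕ) :=
      fun a _ b _ h => (Nat.pair_eq_pair.1 h).2
    have hcard : (X.image p).card < (X.image P).card := by
      rw [himg, Finset.card_union_of_disjoint hdisj, Finset.card_image_of_injOn hi1,
        Finset.card_image_of_injOn hi2, Finset.card_erase_of_mem hc]
      have := Finset.card_pos.2 ⟨c, hc⟩
      omega
    have hm := hmax P hcard
    have hSNP : SN X E s t τ r P = ∑ c' ∈ (X.image p).erase c, need X E s t τ r p c' +
        ∑ k ∈ Xc.image q, need X E s t τ r P (Nat.pair c k) := by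
      unfold SN
      rw [himg, Finset.sum_union hdisj, Finset.sum_image hi1, Finset.sum_image hi2]
      congr 1
      apply Finset.sum_congr rfl
      intro c' hc'
      exact need_congr X E s t hE τ r hr P p _ _ fun x _ => hPo x c' (mem_erase.1 hc').1
    have hSNp : need X E s t τ r p c + ∑ c' ∈ (X.image p).erase c, need X E s t τ r p c'
        = SN X E s t τ r p := Finset.add_sum_erase _ _ hc
    have hcrP : cross E s t P = cross E s t p + cross Ec s t q := by
      unfold cross
      rw [← Finset.card_union_of_disjoint]
      · congr 1
        ext e
        simp only [mem_union, mem_filter, hEc]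
        constructor
        · rintro ⟨a, b⟩
          by_cases h : p (s e) = p (t e)
          · right
            by_cases h2 : p (s e) = c
            · refine ⟨⟨a, h2, h ▸ h2⟩, fun h3 => b ?_⟩
              rw [(hPc (s e) (q (s e))).2 ⟨h2, rfl⟩, (hPc (t e) (q (s e))).2 ⟨h ▸ h2, h3.symm⟩]
            · exfalso; apply b
              simp only [hP, ← h, h2, if_false]
          · left; exact ⟨a, h⟩
        · rintro (⟨a, b⟩ | ⟨⟨a, b, b'⟩, c'⟩)
          · refine ⟨a, fun h => b ?_⟩
            simp only [hP, Nat.pair_eq_pair] at h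
            exact h.1
          · refine ⟨a, fun h => c' ?_⟩
            simp only [hP, Nat.pair_eq_pair, b, b', if_true] at h
            exact h.2
      · rw [Finset.disjoint_left]
        intro e h1 h2
        have h3 := (mem_filter.1 (mem_filter.1 h2).1).2
        exact (mem_filter.1 h1).2 (h3.1.trans h3.2.symm)
    -- relation between needs
    have hnq : ∀ k, need X E s t τ r P (Nat.pair c k) =
        (if p r = c ∧ q r = k then 0 else 1) +
        (eIn Ec s t q k + tot Xc τ q k + (if p r = c ∧ q r = k then 0 else 1)) % 2 := by
      intro k
      have h1 : eIn E s t P (Nat.pair c k) = eIn Ec s t q k := by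
        unfold eIn
        rw [hEc, Finset.filter_filter]
        congr 1
        apply Finset.filter_congr
        intro e _
        rw [hPc, hPc]; tauto
      have h2 : tot X τ P (Nat.pair c k) = tot Xc τ q k := by
        unfold tot
        rw [hXc, Finset.filter_filter]
        congr 1
        apply Finset.filter_congr
        intro e _
        rw [hPc]
      have h3 : rho r P (Nat.pair c k) = if p r = c ∧ q r = k then 0 else 1 := by
        unfold rho; simp only [hPc]
      unfold need
      rw [h1, h2, h3]
    have hkey : SN Xc Ec s t τ' rc q + 2 * rho r p c ≤
        ∑ k ∈ Xc.image q, need X E s t τ r P (Nat.pair c k) + need X E s t τ r p c := by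
      rw [hneed, ← hensum]
      have e1 : fl = ∑ k ∈ Xc.image q, if q rc = k then fl else 0 := by
        rw [Finset.sum_ite_eq, if_pos (mem_image_of_mem q hrcX)]
      have e2 : 2 * rho r p c = ∑ k ∈ Xc.image q, if q rc = k then 2 * rho r p c else 0 := by
        rw [Finset.sum_ite_eq, if_pos (mem_image_of_mem q hrcX)]
      rw [e1, e2]
      unfold SN
      simp only [← Finset.sum_add_distrib]
      apply Finset.sum_le_sum
      intro k _
      rw [hnq k]
      unfold need
      rw [htot k]
      by_cases hcr : c = p r
      · have := hroot hcr
        subst this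
        simp only [rho, hcr, true_and, if_true]
        split_ifs <;> omega
      · have h1 := hen hcr
        have h2 : ¬ (p r = c ∧ q r = k) := fun h => hcr h.1.symm
        have h3 : rho r p c = 1 := by unfold rho; rw [if_neg]; exact fun h => hcr h.symm
        rw [if_neg h2, h3]
        unfold rho
        by_cases hk : q rc = k
        · have h4 : 1 ≤ ∑ v ∈ Xc.filter (fun v => q v = k), en v :=
            h1.trans (Finset.single_le_sum (f := en) (fun _ _ => Nat.zero_le _)
              (mem_filter.2 ⟨hrcX, hk⟩))
          simp only [hk, if_true]
          omega
        · simp only [hk, if_false]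
          omega
    have hnc : need X E s t τ r p c ≤ 1 + rho r p c := by unfold need; omega
    omega

end OT

namespace OT
open Finset

variable {ε : Type}

lemma caseB (X : Finset ℕ) (E : Finset ε) (s t : ε → ℕ) (hE : ∀ e ∈ E, s e ∈ X ∧ t e ∈ X)
    (τ : ℕ → ℕ) (r : ℕ) (hr : r ∈ X) (d : ℕ)
    (p : ℕ → ℕ) (heq : SN X E s t τ r p = cross E s t p + d)
    (hmax : ∀ q : ℕ → ℕ, (X.image p).card < (X.image q).card →
      SN X E s t τ r q + 2 ≤ cross E s t q + d)
    (hIc : Good (X.image p) E (fun e => p (s e)) (fun e => p (t e)) (tot X τ p) (p r) d)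
    (hIp : ∀ c ∈ X.image p, ∀ (τ' : ℕ → ℕ) (rc : ℕ), rc ∈ X.filter (fun v => p v = c) →
      Cond (X.filter fun v => p v = c) (E.filter fun e => p (s e) = c ∧ p (t e) = c) s t τ' rc 0 →
      Good (X.filter fun v => p v = c) (E.filter fun e => p (s e) = c ∧ p (t e) = c) s t τ' rc 0) :
    Good X E s t τ r d := by
  classical
  obtain ⟨hd', tl', rk', hor'', hrk', hfl'⟩ := hIc
  have hor' : ∀ e ∈ E, (hd' e = p (s e) ∧ tl' e = p (t e)) ∨ (hd' e = p (t e) ∧ tl' e = p (s e)) :=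
    hor''
  set fl : ℕ → ℕ := fun c =>
    if (E.filter fun e => hd' e = c).card % 2 ≠ tot X τ p c % 2 then 1 else 0 with hfl
  have hflsum : ∑ c ∈ X.image p, fl c ≤ d := by
    rw [hfl, ← Finset.card_filter]; exact hfl'
  set hdv : ε → ℕ := fun e => if hd' e = p (s e) then s e else t e with hhdv
  set tlv : ε → ℕ := fun e => if hd' e = p (s e) then t e else s e with htlv
  have hv1 : ∀ e ∈ E, p (hdv e) = hd' e ∧ p (tlv e) = tl' e := by
    intro e he
    rcases hor' e he with ⟨h1, h2⟩ | ⟨h1, h2⟩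
    · simp only [hhdv, htlv, h1, h2, if_true, and_self]
    · by_cases h : hd' e = p (s e)
      · simp only [hhdv, htlv, h, if_true, true_and]
        rw [h2, ← h, h1]
      · simp only [hhdv, htlv, h, if_false]
        exact ⟨h1.symm, h2.symm⟩
  have hv2 : ∀ e, (hdv e = s e ∧ tlv e = t e) ∨ (hdv e = t e ∧ tlv e = s e) := by
    intro e
    by_cases h : hd' e = p (s e)
    · left; simp [hhdv, htlv, h]
    · right; simp [hhdv, htlv, h]
  set cr := E.filter fun e => p (s e) ≠ p (t e) with hcr
  set en : ℕ → ℕ := fun v => (cr.filter fun e => hdv e = v).card with hen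
  have hhdX : ∀ e ∈ E, hdv e ∈ X := by
    intro e he
    rcases hv2 e with h | h
    · rw [h.1]; exact (hE e he).1
    · rw [h.1]; exact (hE e he).2
  have hm : ∀ c, ∑ v ∈ X.filter (fun v => p v = c), en v = (cr.filter fun e => hd' e = c).card := by
    intro c
    symm
    rw [Finset.card_eq_sum_card_fiberwise (f := hdv) (t := X.filter fun v => p v = c)]
    · apply Finset.sum_congr rfl
      intro v hv
      simp only [hen]
      congr 1
      ext e
      simp only [mem_filter]
      constructor
      · rintro ⟨⟨a, _⟩, b⟩; exact ⟨a, b⟩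
      · rintro ⟨a, b⟩
        refine ⟨⟨a, ?_⟩, b⟩
        rw [← (hv1 e (mem_filter.1 a).1).1, b]; exact (mem_filter.1 hv).2
    · intro e he
      have h1 := mem_filter.1 (mem_coe.1 he)
      have h2 := (mem_filter.1 h1.1).1
      exact mem_coe.2 (mem_filter.2 ⟨hhdX e h2, (hv1 e h2).1.trans h1.2⟩)
  have hindeg : ∀ c, (E.filter fun e => hd' e = c).card =
      eIn E s t p c + ∑ v ∈ X.filter (fun v => p v = c), en v := by
    intro c
    rw [hm]
    unfold eIn
    rw [← Finset.card_union_of_disjoint]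
    · congr 1
      ext e
      simp only [mem_union, mem_filter, hcr]
      constructor
      · rintro ⟨a, b⟩
        by_cases h : p (s e) = p (t e)
        · left
          rcases hor' e a with h1 | h1
          · rw [h1.1] at b; exact ⟨a, b, h ▸ b⟩
          · rw [h1.1] at b; exact ⟨a, h.trans b, b⟩
        · right; exact ⟨⟨a, h⟩, b⟩
      · rintro (⟨a, b, b'⟩ | ⟨⟨a, _⟩, b⟩)
        · refine ⟨a, ?_⟩
          rcases hor' e a with h1 | h1
          · rw [h1.1]; exact b
          · rw [h1.1]; exact b'
        · exact ⟨a, b⟩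
    · rw [Finset.disjoint_left]
      intro e h1 h2
      have h3 := (mem_filter.1 h1).2
      exact (mem_filter.1 (mem_filter.1 h2).1).2 (h3.1.trans h3.2.symm)
  -- entering edges
  have hex : ∀ c ∈ X.image p, c ≠ p r → ∃ e ∈ cr, hd' e = c ∧ rk' (tl' e) < rk' c := by
    intro c hc hcr'
    obtain ⟨e, he, h1, h2⟩ := hrk' c hc hcr'
    refine ⟨e, mem_filter.2 ⟨he, fun h => ?_⟩, h1, h2⟩
    have : tl' e = hd' e := by
      rcases hor' e he with h3 | h3
      · rw [h3.1, h3.2, h]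
      · rw [h3.1, h3.2, h]
    rw [this, h1] at h2
    omega
  have hle : ∀ c ∈ X.image p, need X E s t τ r p c ≤
      ∑ v ∈ X.filter (fun v => p v = c), en v + fl c := by
    intro c hc
    have h1 := hindeg c
    have hge : rho r p c ≤ ∑ v ∈ X.filter (fun v => p v = c), en v := by
      by_cases h : p r = c
      · simp [rho, h]
      · rw [hm]
        simp only [rho, h, if_false]
        obtain ⟨e, he, h2, _⟩ := hex c hc (Ne.symm h)
        exact Finset.card_pos.2 ⟨e, mem_filter.2 ⟨he, h2⟩⟩
    have hr1 : rho r p c ≤ 1 := by unfold rho; split_ifs <;> omega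
    simp only [hfl]
    unfold need
    split_ifs with h
    · omega
    · omega
  have hsumm : ∑ c ∈ X.image p, ∑ v ∈ X.filter (fun v => p v = c), en v = cross E s t p := by
    unfold cross
    rw [Finset.sum_congr rfl fun c _ => hm c]
    symm
    apply Finset.card_eq_sum_card_fiberwise
    intro e he
    have := (mem_filter.1 (mem_coe.1 he)).1
    rw [← (hv1 e this).1]
    exact mem_coe.2 (mem_image_of_mem p (hhdX e this))
  have hneedeq : ∀ c ∈ X.image p, need X E s t τ r p c =
      ∑ v ∈ X.filter (fun v => p v = c), en v + fl c := by
    apply (Finset.sum_eq_sum_iff_of_le hle).1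
    apply le_antisymm (Finset.sum_le_sum hle)
    rw [Finset.sum_add_distrib, hsumm]
    unfold SN at heq
    omega
  have hparts : ∀ c, ∃ rc : ℕ, ∃ hdc tlc : ε → ℕ, ∃ rkc : ℕ → ℕ, c ∈ X.image p →
      (rc ∈ X ∧ p rc = c ∧ (c = p r → rc = r) ∧
      (c ≠ p r → ∃ e ∈ cr, hdv e = rc ∧ rk' (p (tlv e)) < rk' c) ∧
      (∀ e ∈ E, p (s e) = c → p (t e) = c →
        (hdc e = s e ∧ tlc e = t e) ∨ (hdc e = t e ∧ tlc e = s e)) ∧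
      (∀ v ∈ X, p v = c → v ≠ rc → ∃ e ∈ E, p (s e) = c ∧ p (t e) = c ∧ hdc e = v ∧
        rkc (tlc e) < rkc v) ∧
      (∀ v ∈ X, p v = c →
        ((E.filter fun e => p (s e) = c ∧ p (t e) = c).filter fun e => hdc e = v).card % 2
          = (τ v + en v + if v = rc then fl c else 0) % 2)) := by
    intro c
    by_cases hc : c ∈ X.image p
    swap
    · exact ⟨0, s, s, id, fun h => absurd h hc⟩
    have : ∃ rc, rc ∈ X ∧ p rc = c ∧ (c = p r → rc = r) ∧
        (c ≠ p r → ∃ e ∈ cr, hdv e = rc ∧ rk' (p (tlv e)) < rk' c) := by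
      by_cases h : c = p r
      · exact ⟨r, hr, h.symm, fun _ => rfl, fun h' => absurd h h'⟩
      · obtain ⟨e, he, h1, h2⟩ := hex c hc h
        have heE := (mem_filter.1 he).1
        refine ⟨hdv e, hhdX e heE, (hv1 e heE).1.trans h1, fun h' => absurd h' h, fun _ =>
          ⟨e, he, rfl, ?_⟩⟩
        rw [(hv1 e heE).2]; exact h2
    obtain ⟨rc, h1, h2, h3, h4⟩ := this
    have hcond := part_cond X E s t hE τ r hr d p heq hmax c hc en (fl c) rc h1 h2 h3 (by
      intro h
      obtain ⟨e, he, h5, _⟩ := h4 h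
      exact Finset.card_pos.2 ⟨e, mem_filter.2 ⟨he, h5⟩⟩) (hneedeq c hc) (by
      have h1 := hindeg c
      simp only [hfl]
      split_ifs with h
      · omega
      · omega)
    obtain ⟨hdc, tlc, rkc, g1, g2, g3⟩ := hIp c hc _ rc (mem_filter.2 ⟨h1, h2⟩) hcond
    refine ⟨rc, hdc, tlc, rkc, fun _ => ⟨h1, h2, h3, h4, ?_, ?_, ?_⟩⟩
    · intro e he a b
      exact g1 e (mem_filter.2 ⟨he, a, b⟩)
    · intro v hv hpv hne
      obtain ⟨e, he, a, b⟩ := g2 v (mem_filter.2 ⟨hv, hpv⟩) hne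
      have := mem_filter.1 he
      exact ⟨e, this.1, this.2.1, this.2.2, a, b⟩
    · intro v hv hpv
      have hz := Finset.card_eq_zero.1 (Nat.le_zero.1 g3)
      exact not_not.1 (Finset.filter_eq_empty_iff.1 hz (mem_filter.2 ⟨hv, hpv⟩))
  choose rc hdc tlc rkc hpart using hparts
  set M := ∑ v ∈ X, rkc (p v) v + 1 with hM
  have hMlt : ∀ v ∈ X, rkc (p v) v < M := by
    intro v hv
    have := Finset.single_le_sum (f := fun v => rkc (p v) v) (fun _ _ => Nat.zero_le _) hv
    omega
  set hd : ε → ℕ := fun e => if p (s e) = p (t e) then hdc (p (s e)) e else hdv e with hhd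
  set tl : ε → ℕ := fun e => if p (s e) = p (t e) then tlc (p (s e)) e else tlv e with htl
  have hor : ∀ e ∈ E, (hd e = s e ∧ tl e = t e) ∨ (hd e = t e ∧ tl e = s e) := by
    intro e he
    by_cases h : p (s e) = p (t e)
    · simp only [hhd, htl, if_pos h]
      exact (hpart (p (s e)) (mem_image_of_mem p (hE e he).1)).2.2.2.2.1 e he rfl h.symm
    · simp only [hhd, htl, if_neg h]
      exact hv2 e
  refine ⟨hd, tl, fun v => rk' (p v) * M + rkc (p v) v, hor, ?_, ?_⟩
  · intro v hv hvr
    obtain ⟨h1, h2, h3, h4, h5, h6, h7⟩ := hpart (p v) (mem_image_of_mem p hv)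
    by_cases hvc : v = rc (p v)
    · have hne : p v ≠ p r := fun h => hvr (hvc.trans (h3 h))
      obtain ⟨e, he, g1, g2⟩ := h4 hne
      have he' := mem_filter.1 he
      refine ⟨e, he'.1, ?_, ?_⟩
      · simp only [hhd, if_neg he'.2]; rw [g1]; exact hvc.symm
      · have htle : tl e = tlv e := by simp only [htl, if_neg he'.2]
        have htX : tlv e ∈ X := by
          rcases hv2 e with h | h
          · rw [h.2]; exact (hE e he'.1).2
          · rw [h.2]; exact (hE e he'.1).1
        simp only [htle]
        have := hMlt _ htX
        have h8 : (rk' (p (tlv e)) + 1) * M ≤ rk' (p v) * M := Nat.mul_le_mul_right _ g2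
        rw [Nat.add_mul, Nat.one_mul] at h8
        omega
    · obtain ⟨e, he, g1, g2, g3, g4⟩ := h6 v hv rfl hvc
      have hst : p (s e) = p (t e) := g1.trans g2.symm
      have htle : tl e = tlc (p v) e := by simp only [htl, if_pos hst, g1]
      refine ⟨e, he, ?_, ?_⟩
      · simp only [hhd, if_pos hst, g1]; exact g3
      · have hpt : p (tl e) = p v := by
          rcases hor e he with h | h
          · rw [h.2, g2]
          · rw [h.2, g1]
        simp only [hpt]
        rw [htle]
        omega
  · have hbad : ∀ v ∈ X, (E.filter fun e => hd e = v).card % 2 ≠ τ v % 2 →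
        v = rc (p v) ∧ fl (p v) = 1 := by
      intro v hv hne
      obtain ⟨h1, h2, h3, h4, h5, h6, h7⟩ := hpart (p v) (mem_image_of_mem p hv)
      have h8 := h7 v hv rfl
      clear h4 h5 h6 h7
      have h9 : (E.filter fun e => hd e = v).card =
          ((E.filter fun e => p (s e) = p v ∧ p (t e) = p v).filter
            fun e => hdc (p v) e = v).card + en v := by
        simp only [hen]
        rw [← Finset.card_union_of_disjoint]
        · congr 1
          ext e
          simp only [mem_union, mem_filter, hcr]
          constructor
          · rintro ⟨a, b⟩
            by_cases h : p (s e) = p (t e)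
            · left
              have hpse : p (s e) = p v := by
                rcases hor e a with g | g
                · rw [← b, g.1]
                · rw [← b, g.1, h]
              simp only [hhd, if_pos h, hpse] at b
              exact ⟨⟨a, hpse, h ▸ hpse⟩, b⟩
            · right
              simp only [hhd, if_neg h] at b
              exact ⟨⟨a, h⟩, b⟩
          · rintro (⟨⟨a, b, b'⟩, c⟩ | ⟨⟨a, b⟩, c⟩)
            · refine ⟨a, ?_⟩
              simp only [hhd, b, b', if_true]; exact c
            · refine ⟨a, ?_⟩
              simp only [hhd, if_neg b]; exact c
        · rw [Finset.disjoint_left]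
          intro e h1 h2
          have h3 := (mem_filter.1 (mem_filter.1 h1).1).2
          exact (mem_filter.1 (mem_filter.1 h2).1).2 (h3.1.trans h3.2.symm)
      rw [h9] at hne
      by_cases hvc : v = rc (p v)
      · refine ⟨hvc, ?_⟩
        rw [if_pos hvc] at h8
        by_contra hf
        have : fl (p v) = 0 := by
          simp only [hfl] at hf ⊢
          split_ifs at hf ⊢ with h
          · exact absurd rfl hf
          · rfl
        omega
      · rw [if_neg hvc] at h8
        omega
    calc _ ≤ ((X.image p).filter fun c => (E.filter fun e => hd' e = c).card % 2 ≠ tot X τ p c % 2).card := by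
            apply Finset.card_le_card_of_injOn p
            · intro v hv
              have hv' := mem_filter.1 (mem_coe.1 hv)
              have := hbad v hv'.1 hv'.2
              apply mem_coe.2
              refine mem_filter.2 ⟨mem_image_of_mem p hv'.1, ?_⟩
              by_contra hcon
              have h2 : fl (p v) = 0 := by
                simp only [hfl]; rw [if_neg (not_not.2 hcon)]
              omega
            · intro v hv w hw hvw
              have hv' := mem_filter.1 (mem_coe.1 hv)
              have hw' := mem_filter.1 (mem_coe.1 hw)
              rw [(hbad v hv'.1 hv'.2).1, (hbad w hw'.1 hw'.2).1, hvw]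
      _ ≤ d := hfl'

end OT

namespace OT
open Finset

variable {ε : Type}

lemma const_SN (X : Finset ℕ) (E : Finset ε) (s t : ε → ℕ) (hE : ∀ e ∈ E, s e ∈ X ∧ t e ∈ X)
    (τ : ℕ → ℕ) (r : ℕ) (hr : r ∈ X) (p : ℕ → ℕ) (hp : (X.image p).card ≤ 1) :
    SN X E s t τ r p = (E.card + ∑ v ∈ X, τ v) % 2 ∧ cross E s t p = 0 := by
  have himg : X.image p = {p r} := by
    symm
    apply Finset.eq_of_subset_of_card_le
    · simpa using ⟨r, hr, rfl⟩
    · simpa using hp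
  have hall : ∀ v ∈ X, p v = p r := by
    intro v hv
    have : p v ∈ X.image p := mem_image_of_mem p hv
    rw [himg] at this; simpa using this
  have hcr : cross E s t p = 0 := by
    unfold cross
    rw [Finset.card_eq_zero, Finset.filter_eq_empty_iff]
    intro e he h
    exact h ((hall _ (hE e he).1).trans (hall _ (hE e he).2).symm)
  have h1 := sum_eIn X E s t hE p
  have h2 := sum_tot X τ p
  rw [himg, Finset.sum_singleton] at h1 h2
  refine ⟨?_, hcr⟩
  unfold SN
  rw [himg, Finset.sum_singleton]
  unfold need rho
  simp only [if_true]
  omega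

lemma card_image_zero (X : Finset ℕ) : (X.image fun _ => 0).card ≤ 1 := by
  have : (X.image fun _ => 0) ⊆ {0} := by
    intro x hx
    obtain ⟨_, _, rfl⟩ := mem_image.1 hx
    simp
  simpa using Finset.card_le_card this

lemma tot_bump (X : Finset ℕ) (τ p : ℕ → ℕ) (w : ℕ) (hw : w ∈ X) (c : ℕ) :
    tot X (fun v => τ v + if v = w then 1 else 0) p c = tot X τ p c + if p w = c then 1 else 0 := by
  unfold tot
  rw [Finset.sum_add_distrib, Finset.sum_ite_eq']
  simp [hw]

lemma sum_bump (X : Finset ℕ) (τ : ℕ → ℕ) (w : ℕ) (hw : w ∈ X) :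
    ∑ v ∈ X, (τ v + if v = w then 1 else 0) = ∑ v ∈ X, τ v + 1 := by
  rw [Finset.sum_add_distrib, Finset.sum_ite_eq', if_pos hw]

lemma SN_bump (X : Finset ℕ) (E E' : Finset ε) (s t : ε → ℕ) (τ τ' : ℕ → ℕ) (r w : ℕ)
    (p : ℕ → ℕ)
    (h : ∀ c, need X E' s t τ' r p c ≤ need X E s t τ r p c + if p w = c then 1 else 0) :
    SN X E' s t τ' r p ≤ SN X E s t τ r p + 1 := by
  unfold SN
  calc _ ≤ ∑ c ∈ X.image p, (need X E s t τ r p c + if p w = c then 1 else 0) :=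
        Finset.sum_le_sum fun c _ => h c
    _ ≤ _ := by
      rw [Finset.sum_add_distrib, Finset.sum_ite_eq]
      split_ifs <;> omega

lemma SN_contract (X : Finset ℕ) (E : Finset ε) (s t : ε → ℕ) (τ : ℕ → ℕ) (r : ℕ) (p q : ℕ → ℕ) :
    SN (X.image p) E (fun e => p (s e)) (fun e => p (t e)) (tot X τ p) (p r) q =
    SN X E s t τ r (fun x => q (p x)) := by
  unfold SN
  rw [Finset.image_image]
  apply Finset.sum_congr rfl
  intro k _
  have : tot (X.image p) (tot X τ p) q k = tot X τ (fun x => q (p x)) k := by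
    unfold tot
    rw [← Finset.sum_fiberwise_of_maps_to (s := X.filter fun v => q (p v) = k)
      (t := (X.image p).filter fun c => q c = k) (g := p)]
    · apply Finset.sum_congr rfl
      intro c hc
      congr 1
      ext v
      simp only [mem_filter]
      constructor
      · rintro ⟨a, b⟩; exact ⟨⟨a, by rw [b]; exact (mem_filter.1 hc).2⟩, b⟩
      · rintro ⟨⟨a, _⟩, b⟩; exact ⟨a, b⟩
    · intro v hv
      have := mem_filter.1 hv
      exact mem_filter.2 ⟨mem_image_of_mem p this.1, this.2⟩
  unfold need
  rw [this]
  rfl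

theorem main (N : ℕ) : ∀ (X : Finset ℕ) (E : Finset ε) (s t : ε → ℕ) (τ : ℕ → ℕ) (r d : ℕ),
    X.card + E.card + d ≤ N → (∀ e ∈ E, s e ∈ X ∧ t e ∈ X) → r ∈ X → Conn X E s t →
    Cond X E s t τ r d → Good X E s t τ r d := by
  classical
  induction N with
  | zero =>
    intro X E s t τ r d hN _ hr
    have := Finset.card_pos.2 ⟨r, hr⟩
    omega
  | succ N ih =>
    intro X E s t τ r d hN hE hr hconn hC
    by_cases hA : ∃ p : ℕ → ℕ, Set.InjOn p X ∧ SN X E s t τ r p = cross E s t p + d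
    · obtain ⟨p, h1, h2⟩ := hA
      exact caseA X E s t hE τ r hr hconn d hC p h1 h2
    have hcardle : ∀ p : ℕ → ℕ, (X.image p).card ≤ X.card := fun p => Finset.card_image_le
    have hA' : ∀ p : ℕ → ℕ, (X.image p).card = X.card → SN X E s t τ r p ≠ cross E s t p + d := by
      intro p h1 h2
      exact hA ⟨p, Finset.card_image_iff.1 h1, h2⟩
    by_cases hB : ∃ p : ℕ → ℕ, 2 ≤ (X.image p).card ∧ SN X E s t τ r p = cross E s t p + d
    · obtain ⟨p, hp, hmin⟩ := WellFounded.has_min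
        (measure fun p : ℕ → ℕ => X.card - (X.image p).card).wf
        {p : ℕ → ℕ | 2 ≤ (X.image p).card ∧ SN X E s t τ r p = cross E s t p + d} hB
      obtain ⟨hp2, heq⟩ : 2 ≤ (X.image p).card ∧ SN X E s t τ r p = cross E s t p + d := hp
      have hplt : (X.image p).card < X.card := lt_of_le_of_ne (hcardle p) fun h => hA' p h heq
      apply caseB X E s t hE τ r hr d p heq
      · intro q hq
        have h1 := hC q
        have h2 : SN X E s t τ r q ≠ cross E s t q + d := by
          intro h3
          apply hmin q ⟨by omega, h3⟩
          show X.card - (X.image q).card < X.card - (X.image p).card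
          omega
        have h3 := parity X E s t hE τ r p
        have h4 := parity X E s t hE τ r q
        omega
      · apply ih
        · omega
        · intro e he
          exact ⟨mem_image_of_mem p (hE e he).1, mem_image_of_mem p (hE e he).2⟩
        · exact mem_image_of_mem p hr
        · intro Z hZ hZn hne
          have hmem : ∀ x ∈ X, x ∈ X.filter (fun v => p v ∈ Z) ↔ p x ∈ Z := by
            intro x hx; simp [hx]
          obtain ⟨e, he, h⟩ := hconn (X.filter fun v => p v ∈ Z) (Finset.filter_subset _ _) (by
            obtain ⟨z, hz⟩ := hZn
            obtain ⟨x, hx, rfl⟩ := mem_image.1 (hZ hz)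
            exact ⟨x, mem_filter.2 ⟨hx, hz⟩⟩) (by
            intro h
            apply hne
            apply Finset.Subset.antisymm hZ
            intro c hc
            obtain ⟨x, hx, rfl⟩ := mem_image.1 hc
            rw [← h] at hx
            exact (mem_filter.1 hx).2)
          refine ⟨e, he, ?_⟩
          rw [hmem _ (hE e he).1, hmem _ (hE e he).2] at h
          exact h
        · intro q
          rw [SN_contract]
          exact hC _
      · intro c hc τ' rc hrc hcond
        apply ih
        · have h1 : (X.filter fun v => p v = c).card < X.card := by
            apply Finset.card_lt_card
            refine ⟨Finset.filter_subset _ _, fun h => ?_⟩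
            have : X.image p ⊆ {c} := by
              intro y hy
              obtain ⟨x, hx, rfl⟩ := mem_image.1 hy
              simpa using (mem_filter.1 (h hx)).2
            have := Finset.card_le_card this
            simp at this
            omega
          have h2 : (E.filter fun e => p (s e) = c ∧ p (t e) = c).card ≤ E.card :=
            Finset.card_filter_le _ _
          omega
        · intro e he
          have := mem_filter.1 he
          exact ⟨mem_filter.2 ⟨(hE e this.1).1, this.2.1⟩, mem_filter.2 ⟨(hE e this.1).2, this.2.2⟩⟩
        · exact hrc
        · exact conn_of_cond0 _ _ _ _ _ _ hcond
        · exact hcond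
    have hB' : ∀ p : ℕ → ℕ, 2 ≤ (X.image p).card → SN X E s t τ r p + 1 ≤ cross E s t p + d := by
      intro p h1
      have h2 := hC p
      have h3 : SN X E s t τ r p ≠ cross E s t p + d := fun h => hB ⟨p, h1, h⟩
      omega
    rcases Nat.eq_zero_or_pos d with rfl | hd
    · -- d = 0
      have hX2 : X ≠ {r} := by
        intro h
        apply hA' id (by simp)
        have h1 := const_SN X E s t hE τ r hr id (by rw [h]; simp)
        have h2 := hC id
        omega
      obtain ⟨e0, he0, hcut⟩ := hconn {r} (by simpa using hr) (by simp) (Ne.symm hX2)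
      have hloop : s e0 ≠ t e0 := by
        intro h; rw [h] at hcut; tauto
      set w := t e0 with hw
      have hwX : w ∈ X := (hE e0 he0).2
      have hEc : (E.erase e0).card + 1 = E.card := Finset.card_erase_add_one he0
      have hE' : ∀ e ∈ E.erase e0, s e ∈ X ∧ t e ∈ X := fun e he => hE e (Finset.mem_of_mem_erase he)
      have hcond : Cond X (E.erase e0) s t (fun v => τ v + if v = w then 1 else 0) r 0 := by
        intro p
        by_cases hp : (X.image p).card ≤ 1
        · have h1 := const_SN X E s t hE τ r hr p hp
          have h2 := const_SN X (E.erase e0) s t hE' (fun v => τ v + if v = w then 1 else 0) r hr p hp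
          have h3 := hC p
          rw [sum_bump X τ w hwX] at h2
          omega
        · have h1 := hB' p (by omega)
          have h2 := parity X E s t hE τ r p
          have h2' := parity X E s t hE τ r (fun _ => 0)
          have h2'' := const_SN X E s t hE τ r hr (fun _ => 0) (card_image_zero X)
          have h2c := hC (fun _ => 0)
          have hcr : cross E s t p ≤ cross (E.erase e0) s t p + 1 := by
            unfold cross
            rw [Finset.filter_erase]
            have := Finset.pred_card_le_card_erase (s := E.filter fun e => p (s e) ≠ p (t e)) (a := e0)
            omega
          have hSN := SN_bump X E (E.erase e0) s t τ (fun v => τ v + if v = w then 1 else 0) r w p (by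
            intro c
            unfold need
            rw [tot_bump X τ p w hwX]
            have : eIn (E.erase e0) s t p c + (if p (s e0) = c ∧ p w = c then 1 else 0)
                = eIn E s t p c := by
              unfold eIn
              rw [Finset.filter_erase]
              split_ifs with h
              · exact Finset.card_erase_add_one (mem_filter.2 ⟨he0, h⟩)
              · rw [Finset.erase_eq_of_notMem]
                · omega
                · exact fun h' => h (mem_filter.1 h').2
            have hrr : rho r p c ≤ 1 := by unfold rho; split_ifs <;> omega
            by_cases h1 : p w = c
            · by_cases h2 : p (s e0) = c
              · simp only [h1, h2, and_self, if_true] at this ⊢; omega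
              · simp only [h1, h2, false_and, if_true, if_false] at this ⊢; omega
            · simp only [h1, and_false, if_false] at this ⊢; omega)
          omega
      obtain ⟨hd', tl', rk, g1, g2, g3⟩ := ih X (E.erase e0) s t _ r 0 (by omega) hE' hr
        (conn_of_cond0 _ _ _ _ _ _ hcond) hcond
      refine ⟨fun e => if e = e0 then t e0 else hd' e, fun e => if e = e0 then s e0 else tl' e, rk,
        ?_, ?_, ?_⟩
      · intro e he
        by_cases h : e = e0
        · subst h; right; simp
        · simp only [h, if_false]; exact g1 e (mem_erase.2 ⟨h, he⟩)
      · intro v hv hvr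
        obtain ⟨e, he, h1, h2⟩ := g2 v hv hvr
        have := mem_erase.1 he
        exact ⟨e, this.2, by simpa [this.1] using h1, by simpa [this.1] using h2⟩
      · rw [Nat.le_zero, Finset.card_eq_zero, Finset.filter_eq_empty_iff] at g3 ⊢
        intro v hv
        have h1 : _ = (τ v + if v = w then 1 else 0) % 2 := not_not.1 (g3 hv)
        have h2 : (E.filter fun e => (if e = e0 then t e0 else hd' e) = v).card =
            ((E.erase e0).filter fun e => hd' e = v).card + if v = w then 1 else 0 := by
          conv_lhs => rw [← Finset.insert_erase he0]
          rw [Finset.filter_insert]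
          have h3 : (E.erase e0).filter (fun e => (if e = e0 then t e0 else hd' e) = v) =
              (E.erase e0).filter fun e => hd' e = v := by
            apply Finset.filter_congr
            intro e he
            simp [(mem_erase.1 he).1]
          rw [h3]
          simp only [if_true]
          by_cases h4 : v = w
          · rw [if_pos (by rw [h4]), if_pos h4, Finset.card_insert_of_notMem]
            simp
          · rw [if_neg (fun h => h4 h.symm), if_neg h4, Nat.add_zero]
        rw [not_not, h2]
        omega
    · set q0 : ℕ → ℕ := fun _ => 0 with hq0
      have hq0c : (X.image q0).card ≤ 1 := card_image_zero X
      have hq := const_SN X E s t hE τ r hr q0 hq0c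
      by_cases hc : SN X E s t τ r q0 = cross E s t q0 + d
      · have hd1 : d = 1 := by omega
        subst hd1
        have hcond : Cond X E s t (fun v => τ v + if v = r then 1 else 0) r 0 := by
          intro p
          by_cases hp : (X.image p).card ≤ 1
          · have h2 := const_SN X E s t hE (fun v => τ v + if v = r then 1 else 0) r hr p hp
            rw [sum_bump X τ r hr] at h2
            omega
          · have h1 := hB' p (by omega)
            have h2 := parity X E s t hE τ r p
            have h3 := parity X E s t hE τ r q0
            have hSN := SN_bump X E E s t τ (fun v => τ v + if v = r then 1 else 0) r r p (by
              intro c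
              unfold need
              rw [tot_bump X τ p r hr]
              omega)
            omega
        obtain ⟨hd', tl', rk, g1, g2, g3⟩ := ih X E s t _ r 0 (by omega) hE hr hconn hcond
        refine ⟨hd', tl', rk, g1, g2, ?_⟩
        rw [Nat.le_zero, Finset.card_eq_zero, Finset.filter_eq_empty_iff] at g3
        calc _ ≤ ({r} : Finset ℕ).card := by
              apply Finset.card_le_card
              intro v hv
              have hv' := mem_filter.1 hv
              rw [mem_singleton]
              by_contra hvr
              have := not_not.1 (g3 hv'.1)
              simp only [hvr, if_false] at this
              exact hv'.2 this
          _ = 1 := by simp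
      · have hcond : Cond X E s t τ r (d - 1) := by
          intro p
          by_cases hp : (X.image p).card ≤ 1
          · have h2 := const_SN X E s t hE τ r hr p hp
            have := hC p
            omega
          · have := hB' p (by omega)
            omega
        obtain ⟨hd', tl', rk, g1, g2, g3⟩ := ih X E s t _ r (d - 1) (by omega) hE hr hconn hcond
        exact ⟨hd', tl', rk, g1, g2, by omega⟩

end OT

open SimpleGraph

namespace OT
open Finset

variable {ε : Type}

lemma conn_contract (X : Finset ℕ) (E : Finset ε) (s t : ε → ℕ) (hE : ∀ e ∈ E, s e ∈ X ∧ t e ∈ X)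
    (hconn : Conn X E s t) (p : ℕ → ℕ) :
    Conn (X.image p) E (fun e => p (s e)) (fun e => p (t e)) := by
  classical
  intro Z hZ hZn hne
  have hmem : ∀ x ∈ X, x ∈ X.filter (fun v => p v ∈ Z) ↔ p x ∈ Z := by
    intro x hx; simp [hx]
  obtain ⟨e, he, h⟩ := hconn (X.filter fun v => p v ∈ Z) (Finset.filter_subset _ _) (by
    obtain ⟨z, hz⟩ := hZn
    obtain ⟨x, hx, rfl⟩ := mem_image.1 (hZ hz)
    exact ⟨x, mem_filter.2 ⟨hx, hz⟩⟩) (by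
    intro h
    apply hne
    apply Finset.Subset.antisymm hZ
    intro c hc
    obtain ⟨x, hx, rfl⟩ := mem_image.1 hc
    rw [← h] at hx
    exact (mem_filter.1 hx).2)
  refine ⟨e, he, ?_⟩
  rw [hmem _ (hE e he).1, hmem _ (hE e he).2] at h
  exact h

lemma exists_cond (X : Finset ℕ) (E : Finset ε) (s t : ε → ℕ) (τ : ℕ → ℕ) (r : ℕ) :
    Cond X E s t τ r (2 * X.card) := by
  intro p
  have h1 : SN X E s t τ r p ≤ ∑ c ∈ X.image p, 2 := by
    unfold SN
    apply Finset.sum_le_sum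
    intro c _
    unfold need rho
    split_ifs <;> omega
  have h2 : (X.image p).card ≤ X.card := Finset.card_image_le
  rw [Finset.sum_const, smul_eq_mul] at h1
  omega

lemma cross_ge (X : Finset ℕ) (E : Finset ε) (s t : ε → ℕ) (hE : ∀ e ∈ E, s e ∈ X ∧ t e ∈ X)
    (r : ℕ) (hr : r ∈ X) (hconn : Conn X E s t) (p : ℕ → ℕ) :
    (X.image p).card ≤ cross E s t p + 1 := by
  classical
  obtain ⟨hd, tl, rk, h1, h2, _⟩ := main _ (X.image p) E (fun e => p (s e)) (fun e => p (t e))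
    (fun _ => 0) (p r) _ le_rfl
    (fun e he => ⟨mem_image_of_mem p (hE e he).1, mem_image_of_mem p (hE e he).2⟩)
    (mem_image_of_mem p hr) (conn_contract X E s t hE hconn p)
    (exists_cond _ _ _ _ _ _)
  have h3 : (X.image p).erase (p r) ⊆ (E.filter fun e => p (s e) ≠ p (t e)).image hd := by
    intro c hc
    have hc' := mem_erase.1 hc
    obtain ⟨e, he, h4, h5⟩ := h2 c hc'.2 hc'.1
    refine mem_image.2 ⟨e, mem_filter.2 ⟨he, fun h => ?_⟩, h4⟩
    have : tl e = hd e := by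
      rcases h1 e he with h6 | h6
      · rw [h6.1, h6.2]; exact h.symm
      · rw [h6.1, h6.2]; exact h
    rw [this, h4] at h5
    omega
  have h4 := Finset.card_le_card h3
  have h5 : ((E.filter fun e => p (s e) ≠ p (t e)).image hd).card ≤ cross E s t p :=
    Finset.card_image_le
  rw [Finset.card_erase_of_mem (mem_image_of_mem p hr)] at h4
  omega

lemma count_sym {V : Type} [Fintype V] (R : V → V → Prop) (hs : ∀ a b, R a b → R b a)
    (hi : ∀ a, ¬ R a a) (f : V → ℕ) (hf : Function.Injective f) [DecidableRel R] :
    (univ.filter fun x : V × V => R x.1 x.2).card =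
      2 * (univ.filter fun x : V × V => R x.1 x.2 ∧ f x.1 < f x.2).card := by
  classical
  rw [← Finset.card_filter_add_card_filter_not (s := univ.filter fun x : V × V => R x.1 x.2)
    (fun x => f x.1 < f x.2), Finset.filter_filter, Finset.filter_filter, two_mul]
  congr 1
  refine Finset.card_bij' (fun x _ => x.swap) (fun x _ => x.swap) ?_ ?_ ?_ ?_
  · rintro ⟨a, b⟩ h
    simp only [mem_filter, mem_univ, true_and, Prod.swap] at h ⊢
    refine ⟨hs _ _ h.1, ?_⟩
    have : f a ≠ f b := fun h' => by
      have := hf h'; subst this; exact hi _ h.1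
    omega
  · rintro ⟨a, b⟩ h
    simp only [mem_filter, mem_univ, true_and, Prod.swap] at h ⊢
    exact ⟨hs _ _ h.1, by omega⟩
  · intros; simp
  · intros; simp

lemma exists_minimal_nat {p : ℕ → Prop} (h : ∃ d, p d) : ∃ d, p d ∧ ∀ m < d, ¬ p m := by
  classical
  exact ⟨Nat.find h, Nat.find_spec h, fun m hm => Nat.find_min h hm⟩

theorem phi_bound {V : Type} [Fintype V] (G : SimpleGraph V) (hconn : G.Connected) :
    ∃ (P : V → ℕ) (ec : ℕ → ℕ) (cr : ℕ),
      (∀ c, {x : V × V | G.Adj x.1 x.2 ∧ P x.1 = c ∧ P x.2 = c}.ncard = 2 * ec c) ∧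
      {x : V × V | G.Adj x.1 x.2 ∧ P x.1 ≠ P x.2}.ncard = 2 * cr ∧
      (Finset.univ.image P).card ≤ cr + 1 ∧
      (∑ c ∈ Finset.univ.image P, ec c + cr = G.edgeSet.ncard) ∧
      2 * phi G + Fintype.card V + cr ≤ G.edgeSet.ncard + (Finset.univ.image P).card +
        ∑ c ∈ Finset.univ.image P, (ec c + {v | P v = c}.ncard + 1) % 2 := by
  classical
  obtain ⟨r0⟩ := hconn.nonempty
  set f : V → ℕ := fun v => (Fintype.equivFin V v : ℕ) with hf
  have hfi : Function.Injective f := fun a b h => (Fintype.equivFin V).injective (Fin.ext h)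
  set X : Finset ℕ := univ.image f with hX
  set E : Finset (V × V) := univ.filter fun x : V × V => G.Adj x.1 x.2 ∧ f x.1 < f x.2 with hEd
  set s : V × V → ℕ := fun x => f x.1 with hs
  set t : V × V → ℕ := fun x => f x.2 with ht
  set τ : ℕ → ℕ := fun x => if x = f r0 then 0 else 1 with hτ
  have hfX : ∀ v, f v ∈ X := fun v => mem_image_of_mem f (mem_univ v)
  have hE : ∀ e ∈ E, s e ∈ X ∧ t e ∈ X := fun e _ => ⟨hfX _, hfX _⟩
  have hEx : ∀ a b, G.Adj a b → ∃ e ∈ E, (s e = f a ∧ t e = f b) ∨ (s e = f b ∧ t e = f a) := by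
    intro a b hab
    have hne : f a ≠ f b := fun h => hab.ne (hfi h)
    rcases lt_or_gt_of_ne hne with h | h
    · exact ⟨(a, b), mem_filter.2 ⟨mem_univ _, hab, h⟩, Or.inl ⟨rfl, rfl⟩⟩
    · exact ⟨(b, a), mem_filter.2 ⟨mem_univ _, hab.symm, h⟩, Or.inr ⟨rfl, rfl⟩⟩
  have hC : Conn X E s t := by
    intro Z hZ hZn hne
    obtain ⟨z, hz⟩ := hZn
    obtain ⟨y, hyX, hyZ⟩ : ∃ y ∈ X, y ∉ Z := by
      by_contra h
      push Not at h
      exact hne (Finset.Subset.antisymm hZ h)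
    obtain ⟨a, _, rfl⟩ := mem_image.1 (hZ hz)
    obtain ⟨b, _, rfl⟩ := mem_image.1 hyX
    obtain ⟨w⟩ := hconn.preconnected a b
    obtain ⟨dd, _, h1, h2⟩ := w.exists_boundary_dart {v | f v ∈ Z} hz hyZ
    obtain ⟨e, he, h3⟩ := hEx _ _ dd.adj
    refine ⟨e, he, ?_⟩
    rcases h3 with h | h
    · left; rw [h.1, h.2]; exact ⟨h1, h2⟩
    · right; rw [h.1, h.2]; exact ⟨h2, h1⟩
  have hr : f r0 ∈ X := hfX r0
  have hex : ∃ d, Cond X E s t τ (f r0) d := ⟨_, exists_cond X E s t τ (f r0)⟩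
  obtain ⟨d, hd, p, hp⟩ : ∃ d, Cond X E s t τ (f r0) d ∧
      ∃ p : ℕ → ℕ, cross E s t p + d ≤ SN X E s t τ (f r0) p := by
    obtain ⟨d, hd, hmin⟩ := exists_minimal_nat hex
    refine ⟨d, hd, ?_⟩
    rcases Nat.eq_zero_or_pos d with h | h
    · rw [h]
      refine ⟨fun _ => 0, ?_⟩
      have := (const_SN X E s t hE τ (f r0) hr (fun _ => 0) (card_image_zero X)).2
      omega
    · have := hmin (d - 1) (by omega)
      unfold Cond at this
      push Not at this
      obtain ⟨p, hp⟩ := this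
      exact ⟨p, by omega⟩
  obtain ⟨hdd, tl, rk, g1, g2, g3⟩ := main _ X E s t τ (f r0) d le_rfl hE hr hC hd
  -- the feedback vertex set
  set ind : V → ℕ := fun v => (E.filter fun e => hdd e = f v).card with hind
  set S : Finset V := univ.filter fun v => (v ≠ r0 ∧ 2 ≤ ind v) ∨ (v = r0 ∧ 1 ≤ ind v) with hS
  have hacyc : (G.induce ((S : Set V)ᶜ)).IsAcyclic := by
    have hkey : ∀ w x : V, w ∉ S → x ∉ S → G.Adj w x → rk (f x) ≤ rk (f w) →
        ∃ e ∈ E, hdd e = f w ∧ ((s e = f w ∧ t e = f x) ∨ (s e = f x ∧ t e = f w)) := by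
      intro w x hw hx hadj hle
      obtain ⟨e, he, h1⟩ := hEx w x hadj
      refine ⟨e, he, ?_, h1⟩
      have h2 : (hdd e = f w ∧ tl e = f x) ∨ (hdd e = f x ∧ tl e = f w) := by
        rcases g1 e he with h3 | h3 <;> rcases h1 with h4 | h4 <;> rw [h3.1, h3.2, h4.1, h4.2] <;> simp
      rcases h2 with h2 | h2
      · exact h2.1
      exfalso
      have hpos : 1 ≤ ind x := Finset.card_pos.2 ⟨e, mem_filter.2 ⟨he, h2.1⟩⟩
      have hxr : x ≠ r0 := by
        intro h
        exact hx (mem_filter.2 ⟨mem_univ _, Or.inr ⟨h, hpos⟩⟩)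
      have hle1 : ind x ≤ 1 := by
        by_contra h
        exact hx (mem_filter.2 ⟨mem_univ _, Or.inl ⟨hxr, by omega⟩⟩)
      obtain ⟨e', he', h5, h6⟩ := g2 (f x) (hfX x) (fun h => hxr (hfi h))
      have : e = e' := Finset.card_le_one.1 hle1 e (mem_filter.2 ⟨he, h2.1⟩) e' (mem_filter.2 ⟨he', h5⟩)
      subst this
      rw [h2.2] at h6
      omega
    intro v c hc
    obtain ⟨w, hw, hmax⟩ := Finset.exists_max_image c.support.toFinset (fun x => rk (f x.1))
      ⟨v, by simp⟩
    have hw' : w ∈ c.support := by simpa using hw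
    have hc' : (c.rotate w hw').IsCycle := hc.rotate _
    have hmem : ∀ x, x ∈ (c.rotate w hw').support → rk (f x.1) ≤ rk (f w.1) := by
      intro x hx
      apply hmax
      simpa using hx
    have hnn := hc'.not_nil
    have ha1 := Walk.adj_snd hnn
    have ha2 := (Walk.adj_penultimate hnn).symm
    have hne := hc'.snd_ne_penultimate
    have hm1 := hmem _ (Walk.getVert_mem_support (c.rotate w hw') 1)
    have hm2 : rk (f (c.rotate w hw').penultimate.1) ≤ rk (f w.1) :=
      hmem _ (Walk.getVert_mem_support (c.rotate w hw') _)
    generalize (c.rotate w hw').penultimate = y at *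
    change rk (f (c.rotate w hw').snd.1) ≤ rk (f w.1) at hm1
    generalize (c.rotate w hw').snd = x at *
    have hwS : w.1 ∉ S := w.2
    obtain ⟨e1, he1, k1, k2⟩ := hkey w.1 x.1 hwS x.2 ha1 hm1
    obtain ⟨e2, he2, k3, k4⟩ := hkey w.1 y.1 hwS y.2 ha2 hm2
    have hee : e1 ≠ e2 := by
      rintro rfl
      have hxy : f x.1 ≠ f y.1 := fun h => hne (Subtype.ext (hfi h))
      have hwx : f w.1 ≠ f x.1 := fun h => ha1.ne (Subtype.ext (hfi h))
      have hwy : f w.1 ≠ f y.1 := fun h => ha2.ne (Subtype.ext (hfi h))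
      rcases k2 with k2 | k2 <;> rcases k4 with k4 | k4
      · exact hxy (k2.2.symm.trans k4.2)
      · exact hwy (k2.1.symm.trans k4.1)
      · exact hwx (k2.1.symm.trans k4.1).symm
      · exact hxy (k2.1.symm.trans k4.1)
    have h2 : 2 ≤ ind w.1 :=
      Finset.one_lt_card.2 ⟨e1, mem_filter.2 ⟨he1, k1⟩, e2, mem_filter.2 ⟨he2, k3⟩, hee⟩
    apply hwS
    refine mem_filter.2 ⟨mem_univ _, ?_⟩
    by_cases h : w.1 = r0
    · right; exact ⟨h, by omega⟩
    · left; exact ⟨h, h2⟩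
  have hphi : phi G ≤ S.card := Nat.sInf_le ⟨S, rfl, hacyc⟩
  -- counting
  have hcount : 2 * S.card + Fintype.card V ≤ E.card + d + 1 := by
    have h1 : ∑ v : V, ((2 * if v ∈ S then 1 else 0) + 1) ≤
        ∑ v : V, (ind v + (if ind v % 2 ≠ τ (f v) % 2 then 1 else 0) + if v = r0 then 1 else 0) := by
      apply Finset.sum_le_sum
      intro v _
      by_cases hv : v = r0
      · have : τ (f v) = 0 := by simp [hτ, hv]
        simp only [hS, mem_filter, mem_univ, true_and, hv, ne_eq, not_true, false_and, false_or]
        rw [hv] at this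
        rw [this]
        simp only [if_true]
        split_ifs <;> omega
      · have h2 : τ (f v) = 1 := by
          simp only [hτ]; rw [if_neg]; exact fun h => hv (hfi h)
        have h3 : 1 ≤ ind v := by
          obtain ⟨e, he, h4, _⟩ := g2 (f v) (hfX v) (fun h => hv (hfi h))
          exact Finset.card_pos.2 ⟨e, mem_filter.2 ⟨he, h4⟩⟩
        rw [h2]
        simp only [hS, mem_filter, mem_univ, true_and, hv, ne_eq, not_false_eq_true, false_and,
          or_false, if_false]
        split_ifs <;> omega
    have h2 : ∑ v : V, ind v = E.card := by
      have h3 : ∑ x ∈ X, (E.filter fun e => hdd e = x).card = E.card := by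
        symm
        apply Finset.card_eq_sum_card_fiberwise
        intro e he
        rcases g1 e he with h | h
        · rw [h.1]; exact (hE e he).1
        · rw [h.1]; exact (hE e he).2
      rw [← h3, hX, Finset.sum_image (fun a _ b _ h => hfi h)]
    have h3 : ∑ v : V, (if ind v % 2 ≠ τ (f v) % 2 then 1 else 0) ≤ d := by
      refine le_trans ?_ g3
      rw [hX, Finset.card_filter, Finset.sum_image (fun a _ b _ h => hfi h)]
    have h4 : ∑ v : V, (2 * if v ∈ S then 1 else 0) = 2 * S.card := by
      rw [← Finset.mul_sum]; simp
    rw [Finset.sum_add_distrib, Finset.sum_add_distrib, Finset.sum_add_distrib, h4, h2] at h1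
    simp only [Finset.sum_const, Finset.card_univ, smul_eq_mul, mul_one, Finset.sum_ite_eq',
      mem_univ, if_true] at h1
    omega
  have hEm : E.card = G.edgeSet.ncard := by
    have h1 := count_sym G.Adj (fun _ _ h => h.symm) (fun a => G.loopless.irrefl a) f hfi
    have h2 := G.sum_degrees_eq_twice_card_edges
    have h3 : (univ.filter fun x : V × V => G.Adj x.1 x.2).card = ∑ v, G.degree v := by
      rw [Finset.card_filter, Fintype.sum_prod_type]
      apply Finset.sum_congr rfl
      intro v _
      rw [← Finset.card_filter, ← G.card_neighborFinset_eq_degree]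
      congr 1
      ext x; simp
    have h4 : G.edgeSet.ncard = G.edgeFinset.card := by
      rw [← SimpleGraph.coe_edgeFinset, Set.ncard_coe_finset]
    have h5 : E.card = (univ.filter fun x : V × V => G.Adj x.1 x.2 ∧ f x.1 < f x.2).card := rfl
    omega
  have himg : X.image p = univ.image (fun v => p (f v)) := by
    rw [hX, Finset.image_image]; rfl
  have hec : ∀ c, {x : V × V | G.Adj x.1 x.2 ∧ p (f x.1) = c ∧ p (f x.2) = c}.ncard =
      2 * eIn E s t p c := by
    intro c
    have h1 := count_sym (fun a b => G.Adj a b ∧ p (f a) = c ∧ p (f b) = c)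
      (fun _ _ h => ⟨h.1.symm, h.2.2, h.2.1⟩) (fun a h => G.loopless.irrefl a h.1) f hfi
    rw [← Set.ncard_coe_finset] at h1
    simp only [coe_filter, mem_univ, true_and] at h1
    rw [h1]
    congr 1
    unfold eIn
    rw [hEd, Finset.filter_filter]
    congr 1
    ext x
    simp only [mem_filter, mem_univ, true_and, hs, ht]
    tauto
  have hcr : {x : V × V | G.Adj x.1 x.2 ∧ p (f x.1) ≠ p (f x.2)}.ncard = 2 * cross E s t p := by
    have h1 := count_sym (fun a b => G.Adj a b ∧ p (f a) ≠ p (f b))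
      (fun _ _ h => ⟨h.1.symm, h.2.symm⟩) (fun a h => G.loopless.irrefl a h.1) f hfi
    rw [← Set.ncard_coe_finset] at h1
    simp only [coe_filter, mem_univ, true_and] at h1
    rw [h1]
    congr 1
    unfold cross
    rw [hEd, Finset.filter_filter]
    congr 1
    ext x
    simp only [mem_filter, mem_univ, true_and, hs, ht]
    tauto
  refine ⟨fun v => p (f v), eIn E s t p, cross E s t p, hec, hcr, ?_, ?_, ?_⟩
  · rw [← himg]
    exact cross_ge X E s t hE (f r0) hr hC p
  · rw [← himg, ← hEm]
    exact sum_eIn X E s t hE p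
  · have hSN : SN X E s t τ (f r0) p + 1 = (X.image p).card +
        ∑ c ∈ X.image p, (eIn E s t p c + {v | p (f v) = c}.ncard + 1) % 2 := by
      have h1 : ∀ c, need X E s t τ (f r0) p c =
          rho (f r0) p c + (eIn E s t p c + {v | p (f v) = c}.ncard + 1) % 2 := by
        intro c
        have h2 : tot X τ p c + 1 = {v | p (f v) = c}.ncard + rho (f r0) p c := by
          have h3 : {v | p (f v) = c}.ncard = ∑ x ∈ X.filter (fun x => p x = c), 1 := by
            rw [Finset.sum_filter, hX, Finset.sum_image (fun a _ b _ h => hfi h), ← Finset.card_filter,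
              ← Set.ncard_coe_finset]
            simp
          have h4 : tot X τ p c + (if p (f r0) = c then 1 else 0) =
              ∑ x ∈ X.filter (fun x => p x = c), 1 := by
            unfold tot
            have h5 : (if p (f r0) = c then 1 else 0) =
                ∑ x ∈ X.filter (fun x => p x = c), if x = f r0 then 1 else 0 := by
              rw [Finset.sum_ite_eq']; simp [hr]
            rw [h5, ← Finset.sum_add_distrib]
            apply Finset.sum_congr rfl
            intro x _
            simp only [hτ]
            split_ifs <;> rfl
          rw [h3, ← h4]
          unfold rho
          split_ifs <;> omega
        unfold need
        omega
      have h2 : ∑ c ∈ X.image p, rho (f r0) p c + 1 = (X.image p).card := by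
        have h3 : ∑ c ∈ X.image p, (rho (f r0) p c + if p (f r0) = c then 1 else 0) =
            (X.image p).card := by
          rw [Finset.card_eq_sum_ones]
          apply Finset.sum_congr rfl
          intro c _
          unfold rho
          split_ifs <;> rfl
        rw [Finset.sum_add_distrib, Finset.sum_ite_eq, if_pos (mem_image_of_mem p hr)] at h3
        exact h3
      unfold SN
      rw [Finset.sum_congr rfl fun c _ => h1 c, Finset.sum_add_distrib]
      omega
    rw [himg] at hSN
    beta_reduce
    omega

end OT

open SimpleGraph

namespace FM

/-- The graph on the labels in `A` given by a Boolean relation. -/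
def gr (A : List ℕ) (r : ℕ → ℕ → Bool) : SimpleGraph {x // x ∈ A} :=
  SimpleGraph.fromRel (fun x y => r x.1 y.1 = true)

structure Sy (A : List ℕ) (r : ℕ → ℕ → Bool) : Prop where
  symm : ∀ x ∈ A, ∀ y ∈ A, r x y = true → r y x = true
  irr : ∀ x ∈ A, r x x = false

lemma gr_adj {A : List ℕ} {r : ℕ → ℕ → Bool} (h : Sy A r) (x y : {x // x ∈ A}) :
    (gr A r).Adj x y ↔ r x.1 y.1 = true := by
  unfold gr
  rw [SimpleGraph.fromRel_adj]
  constructor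
  · rintro ⟨_, h1 | h1⟩
    · exact h1
    · exact h.symm _ y.2 _ x.2 h1
  · intro h1
    refine ⟨?_, Or.inl h1⟩
    rintro rfl
    rw [h.irr _ x.2] at h1
    exact Bool.false_ne_true h1

lemma sub_step {A A' : List ℕ} {r r' : ℕ → ℕ → Bool} (hr : Sy A r) (hr' : Sy A' r') (x p q : ℕ)
    (hx : x ∈ A) (hA' : ∀ y, y ∈ A' ↔ y ∈ A ∧ y ≠ x) (hp : p ∈ A') (hq : q ∈ A')
    (hpq : r p q = false) (hqp : r q p = false)
    (hN : ∀ y ∈ A, r x y = true ↔ y = p ∨ y = q)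
    (h' : ∀ y ∈ A', ∀ z ∈ A', r' y z = true ↔ (r y z = true ∨ (y = p ∧ z = q) ∨ (y = q ∧ z = p)))
    {i j : ℕ} (hF : IsInF i j (gr A' r')) : IsInF (i + 1) j (gr A r) := by
  classical
  have huv : (gr A' r').Adj ⟨p, hp⟩ ⟨q, hq⟩ := by
    rw [gr_adj hr', h' p hp q hq]; simp
  refine IsInF.iso ⟨?_⟩ (IsInF.subdiv huv hF)
  refine { toFun := fun y => if h : y.1 = x then none else some ⟨y.1, (hA' _).2 ⟨y.2, h⟩⟩,
           invFun := fun o => match o with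
            | none => ⟨x, hx⟩
            | some y => ⟨y.1, ((hA' _).1 y.2).1⟩,
           left_inv := ?_, right_inv := ?_, map_rel_iff' := ?_ }
  · rintro ⟨y, hy⟩
    by_cases h : y = x
    · simp [h]
    · simp [h]
  · rintro (_ | ⟨y, hy⟩)
    · simp
    · simp [((hA' _).1 hy).2]
  · rintro ⟨y, hy⟩ ⟨z, hz⟩
    rw [gr_adj hr]
    have hxx := hr.irr x hx
    have hzx : r z x = true ↔ r x z = true := ⟨hr.symm _ hz _ hx, hr.symm _ hx _ hz⟩
    have hyx : r y x = true ↔ r x y = true := ⟨hr.symm _ hy _ hx, hr.symm _ hx _ hy⟩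
    by_cases h1 : y = x <;> by_cases h2 : z = x
    · subst h1; subst h2; simp [hxx]
    · subst h1
      simp [subdivideEdge, h2, hN z hz]
    · subst h2
      simp [subdivideEdge, h1, hN y hy, hyx]
    · have hy' := (hA' y).2 ⟨hy, h1⟩
      have hz' := (hA' z).2 ⟨hz, h2⟩
      have e1 := gr_adj hr' ⟨y, hy'⟩ ⟨z, hz'⟩
      have e2 := gr_adj hr' ⟨z, hz'⟩ ⟨y, hy'⟩
      have e3 : (gr A' r').Adj ⟨y, hy'⟩ ⟨z, hz'⟩ ↔ (gr A' r').Adj ⟨z, hz'⟩ ⟨y, hy'⟩ :=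
        (gr A' r').adj_comm _ _
      have e4 := h' y hy' z hz'
      have e5 := hr.irr y hy
      simp [subdivideEdge, h1, h2, e1, e2]
      grind

end FM

open SimpleGraph

namespace FM

lemma op_step {A A' : List ℕ} {r r' : ℕ → ℕ → Bool} (hr : Sy A r) (hr' : Sy A' r')
    (v a b c u₁ v₁ u₂ v₂ p q : ℕ)
    (hv : v ∈ A) (hb : b ∈ A) (hc : c ∈ A)
    (hA' : ∀ y, y ∈ A' ↔ y ∈ A ∧ y ≠ v ∧ y ≠ b ∧ y ≠ c)
    (hbc : b ≠ c) (hbc' : r b c = false) (ha : a ∈ A')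
    (hu₁ : u₁ ∈ A') (hv₁ : v₁ ∈ A') (hu₂ : u₂ ∈ A') (hv₂ : v₂ ∈ A')
    (h1 : r u₁ v₁ = false) (h2 : r u₂ v₂ = false)
    (hne : ¬ (u₁ = u₂ ∧ v₁ = v₂)) (hne' : ¬ (u₁ = v₂ ∧ v₁ = u₂))
    (hNv : ∀ y ∈ A, r v y = true ↔ y = a ∨ y = b ∨ y = c)
    (hNb : ∀ y ∈ A, r b y = true ↔ y = v ∨ y = u₁ ∨ y = v₁)
    (hNc : ∀ y ∈ A, r c y = true ↔ y = v ∨ y = u₂ ∨ y = v₂)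
    (hp : p ∈ A') (hq : q ∈ A') (hpq : p ≠ q) (hNa : ∀ y ∈ A', r' a y = true ↔ y = p ∨ y = q)
    (h' : ∀ y ∈ A', ∀ z ∈ A', r' y z = true ↔ (r y z = true ∨ (y = u₁ ∧ z = v₁) ∨
      (y = v₁ ∧ z = u₁) ∨ (y = u₂ ∧ z = v₂) ∨ (y = v₂ ∧ z = u₂)))
    {i j : ℕ} (hF : IsInF i j (gr A' r')) : IsInF i (j + 1) (gr A r) := by
  classical
  have hd : HasDegreeTwo (gr A' r') ⟨a, ha⟩ := by
    refine ⟨⟨p, hp⟩, ⟨q, hq⟩, by simpa using hpq, ?_, ?_, ?_⟩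
    · rw [gr_adj hr', hNa p hp]; simp
    · rw [gr_adj hr', hNa q hq]; simp
    · rintro ⟨z, hz⟩ h
      rw [gr_adj hr', hNa z hz] at h
      simpa using h
  have hE : IsCircOp (gr A' r') ⟨a, ha⟩
      (circOpTwo (gr A' r') ⟨u₁, hu₁⟩ ⟨v₁, hv₁⟩ ⟨u₂, hu₂⟩ ⟨v₂, hv₂⟩ ⟨a, ha⟩) := by
    left
    refine ⟨_, _, _, _, ?_, ?_, ?_, rfl⟩
    · rw [gr_adj hr', h' _ hu₁ _ hv₁]; simp
    · rw [gr_adj hr', h' _ hu₂ _ hv₂]; simp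
    · simp only [ne_eq, Sym2.eq_iff, Subtype.mk.injEq]
      tauto
  have hvb : v ≠ b := by
    rintro rfl
    have := (hNv v hv).2 (by simp)
    rw [hr.irr v hv] at this; simp at this
  have hvc : v ≠ c := by
    rintro rfl
    have := (hNv v hv).2 (by simp)
    rw [hr.irr v hv] at this; simp at this
  refine IsInF.iso ⟨?_⟩ (IsInF.op hd hE hF)
  refine { toFun := fun y => if h : y.1 = v then Sum.inr 2 else if h0 : y.1 = b then Sum.inr 0 else
              if h1 : y.1 = c then Sum.inr 1 else Sum.inl ⟨y.1, (hA' _).2 ⟨y.2, h, h0, h1⟩⟩,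
           invFun := fun o => match o with
            | Sum.inr 0 => ⟨b, hb⟩
            | Sum.inr 1 => ⟨c, hc⟩
            | Sum.inr 2 => ⟨v, hv⟩
            | Sum.inl y => ⟨y.1, ((hA' _).1 y.2).1⟩,
           left_inv := ?_, right_inv := ?_, map_rel_iff' := ?_ }
  · rintro ⟨y, hy⟩
    by_cases h : y = v
    · simp [h]
    by_cases h0 : y = b
    · simp [h0, hvb.symm]
    by_cases h1 : y = c
    · simp [h1, hvc.symm, hbc.symm]
    simp [h, h0, h1]
  · rintro (⟨y, hy⟩ | o)
    · have := (hA' _).1 hy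
      simp [this]
    · fin_cases o
      · simp [hvb.symm]
      · simp [hvc.symm, hbc.symm]
      · simp
  · have half : ∀ (y z : {x // x ∈ A}), ∀ o : Fin 3, (z.1 = if o = 0 then b else if o = 1 then c else v) →
        ((circOpTwo (gr A' r') ⟨u₁, hu₁⟩ ⟨v₁, hv₁⟩ ⟨u₂, hu₂⟩ ⟨v₂, hv₂⟩ ⟨a, ha⟩).Adj
          (if h : y.1 = v then Sum.inr 2 else if h0 : y.1 = b then Sum.inr 0 else
              if h1 : y.1 = c then Sum.inr 1 else Sum.inl ⟨y.1, (hA' _).2 ⟨y.2, h, h0, h1⟩⟩)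
          (Sum.inr o) ↔ r z.1 y.1 = true) := by
      rintro ⟨y, hy⟩ ⟨z, hz⟩ o ho
      have ha' := (hA' _).1 ha
      have hu₁' := (hA' _).1 hu₁
      have hu₂' := (hA' _).1 hu₂
      have hv₁' := (hA' _).1 hv₁
      have hv₂' := (hA' _).1 hv₂
      have ev := hNv y hy
      have eb := hNb y hy
      have ec := hNc y hy
      by_cases h : y = v
      · fin_cases o <;> simp at ho <;> subst ho <;> simp [circOpTwo, h] <;> grind
      by_cases h0 : y = b
      · fin_cases o <;> simp at ho <;> subst ho <;> simp [circOpTwo, h0, hvb.symm] <;> grind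
      by_cases h1 : y = c
      · fin_cases o <;> simp at ho <;> subst ho <;> simp [circOpTwo, h1, hvc.symm, hbc.symm] <;> grind
      fin_cases o <;> simp at ho <;> subst ho <;> simp [circOpTwo, h, h0, h1] <;> grind
    rintro ⟨y, hy⟩ ⟨z, hz⟩
    rw [gr_adj hr]
    have hzy : r y z = true ↔ r z y = true := ⟨hr.symm _ hy _ hz, hr.symm _ hz _ hy⟩
    by_cases kz : z = v
    · rw [hzy, ← half ⟨y, hy⟩ ⟨z, hz⟩ 2 (by simpa using kz)]; simp [kz]
    by_cases kz0 : z = b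
    · rw [hzy, ← half ⟨y, hy⟩ ⟨z, hz⟩ 0 (by simpa using kz0)]; simp [kz0, hvb.symm]
    by_cases kz1 : z = c
    · rw [hzy, ← half ⟨y, hy⟩ ⟨z, hz⟩ 1 (by simpa using kz1)]; simp [kz1, hvc.symm, hbc.symm]
    by_cases ky : y = v
    · rw [← half ⟨z, hz⟩ ⟨y, hy⟩ 2 (by simpa using ky), SimpleGraph.adj_comm]; simp [ky]
    by_cases ky0 : y = b
    · rw [← half ⟨z, hz⟩ ⟨y, hy⟩ 0 (by simpa using ky0), SimpleGraph.adj_comm]; simp [ky0, hvb.symm]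
    by_cases ky1 : y = c
    · rw [← half ⟨z, hz⟩ ⟨y, hy⟩ 1 (by simpa using ky1), SimpleGraph.adj_comm]
      simp [ky1, hvc.symm, hbc.symm]
    have hy' := (hA' y).2 ⟨hy, ky, ky0, ky1⟩
    have hz' := (hA' z).2 ⟨hz, kz, kz0, kz1⟩
    have e1 := gr_adj hr' ⟨y, hy'⟩ ⟨z, hz'⟩
    have e2 := gr_adj hr' ⟨z, hz'⟩ ⟨y, hy'⟩
    have e3 : (gr A' r').Adj ⟨y, hy'⟩ ⟨z, hz'⟩ ↔ (gr A' r').Adj ⟨z, hz'⟩ ⟨y, hy'⟩ :=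
      (gr A' r').adj_comm _ _
    have e4 := h' y hy' z hz'
    have e5 := hr.irr y hy
    have e6 := h' z hz' y hy'
    have k1 : r v₁ u₁ = true → r u₁ v₁ = true := hr.symm _ ((hA' _).1 hv₁).1 _ ((hA' _).1 hu₁).1
    have k2 : r v₂ u₂ = true → r u₂ v₂ = true := hr.symm _ ((hA' _).1 hv₂).1 _ ((hA' _).1 hu₂).1
    rw [e1, e2] at e3
    simp [circOpTwo, ky, ky0, ky1, kz, kz0, kz1, e1, e2]
    change r' y z = true ↔ r' z y = true at e3
    clear e1 e2 hzy hF hd hE half hNa h' hNv hNb hNc hA' hne hne' hr hr' hpq hp hq ha hbc hbc' hb hc hv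
    clear kz kz0 kz1 ky ky0 ky1 hvb hvc
    grind

lemma k4_base {A : List ℕ} {r : ℕ → ℕ → Bool} (hr : Sy A r) (hA : A.Nodup) (h4 : A.length = 4)
    (h : ∀ x ∈ A, ∀ y ∈ A, x ≠ y → r x y = true) : IsInF 1 1 (gr A r) := by
  have e : {x // x ∈ A} ≃ Fin 4 := by
    refine Fintype.equivFinOfCardEq ?_
    rw [Fintype.card_of_subtype A.toFinset (by simp), List.toFinset_card_of_nodup hA, h4]
  refine IsInF.iso ⟨{ e with map_rel_iff' := ?_ }⟩ IsInF.k4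
  intro x y
  rw [gr_adj hr]
  simp only [SimpleGraph.top_adj, ne_eq]
  constructor
  · intro hxy
    exact h _ x.2 _ y.2 (fun h1 => hxy (by rw [Subtype.ext h1]))
  · intro h1 h2
    have := e.injective h2
    subst this
    rw [hr.irr _ x.2] at h1; simp at h1

end FM

open SimpleGraph

namespace FM

/-- Adjacency bit of the pair `x y` in the encoded matrix `M`. -/
def tb (M x y : ℕ) : Bool :=
  Nat.beq (Nat.land 1 (Nat.shiftRight M (Nat.add 32 (Nat.add (Nat.mul 16 x) y)))) 1

/-- The low 32 bits hold a checksum, which keeps the hash tables of the checker balanced. -/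
def salt (X : ℕ) : ℕ := Nat.add (Nat.mul X 4294967296) (Nat.mod X 4294967291)

/-- Insert the edge `u v`. -/
def addE (M u v : ℕ) : ℕ :=
  salt (Nat.lor (Nat.shiftRight M 32) (Nat.lor (Nat.shiftLeft 1 (Nat.add (Nat.mul 16 u) v))
    (Nat.shiftLeft 1 (Nat.add (Nat.mul 16 v) u))))

/-- Evaluate the argument before applying the function. -/
def force (M : ℕ) (f : ℕ → Bool) : Bool :=
  match M with
  | 0 => f 0
  | Nat.succ n => f (Nat.succ n)

/-- Evaluate a list before applying the function. -/
def forceL : List ℕ → (List ℕ → Bool) → Bool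
  | [], f => f []
  | a :: l, f => forceL l fun l' => force a fun a' => f (a' :: l')

/-- Suppress vertices of degree two until `K₄` is reached. -/
def suppCheck : ℕ → List ℕ → ℕ → Bool
  | 0, A, M => Nat.beq A.length 4 && A.all fun x => A.all fun y => Nat.beq x y || tb M x y
  | k + 1, A, M => A.any fun x =>
      match A.filter (fun y => tb M x y) with
      | [p, q] => !tb M p q &&
          force (addE M p q) (fun M' => forceL (A.filter fun y => !Nat.beq y x) fun A' =>
            suppCheck k A' M')
      | _ => false

/-- Undo operations `∘`, guided by hints, and then suppress vertices of degree two. -/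
def opCheck : List (List (ℕ × ℕ)) → List ℕ → ℕ → Bool
  | [], A, M => suppCheck 3 A M
  | h :: hs, A, M => h.any fun va =>
      A.contains va.1 && A.contains va.2 && tb M va.1 va.2 &&
      match A.filter (fun y => tb M va.1 y && !Nat.beq y va.2) with
      | [b, c] => !tb M b c &&
        match A.filter (fun y => tb M b y && !Nat.beq y va.1),
            A.filter (fun y => tb M c y && !Nat.beq y va.1) with
        | [u₁, v₁], [u₂, v₂] => !tb M u₁ v₁ && !tb M u₂ v₂ &&
            !(Nat.beq u₁ u₂ && Nat.beq v₁ v₂) && !(Nat.beq u₁ v₂ && Nat.beq v₁ u₂) &&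
            force (addE (addE M u₁ v₁) u₂ v₂) fun M' =>
              forceL (A.filter fun y => !(Nat.beq y va.1 || Nat.beq y b || Nat.beq y c)) fun A' =>
              (match A'.filter (fun y => tb M' va.2 y) with
              | [_, _] => true
              | _ => false) && opCheck hs A' M'
        | _, _ => false
      | _ => false

lemma force_eq (M : ℕ) (f : ℕ → Bool) : force M f = f M := by
  cases M <;> rfl

lemma forceL_eq (L : List ℕ) (f : List ℕ → Bool) : forceL L f = f L := by
  induction L generalizing f with
  | nil => rfl
  | cons a l ih => simp only [forceL, ih, force_eq]

lemma tb_eq (M x y : ℕ) : tb M x y = (M >>> 32).testBit (16 * x + y) := by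
  have h : tb M x y = Nat.beq (1 &&& (M >>> (32 + (16 * x + y)))) 1 := rfl
  rw [h, Nat.testBit, Nat.shiftRight_add]
  have h1 : ∀ z : ℕ, Nat.beq (1 &&& z) 1 = (1 &&& z != 0) := by
    intro z
    rw [Nat.one_and_eq_mod_two]
    rcases Nat.mod_two_eq_zero_or_one z with h | h <;> rw [h] <;> rfl
  exact h1 _

lemma salt_shift (X : ℕ) : (salt X) >>> 32 = X := by
  have h : salt X = X * 4294967296 + X % 4294967291 := rfl
  rw [h, Nat.shiftRight_eq_div_pow]
  omega

lemma tb_addE {M u v x y : ℕ} (hu : u < 16) (hv : v < 16) (hy : y < 16) :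
    tb (addE M u v) x y = true ↔ tb M x y = true ∨ (x = u ∧ y = v) ∨ (x = v ∧ y = u) := by
  have h : addE M u v = salt ((M >>> 32) ||| ((1 <<< (16 * u + v)) ||| (1 <<< (16 * v + u)))) := rfl
  rw [tb_eq, tb_eq, h, salt_shift, Nat.testBit_or, Nat.testBit_or, Nat.one_shiftLeft,
    Nat.one_shiftLeft, Nat.testBit_two_pow, Nat.testBit_two_pow]
  simp only [Bool.or_eq_true, decide_eq_true_eq]
  have e1 : (16 * u + v = 16 * x + y) ↔ (x = u ∧ y = v) := by omega
  have e2 : (16 * v + u = 16 * x + y) ↔ (x = v ∧ y = u) := by omega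
  rw [e1, e2]

lemma tb_zero (x y : ℕ) : tb 0 x y = false := by
  rw [tb_eq]; simp

lemma filter_pair {A : List ℕ} {P : ℕ → Bool} {p q : ℕ} (h : A.filter P = [p, q]) (y : ℕ)
    (hy : y ∈ A) : P y = true ↔ y = p ∨ y = q := by
  have : y ∈ A.filter P ↔ y ∈ [p, q] := by rw [h]
  simpa [hy] using this

lemma filter_pair_mem {A : List ℕ} {P : ℕ → Bool} {p q : ℕ} (h : A.filter P = [p, q]) :
    (p ∈ A ∧ P p = true) ∧ (q ∈ A ∧ P q = true) := by
  have h1 : p ∈ A.filter P := by rw [h]; simp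
  have h2 : q ∈ A.filter P := by rw [h]; simp
  simpa using And.intro h1 h2

lemma filter_pair_ne {A : List ℕ} {P : ℕ → Bool} {p q : ℕ} (hA : A.Nodup) (h : A.filter P = [p, q]) :
    p ≠ q := by
  have : (A.filter P).Nodup := hA.filter P
  rw [h] at this
  simpa using this

lemma nbeq (x y : ℕ) : Nat.beq x y = true ↔ x = y := by
  rw [Nat.beq_eq]

lemma nbeq' (x y : ℕ) : Nat.beq x y = false ↔ x ≠ y := by
  rw [ne_eq, ← nbeq, Bool.not_eq_true]

lemma suppCheck_sound (k : ℕ) : ∀ (A : List ℕ) (M : ℕ), A.Nodup → (∀ x ∈ A, x < 16) →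
    Sy A (tb M) → suppCheck k A M = true → IsInF (k + 1) 1 (gr A (tb M)) := by
  induction k with
  | zero =>
    intro A M hA h16 hS h
    simp only [suppCheck, Bool.and_eq_true, nbeq, List.all_eq_true, Bool.or_eq_true] at h
    refine k4_base hS hA h.1 fun x hx y hy hxy => ?_
    exact (h.2 x hx y hy).resolve_left hxy
  | succ k ih =>
    intro A M hA h16 hS h
    simp only [suppCheck, List.any_eq_true] at h
    obtain ⟨x, hx, h⟩ := h
    split at h
    case h_2 => exact absurd h (by simp)
    rename_i p q hpq
    simp only [Bool.and_eq_true, Bool.not_eq_true', force_eq, forceL_eq] at h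
    obtain ⟨h1, h2⟩ := h
    obtain ⟨⟨hp, hp'⟩, hq, hq'⟩ := filter_pair_mem hpq
    have hne := filter_pair_ne hA hpq
    have hpx : p ≠ x := by
      rintro rfl; rw [hS.irr _ hp] at hp'; simp at hp'
    have hqx : q ≠ x := by
      rintro rfl; rw [hS.irr _ hq] at hq'; simp at hq'
    set A' := A.filter fun y => !Nat.beq y x with hA'
    have hmem : ∀ y, y ∈ A' ↔ y ∈ A ∧ y ≠ x := by
      intro y; simp only [hA', List.mem_filter, Bool.not_eq_true', nbeq']
    have hadd : ∀ y ∈ A', ∀ z ∈ A', tb (addE M p q) y z = true ↔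
        (tb M y z = true ∨ (y = p ∧ z = q) ∨ (y = q ∧ z = p)) := fun y _ z hz =>
      tb_addE (h16 _ hp) (h16 _ hq) (h16 _ ((hmem z).1 hz).1)
    have hS' : Sy A' (tb (addE M p q)) := by
      constructor
      · intro y hy z hz hyz
        rw [hadd _ hz _ hy]
        rw [hadd _ hy _ hz] at hyz
        rcases hyz with h3 | h3 | h3
        · exact Or.inl (hS.symm _ ((hmem y).1 hy).1 _ ((hmem z).1 hz).1 h3)
        · tauto
        · tauto
      · intro y hy
        rw [Bool.eq_false_iff, ne_eq, hadd _ hy _ hy, hS.irr _ ((hmem y).1 hy).1]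
        grind
    refine sub_step hS hS' x p q hx hmem ((hmem _).2 ⟨hp, hpx⟩) ((hmem _).2 ⟨hq, hqx⟩) h1 ?_
      (fun y hy => filter_pair hpq y hy) hadd
      (ih A' _ (hA.filter _) (fun y hy => h16 y ((hmem y).1 hy).1) hS' h2)
    rw [Bool.eq_false_iff]
    intro h3
    rw [hS.symm _ hq _ hp h3] at h1
    simp at h1

lemma opCheck_sound (hs : List (List (ℕ × ℕ))) : ∀ (A : List ℕ) (M : ℕ), A.Nodup →
    (∀ x ∈ A, x < 16) → Sy A (tb M) → opCheck hs A M = true →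
    IsInF 4 (hs.length + 1) (gr A (tb M)) := by
  induction hs with
  | nil =>
    intro A M hA h16 hS h
    exact suppCheck_sound 3 A M hA h16 hS h
  | cons h0 hs ih =>
    intro A M hA h16 hS h
    simp only [opCheck, List.any_eq_true] at h
    obtain ⟨⟨v, a⟩, -, h⟩ := h
    simp only [Bool.and_eq_true, List.contains_iff_mem] at h
    obtain ⟨⟨⟨hv, ha⟩, hva⟩, h⟩ := h
    split at h
    case h_2 => exact absurd h (by simp)
    rename_i b c hbc
    simp only [Bool.and_eq_true, Bool.not_eq_true'] at h
    obtain ⟨hbc', h⟩ := h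
    split at h
    case h_2 => exact absurd h (by simp)
    rename_i u₁ v₁ u₂ v₂ e1 e2
    simp only [force_eq, forceL_eq, Bool.and_eq_true, Bool.not_eq_true', Bool.and_eq_false_iff, nbeq'] at h
    obtain ⟨⟨⟨⟨h1, h2⟩, h3⟩, h4⟩, h5, h6⟩ := h
    split at h5
    case h_2 => exact absurd h5 (by simp)
    rename_i p q hpq
    clear h5
    set A' := A.filter fun y => !(Nat.beq y v || Nat.beq y b || Nat.beq y c) with hA'
    have hmem : ∀ y, y ∈ A' ↔ y ∈ A ∧ y ≠ v ∧ y ≠ b ∧ y ≠ c := by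
      intro y
      simp only [hA', List.mem_filter, Bool.not_eq_true', Bool.or_eq_false_iff, nbeq', and_assoc]
    have hirr : ∀ x ∈ A, tb M x x = true → False := by
      intro x hx h; rw [hS.irr x hx] at h; simp at h
    obtain ⟨⟨hb, hb'⟩, hc, hc'⟩ := filter_pair_mem hbc
    obtain ⟨⟨hu₁, hu₁'⟩, hv₁, hv₁'⟩ := filter_pair_mem e1
    obtain ⟨⟨hu₂, hu₂'⟩, hv₂, hv₂'⟩ := filter_pair_mem e2
    have hbcne := filter_pair_ne hA hbc
    have hne1 := filter_pair_ne hA e1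
    have hne2 := filter_pair_ne hA e2
    have hNv := filter_pair hbc
    have hNb := filter_pair e1
    have hNc := filter_pair e2
    simp only [Bool.and_eq_true, Bool.not_eq_true', nbeq'] at hb' hc' hu₁' hv₁' hu₂' hv₂' hNv hNb hNc
    have hcb : tb M c b = true → False := by
      intro h; rw [hS.symm _ hc _ hb h] at hbc'; simp at hbc'
    have hbc2 : tb M b c = true → False := by
      intro h; rw [h] at hbc'; simp at hbc'
    have ne_of : ∀ x ∈ A, ∀ y, tb M x y = true → y ≠ x := by
      rintro x hx y h rfl; exact hirr _ hx h
    have mk : ∀ x ∈ A, x ≠ v → ∀ z, (z = b ∨ z = c) → tb M z x = true → x ∈ A' := by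
      rintro x hx hxv z hz h
      refine (hmem x).2 ⟨hx, hxv, ?_, ?_⟩
      · rintro rfl
        rcases hz with rfl | rfl
        · exact hirr _ hx h
        · exact hcb h
      · rintro rfl
        rcases hz with rfl | rfl
        · exact hbc2 h
        · exact hirr _ hx h
    have mu₁ := mk _ hu₁ hu₁'.2 b (Or.inl rfl) hu₁'.1
    have mv₁ := mk _ hv₁ hv₁'.2 b (Or.inl rfl) hv₁'.1
    have mu₂ := mk _ hu₂ hu₂'.2 c (Or.inr rfl) hu₂'.1
    have mv₂ := mk _ hv₂ hv₂'.2 c (Or.inr rfl) hv₂'.1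
    have ma : a ∈ A' := (hmem a).2 ⟨ha, ne_of v hv a hva, fun h => hb'.2 h.symm, fun h => hc'.2 h.symm⟩
    obtain ⟨⟨hp, hp'⟩, hq, hq'⟩ := filter_pair_mem hpq
    have hA'n : A'.Nodup := hA.filter _
    have h16' : ∀ x ∈ A', x < 16 := fun y hy => h16 y ((hmem y).1 hy).1
    have hadd : ∀ y ∈ A', ∀ z ∈ A', tb (addE (addE M u₁ v₁) u₂ v₂) y z = true ↔
        (tb M y z = true ∨ (y = u₁ ∧ z = v₁) ∨ (y = v₁ ∧ z = u₁) ∨ (y = u₂ ∧ z = v₂) ∨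
          (y = v₂ ∧ z = u₂)) := by
      intro y _ z hz
      rw [tb_addE (h16 _ hu₂) (h16 _ hv₂) (h16' _ hz), tb_addE (h16 _ hu₁) (h16 _ hv₁) (h16' _ hz)]
      simp only [or_assoc]
    have hS' : Sy A' (tb (addE (addE M u₁ v₁) u₂ v₂)) := by
      constructor
      · intro y hy z hz hyz
        rw [hadd _ hz _ hy]
        rw [hadd _ hy _ hz] at hyz
        rcases hyz with h3 | h3
        · exact Or.inl (hS.symm _ ((hmem y).1 hy).1 _ ((hmem z).1 hz).1 h3)
        · right; rcases h3 with h | h | h | h <;> simp [h]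
      · intro y hy
        rw [Bool.eq_false_iff, ne_eq, hadd _ hy _ hy, hS.irr _ ((hmem y).1 hy).1]
        rintro (h | ⟨rfl, h⟩ | ⟨rfl, h⟩ | ⟨rfl, h⟩ | ⟨rfl, h⟩)
        · simp at h
        · exact hne1 h
        · exact hne1 h.symm
        · exact hne2 h
        · exact hne2 h.symm
    refine op_step hS hS' v a b c u₁ v₁ u₂ v₂ p q hv hb hc hmem hbcne hbc' ma mu₁ mv₁ mu₂ mv₂ h1 h2
      (not_and_or.2 h3) (not_and_or.2 h4) ?_ ?_ ?_ hp hq (filter_pair_ne hA'n hpq)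
      (fun y hy => filter_pair hpq y hy) hadd (ih A' _ hA'n h16' hS' h6)
    · intro y hy
      rw [← hNv y hy]
      by_cases h : y = a
      · subst h; simp [hva]
      · simp [h]
    · intro y hy
      rw [← hNb y hy]
      by_cases h : y = v
      · subst h; simp [hS.symm _ hv _ hb hb'.1]
      · simp [h]
    · intro y hy
      rw [← hNc y hy]
      by_cases h : y = v
      · subst h; simp [hS.symm _ hv _ hc hc'.1]
      · simp [h]

end FM

open SimpleGraph

namespace FM

def row (M x : ℕ) : ℕ := Nat.land 65535 (Nat.shiftRight M (Nat.add 32 (Nat.mul 16 x)))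

/-- The labels `x` and `v` have a common neighbour. -/
def meets (M x v : ℕ) : Bool := !Nat.beq (Nat.land (row M x) (row M v)) 0

/-- Label `v` cannot be a further neighbour of label `u` (whose known neighbours are `L`). -/
def bad (M N u v : ℕ) (L : List ℕ) : Bool :=
  Nat.beq u v || tb M u v || tb N u v || meets M u v || L.any fun y => meets M y v

def loop (bd : ℕ → ℕ → Bool) (g : ℕ → ℕ → Bool) (u : ℕ) : List ℕ → ℕ → Bool
  | [], _ => true
  | v :: vs, N => bif bd v N then loop bd g u vs N else
      g v N && force (addE N u v) fun N' => loop bd g u vs N'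

/-- One step of the search: `k` labels are in use, `S` lists the missing neighbours (with
multiplicity), `M` encodes the known edges and `N` known non-edges. -/
def srchStep (n : ℕ) (hints : List (List (ℕ × ℕ))) (rec : ℕ → List ℕ → ℕ → ℕ → Bool)
    (k : ℕ) (S : List ℕ) (M N : ℕ) : Bool :=
    match S with
    | [] => bif Nat.beq k n then forceL (List.range n) (fun A => opCheck hints A M) else
        force (Nat.succ k) fun k' => rec k' [k, k, k] M N
    | u :: S' =>
      (Nat.beq k n || tb N u 15 ||
        force (addE M u k) fun M' => force (Nat.succ k) fun k' => forceL (S' ++ [k, k]) fun S1 =>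
          rec k' S1 M' N) &&
      force (addE N u 15) fun N1 =>
        forceL ((List.range k).filter fun y => tb M u y) fun L =>
        loop (fun v N' => bad M N' u v L)
          (fun v N' => force (addE M u v) fun M' => forceL (S'.erase v) fun S1 =>
            rec k S1 M' N') u S' N1

def srch (n : ℕ) (hints : List (List (ℕ × ℕ))) (f : ℕ) : ℕ → List ℕ → ℕ → ℕ → Bool :=
  Nat.rec (fun _ _ _ _ => false) (fun _ ih => srchStep n hints ih) f

def pairs (n : ℕ) : List (ℕ × ℕ) :=
  (List.range n).flatMap fun a => (List.range n).map fun b => (a, b)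

lemma row_testBit (M x i : ℕ) : (row M x).testBit i = (decide (i < 16) && tb M x i) := by
  have h : row M x = 65535 &&& (M >>> (32 + 16 * x)) := rfl
  rw [h, tb_eq, Nat.testBit_and, Nat.shiftRight_add, Nat.testBit_shiftRight]
  have : (65535 : ℕ) = 2 ^ 16 - 1 := by norm_num
  rw [this, Nat.testBit_two_pow_sub_one]

lemma meets_spec {M x v : ℕ} (h : meets M x v = true) :
    ∃ y < 16, tb M x y = true ∧ tb M v y = true := by
  have h1 : meets M x v = !Nat.beq (row M x &&& row M v) 0 := rfl
  rw [h1, Bool.not_eq_true', nbeq'] at h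
  by_contra hc
  push Not at hc
  apply h
  apply Nat.eq_of_testBit_eq
  intro i
  rw [Nat.testBit_and, row_testBit, row_testBit, Nat.zero_testBit]
  by_cases hi : i < 16
  · have := hc i hi
    cases h2 : tb M x i
    · simp
    · simp [this h2]
  · simp [hi]

/-- Labels below 16 joined to `x`. -/
def NB (M x : ℕ) : Finset ℕ := (Finset.range 16).filter fun y => tb M x y = true

lemma mem_NB {M x y : ℕ} : y ∈ NB M x ↔ y < 16 ∧ tb M x y = true := by
  simp [NB]

lemma NB_card_addE {M u v : ℕ} (hu : u < 16) (hv : v < 16) (huv : u ≠ v) (h : tb M u v = false)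
    (h' : tb M v u = false) (x : ℕ) :
    (NB (addE M u v) x).card = (NB M x).card + (if x = u then 1 else 0) + (if x = v then 1 else 0) := by
  by_cases h1 : x = u
  · subst h1
    rw [if_pos rfl, if_neg huv]
    rw [← Finset.card_insert_of_notMem (a := v) (s := NB M x) (by rw [mem_NB, h]; simp)]
    congr 1
    ext y
    rw [Finset.mem_insert, mem_NB, mem_NB]
    constructor
    · rintro ⟨hy, h2⟩
      rw [tb_addE hu hv hy] at h2
      grind
    · rintro (rfl | ⟨hy, h2⟩)
      · exact ⟨hv, (tb_addE hu hv hv).2 (by simp)⟩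
      · exact ⟨hy, (tb_addE hu hv hy).2 (Or.inl h2)⟩
  by_cases h2 : x = v
  · subst h2
    rw [if_pos rfl, if_neg h1]
    rw [add_zero, ← Finset.card_insert_of_notMem (a := u) (s := NB M x) (by rw [mem_NB, h']; simp)]
    congr 1
    ext y
    rw [Finset.mem_insert, mem_NB, mem_NB]
    constructor
    · rintro ⟨hy, h2⟩
      rw [tb_addE hu hv hy] at h2
      grind
    · rintro (rfl | ⟨hy, h2⟩)
      · exact ⟨hu, (tb_addE hu hv hu).2 (by simp)⟩
      · exact ⟨hy, (tb_addE hu hv hy).2 (Or.inl h2)⟩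
  · rw [if_neg h1, if_neg h2]
    simp only [add_zero]
    congr 1
    ext y
    rw [mem_NB, mem_NB]
    apply and_congr_right
    intro hy
    rw [tb_addE hu hv hy]
    simp [h1, h2]

variable {W : Type}

structure Inv (K : SimpleGraph W) (n : ℕ) (f : ℕ → W) (k : ℕ) (S : List ℕ) (M N : ℕ) : Prop where
  kn : k ≤ n
  inj : ∀ x < k, ∀ y < k, f x = f y → x = y
  degL : ∀ x < k, S.count x + (NB M x).card = (K.neighborSet (f x)).ncard
  degU : ∀ w, (∀ x < k, f x ≠ w) → (K.neighborSet w).ncard = 3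
  edge : ∀ x < 16, ∀ y < 16, tb M x y = true → x < k ∧ y < k ∧ K.Adj (f x) (f y)
  sym : ∀ x < 16, ∀ y < 16, tb M x y = true → tb M y x = true
  non : ∀ x < 15, ∀ y < 15, tb N x y = true → x < k ∧ y < k ∧ ¬ K.Adj (f x) (f y)
  fr : ∀ x < 15, tb N x 15 = true → x < k ∧ ∀ w, K.Adj (f x) w → ∃ y < k, f y = w
  mem : ∀ x ∈ S, x < k

variable {K : SimpleGraph W} {n k M N : ℕ} {f : ℕ → W} {S : List ℕ}

lemma Inv.image_sub [Finite W] (hn : n < 15) (I : Inv K n f k S M N) (x : ℕ) (hx : x < k) :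
    f '' (NB M x : Set ℕ) ⊆ K.neighborSet (f x) ∧ (f '' (NB M x : Set ℕ)).ncard = (NB M x).card := by
  have hkn := I.kn
  have hlt : ∀ y ∈ (NB M x : Set ℕ), y < k ∧ K.Adj (f x) (f y) := by
    intro y hy
    have hy' := mem_NB.1 hy
    exact (I.edge x (by omega) y hy'.1 hy'.2).2
  constructor
  · rintro _ ⟨y, hy, rfl⟩
    exact (hlt y hy).2
  · rw [Set.InjOn.ncard_image, Set.ncard_coe_finset]
    intro a ha b hb hab
    exact I.inj a (hlt a ha).1 b (hlt b hb).1 hab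

lemma Inv.full [Finite W] (hn : n < 15) (I : Inv K n f k S M N) (x : ℕ) (hx : x < k)
    (h0 : S.count x = 0) (w : W) (hw : K.Adj (f x) w) : ∃ y < k, tb M x y = true ∧ f y = w := by
  obtain ⟨h1, h2⟩ := I.image_sub hn x hx
  have h3 := I.degL x hx
  have h4 : f '' (NB M x : Set ℕ) = K.neighborSet (f x) :=
    Set.eq_of_subset_of_ncard_le h1 (by omega) (Set.toFinite _)
  have h5 : w ∈ f '' (NB M x : Set ℕ) := by rw [h4]; exact hw
  obtain ⟨y, hy, rfl⟩ := h5
  have hy' := mem_NB.1 hy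
  have := I.kn
  exact ⟨y, (I.edge x (by omega) y hy'.1 hy'.2).2.1, hy'.2, rfl⟩

lemma Inv.deficient [Finite W] (hn : n < 15) (I : Inv K n f k S M N) (x : ℕ) (hx : x < k)
    (h0 : 0 < S.count x) : ∃ w, K.Adj (f x) w ∧ ∀ y < 16, tb M x y = true → f y ≠ w := by
  obtain ⟨h1, h2⟩ := I.image_sub hn x hx
  have h3 := I.degL x hx
  obtain ⟨w, hw, hw'⟩ := Set.exists_mem_notMem_of_ncard_lt_ncard
    (s := f '' (NB M x : Set ℕ)) (t := K.neighborSet (f x)) (by omega) (Set.toFinite _)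
  refine ⟨w, hw, fun y hy hxy h => hw' ⟨y, mem_NB.2 ⟨hy, hxy⟩, h⟩⟩

lemma Inv.join (hn : n < 15) (I : Inv K n f k S M N) (u v : ℕ) (hu : u < k) (hv : v < k)
    (hadj : K.Adj (f u) (f v)) (hno : tb M u v = false) (S2 : List ℕ)
    (hS2 : ∀ x, S2.count x + (if x = u then 1 else 0) + (if x = v then 1 else 0) = S.count x) :
    Inv K n f k S2 (addE M u v) N := by
  have hkn := I.kn
  have huv : u ≠ v := by rintro rfl; exact hadj.ne rfl
  have hno' : tb M v u = false := by
    rw [Bool.eq_false_iff]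
    intro h
    rw [I.sym v (by omega) u (by omega) h] at hno
    simp at hno
  refine ⟨I.kn, I.inj, ?_, I.degU, ?_, ?_, I.non, I.fr, ?_⟩
  · intro x hx
    rw [NB_card_addE (by omega) (by omega) huv hno hno', ← I.degL x hx, ← hS2 x]
    omega
  · intro x hx y hy h
    rw [tb_addE (by omega) (by omega) hy] at h
    rcases h with h | ⟨rfl, rfl⟩ | ⟨rfl, rfl⟩
    · exact I.edge x hx y hy h
    · exact ⟨hu, hv, hadj⟩
    · exact ⟨hv, hu, hadj.symm⟩
  · intro x hx y hy h
    rw [tb_addE (by omega) (by omega) hy] at h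
    rw [tb_addE (by omega) (by omega) hx]
    rcases h with h | h | h
    · exact Or.inl (I.sym x hx y hy h)
    · exact Or.inr (Or.inr ⟨h.2, h.1⟩)
    · exact Or.inr (Or.inl ⟨h.2, h.1⟩)
  · intro x hx
    apply I.mem
    rw [← List.count_pos_iff] at hx ⊢
    rw [← hS2 x]
    omega

lemma Inv.extend (hn : n < 15) (I : Inv K n f k S M N) (hk : k < n) (w : W)
    (hw : ∀ x < k, f x ≠ w) :
    Inv K n (Function.update f k w) (k + 1) (S ++ [k, k, k]) M N := by
  have hup : ∀ x < k, Function.update f k w x = f x := fun x hx =>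
    Function.update_of_ne (by omega) _ _
  have hself : Function.update f k w k = w := Function.update_self _ _ _
  refine ⟨hk, ?_, ?_, ?_, ?_, I.sym, ?_, ?_, ?_⟩
  · intro x hx y hy h
    rcases Nat.lt_succ_iff_lt_or_eq.1 hx with hx | rfl <;>
      rcases Nat.lt_succ_iff_lt_or_eq.1 hy with hy | rfl
    · rw [hup x hx, hup y hy] at h; exact I.inj x hx y hy h
    · rw [hup x hx, hself] at h; exact absurd h (hw x hx)
    · rw [hup y hy, hself] at h; exact absurd h.symm (hw y hy)
    · rfl
  · intro x hx
    rw [List.count_append]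
    rcases Nat.lt_succ_iff_lt_or_eq.1 hx with hx | rfl
    · have h1 : List.count x [k, k, k] = 0 := by
        rw [List.count_eq_zero]; simp; omega
      rw [hup x hx, ← I.degL x hx, h1, add_zero]
    · have h1 : List.count x [x, x, x] = 3 := by simp
      have h2 : List.count x S = 0 := by
        rw [List.count_eq_zero]; intro h; exact absurd (I.mem x h) (lt_irrefl _)
      have h3 : NB M x = ∅ := by
        rw [Finset.eq_empty_iff_forall_notMem]
        intro y hy
        have hy' := mem_NB.1 hy
        exact absurd (I.edge x (by omega) y hy'.1 hy'.2).1 (lt_irrefl _)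
      rw [hself, I.degU w hw, h1, h2, h3]; simp
  · intro w' hw'
    apply I.degU
    intro x hx
    rw [← hup x hx]
    exact hw' x (by omega)
  · intro x hx y hy h
    obtain ⟨h1, h2, h3⟩ := I.edge x hx y hy h
    rw [hup x h1, hup y h2]
    exact ⟨by omega, by omega, h3⟩
  · intro x hx y hy h
    obtain ⟨h1, h2, h3⟩ := I.non x hx y hy h
    rw [hup x h1, hup y h2]
    exact ⟨by omega, by omega, h3⟩
  · intro x hx h
    obtain ⟨h1, h2⟩ := I.fr x hx h
    refine ⟨by omega, fun w' hw' => ?_⟩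
    rw [hup x h1] at hw'
    obtain ⟨y, hy, rfl⟩ := h2 w' hw'
    exact ⟨y, by omega, hup y hy⟩
  · intro x hx
    rw [List.mem_append] at hx
    rcases hx with hx | hx
    · have := I.mem x hx; omega
    · simp at hx; omega

lemma Inv.addNon (hn : n < 15) (I : Inv K n f k S M N) (u v : ℕ) (hu : u < k) (hv : v < k)
    (h : ¬ K.Adj (f u) (f v)) : Inv K n f k S M (addE N u v) := by
  have hkn := I.kn
  refine ⟨I.kn, I.inj, I.degL, I.degU, I.edge, I.sym, ?_, ?_, I.mem⟩
  · intro x hx y hy h1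
    rw [tb_addE (by omega) (by omega) (by omega)] at h1
    rcases h1 with h1 | ⟨rfl, rfl⟩ | ⟨rfl, rfl⟩
    · exact I.non x hx y hy h1
    · exact ⟨hu, hv, h⟩
    · exact ⟨hv, hu, fun h' => h h'.symm⟩
  · intro x hx h1
    rw [tb_addE (by omega) (by omega) (by omega)] at h1
    rcases h1 with h1 | ⟨rfl, h1⟩ | ⟨rfl, h1⟩
    · exact I.fr x hx h1
    · omega
    · omega

lemma Inv.addFr (hn : n < 15) (I : Inv K n f k S M N) (u : ℕ) (hu : u < k)
    (h : ∀ w, K.Adj (f u) w → ∃ y < k, f y = w) : Inv K n f k S M (addE N u 15) := by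
  have hkn := I.kn
  refine ⟨I.kn, I.inj, I.degL, I.degU, I.edge, I.sym, ?_, ?_, I.mem⟩
  · intro x hx y hy h1
    rw [tb_addE (by omega) (by omega) (by omega)] at h1
    rcases h1 with h1 | ⟨rfl, h1⟩ | ⟨h1, _⟩
    · exact I.non x hx y hy h1
    · omega
    · omega
  · intro x hx h1
    rw [tb_addE (by omega) (by omega) (by omega)] at h1
    rcases h1 with h1 | ⟨rfl, h1⟩ | ⟨h1, _⟩
    · exact I.fr x hx h1
    · exact ⟨hu, h⟩
    · omega

/-- No cycles of length three or four. -/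
def NoShort (K : SimpleGraph W) : Prop :=
  (∀ a b c, K.Adj a b → K.Adj b c → ¬ K.Adj c a) ∧
  (∀ a b c d, a ≠ c → b ≠ d → K.Adj a b → K.Adj b c → K.Adj c d → ¬ K.Adj d a)

lemma bad_sound (hn : n < 15) (hK : NoShort K) (I : Inv K n f k S M N) (u v : ℕ) (hu : u < k)
    (hv : v < k) (L : List ℕ) (hL : ∀ y ∈ L, y < k ∧ tb M u y = true)
    (hb : bad M N u v L = true) (hadj : K.Adj (f u) (f v)) : tb M u v = true := by
  have hkn := I.kn
  simp only [bad, Bool.or_eq_true, nbeq, List.any_eq_true] at hb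
  rcases hb with (((hb | hb) | hb) | hb) | ⟨y, hy, hb⟩
  · subst hb; exact absurd rfl hadj.ne
  · exact hb
  · exact absurd hadj (I.non u (by omega) v (by omega) hb).2.2
  · obtain ⟨y, hy, h1, h2⟩ := meets_spec hb
    have e1 := (I.edge u (by omega) y hy h1).2.2
    have e2 := (I.edge v (by omega) y hy h2).2.2
    exact absurd hadj.symm (hK.1 _ _ _ e1 e2.symm)
  · obtain ⟨hyk, huy⟩ := hL y hy
    obtain ⟨z, hz, h1, h2⟩ := meets_spec hb
    have e0 := (I.edge u (by omega) y (by omega) huy).2.2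
    obtain ⟨-, hzk, e1⟩ := I.edge y (by omega) z hz h1
    have e2 := (I.edge v (by omega) z hz h2).2.2
    by_cases hzu : z = u
    · subst hzu
      exact I.sym v (by omega) z hz h2
    by_cases hyv : y = v
    · subst hyv; exact huy
    · exact absurd hadj.symm (hK.2 (f u) (f y) (f z) (f v)
        (fun h => hzu (I.inj _ hzk _ hu h.symm)) (fun h => hyv (I.inj _ hyk _ hv h)) e0 e1 e2.symm)

lemma loop_sound (hn : n < 15) (hK : NoShort K) (Goal : Prop) (u : ℕ) (S' : List ℕ)
    (g : ℕ → ℕ → Bool) (L : List ℕ) (hL : ∀ y ∈ L, y < k ∧ tb M u y = true)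
    (hg : ∀ v N', v ∈ S' → g v N' = true → Inv K n f k (S'.erase v) (addE M u v) N' → Goal) :
    ∀ (vs : List ℕ) (N : ℕ), (∀ v ∈ vs, v ∈ S') → Inv K n f k (u :: S') M N →
      (∃ v ∈ vs, K.Adj (f u) (f v) ∧ tb M u v = false) →
      loop (fun v N' => bad M N' u v L) g u vs N = true → Goal := by
  intro vs
  induction vs with
  | nil => intro N _ _ h; obtain ⟨v, hv, _⟩ := h; simp at hv
  | cons v vs ih =>
    intro N hsub I hex h
    have hu : u < k := I.mem u (by simp)
    have hvS := hsub v (by simp)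
    have hv : v < k := I.mem v (List.mem_cons_of_mem _ hvS)
    have hsub' : ∀ v ∈ vs, v ∈ S' := fun x hx => hsub x (List.mem_cons_of_mem _ hx)
    have hrest : ¬ (K.Adj (f u) (f v) ∧ tb M u v = false) →
        ∃ v ∈ vs, K.Adj (f u) (f v) ∧ tb M u v = false := by
      intro hnot
      obtain ⟨x, hx, h1⟩ := hex
      rcases List.mem_cons.1 hx with rfl | hx
      · exact absurd h1 hnot
      · exact ⟨x, hx, h1⟩
    simp only [loop, force_eq] at h
    by_cases hb : bad M N u v L = true
    · rw [hb, cond_true] at h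
      refine ih N hsub' I (hrest ?_) h
      rintro ⟨h1, h2⟩
      rw [bad_sound hn hK I u v hu hv L hL hb h1] at h2
      simp at h2
    · rw [Bool.not_eq_true] at hb
      rw [hb, cond_false, Bool.and_eq_true] at h
      by_cases hadj : K.Adj (f u) (f v)
      · have hno : tb M u v = false := by
          simp only [bad, Bool.or_eq_false_iff] at hb
          exact hb.1.1.1.2
        refine hg v N hvS h.1 (I.join hn u v hu hv hadj hno _ ?_)
        intro x
        rw [List.count_erase, List.count_cons]
        have : 0 < S'.count v := List.count_pos_iff.2 hvS
        have huv : u ≠ v := by rintro rfl; exact hadj.ne rfl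
        by_cases h1 : x = u
        · subst h1; simp [huv, huv.symm]
        · by_cases h2 : x = v
          · subst h2; simp [huv, huv.symm]; omega
          · simp [h1, h2, Ne.symm h1, Ne.symm h2]
      · exact ih _ hsub' (I.addNon hn u v hu hv hadj) (hrest fun h => hadj h.1) h.2

lemma leaf_sound [Fintype W] (hn : n < 15) (hcard : Fintype.card W = n) (hints : List (List (ℕ × ℕ)))
    (I : Inv K n f n [] M N) (h : opCheck hints (List.range n) M = true) :
    IsInF 4 (hints.length + 1) K := by
  have hSy : Sy (List.range n) (tb M) := by
    constructor
    · intro x hx y hy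
      rw [List.mem_range] at hx hy
      exact I.sym x (by omega) y (by omega)
    · intro x hx
      rw [List.mem_range] at hx
      rw [Bool.eq_false_iff]
      intro h
      exact (I.edge x (by omega) x (by omega) h).2.2.ne rfl
  have h1 := opCheck_sound hints (List.range n) M List.nodup_range
    (fun x hx => by rw [List.mem_range] at hx; omega) hSy h
  let φ : {x // x ∈ List.range n} → W := fun x => f x.1
  have hinj : Function.Injective φ := by
    rintro ⟨x, hx⟩ ⟨y, hy⟩ hxy
    exact Subtype.ext (I.inj x (List.mem_range.1 hx) y (List.mem_range.1 hy) hxy)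
  have hc : Fintype.card {x // x ∈ List.range n} = Fintype.card W := by
    rw [hcard, Fintype.card_of_subtype (Finset.range n) (by simp), Finset.card_range]
  have hbij := (Fintype.bijective_iff_injective_and_card φ).2 ⟨hinj, hc⟩
  let e : gr (List.range n) (tb M) ≃g K :=
    { Equiv.ofBijective φ hbij with
      map_rel_iff' := by
        rintro ⟨x, hx⟩ ⟨y, hy⟩
        rw [gr_adj hSy]
        have hx' := List.mem_range.1 hx
        have hy' := List.mem_range.1 hy
        change K.Adj (f x) (f y) ↔ tb M x y = true
        constructor
        · intro hadj
          obtain ⟨z, hz, h2, h3⟩ := I.full hn x hx' (by simp) _ hadj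
          rw [← I.inj z hz y hy' h3]
          exact h2
        · intro h2
          exact (I.edge x (by omega) y (by omega) h2).2.2 }
  exact IsInF.iso ⟨e.symm⟩ h1

lemma exists_fresh [Fintype W] (hcard : Fintype.card W = n) (hk : k < n) (f : ℕ → W) :
    ∃ w, ∀ x < k, f x ≠ w := by
  classical
  by_contra hc
  push Not at hc
  have h1 : (Finset.univ : Finset W) ⊆ (Finset.range k).image f := by
    intro w _
    obtain ⟨x, hx, hxw⟩ := hc w
    exact Finset.mem_image.2 ⟨x, Finset.mem_range.2 hx, hxw⟩
  have h2 := Finset.card_le_card h1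
  have h3 : ((Finset.range k).image f).card ≤ (Finset.range k).card := Finset.card_image_le
  rw [Finset.card_univ, hcard] at h2
  rw [Finset.card_range] at h3
  omega

lemma fresh_lt [Fintype W] (hcard : Fintype.card W = n) (I : Inv K n f k S M N) (w : W)
    (hw : ∀ x < k, f x ≠ w) : k < n := by
  classical
  have h1 : ((Finset.range k).image f).card = k := by
    rw [Finset.card_image_of_injOn, Finset.card_range]
    intro a ha b hb hab
    exact I.inj a (by simpa using ha) b (by simpa using hb) hab
  have h2 : (Finset.range k).image f ⊂ Finset.univ := by
    rw [Finset.ssubset_univ_iff]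
    intro h
    have : w ∈ (Finset.range k).image f := by rw [h]; simp
    obtain ⟨x, hx, hxw⟩ := Finset.mem_image.1 this
    exact hw x (Finset.mem_range.1 hx) hxw
  have h3 := Finset.card_lt_card h2
  rw [Finset.card_univ, hcard, h1] at h3
  exact h3

theorem srch_sound [Fintype W] (hn : n < 15) (hcard : Fintype.card W = n) (hK : NoShort K)
    (hints : List (List (ℕ × ℕ))) (fuel : ℕ) : ∀ (f : ℕ → W) (k : ℕ) (S : List ℕ) (M N : ℕ),
    Inv K n f k S M N → srch n hints fuel k S M N = true → IsInF 4 (hints.length + 1) K := by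
  induction fuel with
  | zero => intro f k S M N _ h; exact absurd h (by simp [srch])
  | succ fuel ih =>
    intro f k S M N I h
    have hst : srch n hints (fuel + 1) k S M N = srchStep n hints (srch n hints fuel) k S M N := rfl
    rw [hst] at h
    have hkn := I.kn
    cases S with
    | nil =>
      simp only [srchStep, forceL_eq, force_eq] at h
      by_cases hk : k = n
      · subst hk
        rw [(nbeq k k).2 rfl, cond_true] at h
        exact leaf_sound hn hcard hints I h
      · rw [(nbeq' k n).2 hk, cond_false] at h
        have hlt : k < n := by omega
        obtain ⟨w, hw⟩ := exists_fresh hcard hlt f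
        exact ih _ _ _ _ _ (I.extend hn hlt w hw) h
    | cons u S' =>
      simp only [srchStep, forceL_eq, force_eq, Bool.and_eq_true, Bool.or_eq_true, nbeq] at h
      obtain ⟨h1, h2⟩ := h
      have hu : u < k := I.mem u (by simp)
      by_cases hfr : ∃ w, K.Adj (f u) w ∧ ∀ x < k, f x ≠ w
      · obtain ⟨w, hadj, hw⟩ := hfr
        have hlt := fresh_lt hcard I w hw
        rcases h1 with (h1 | h1) | h1
        · omega
        · obtain ⟨y, hy, hyw⟩ := (I.fr u (by omega) h1).2 w hadj
          exact absurd hyw (hw y hy)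
        · have I1 := I.extend hn hlt w hw
          have hfu : Function.update f k w u = f u := Function.update_of_ne (by omega) _ _
          have hfk : Function.update f k w k = w := Function.update_self _ _ _
          have hno : tb M u k = false := by
            rw [Bool.eq_false_iff]
            intro h3
            exact absurd (I.edge u (by omega) k (by omega) h3).2.1 (lt_irrefl _)
          refine ih _ _ _ _ _ (I1.join hn u k (by omega) (by omega) (by rw [hfu, hfk]; exact hadj) hno
            (S' ++ [k, k]) ?_) h1
          intro x
          have huk : u ≠ k := by omega
          simp only [List.count_append, List.count_cons, List.cons_append, List.count_nil]
          by_cases e1 : x = u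
          · subst e1; simp [huk, huk.symm]
          · by_cases e2 : x = k
            · subst e2; simp [huk]; omega
            · simp [e1, e2, Ne.symm e1, Ne.symm e2]
      · push Not at hfr
        have I1 := I.addFr hn u hu hfr
        refine loop_sound hn hK _ u S' _ _ ?_ ?_ S' _ (fun _ h => h) I1 ?_ h2
        · intro y hy
          simpa using hy
        · intro v N' hv h3 I2
          exact ih _ _ _ _ _ I2 h3
        · obtain ⟨w, hw, hw'⟩ := I.deficient hn u hu (by simp)
          obtain ⟨v, hv, rfl⟩ := hfr w hw
          have hno : tb M u v = false := by
            rw [Bool.eq_false_iff]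
            intro h3
            exact hw' v (by omega) h3 rfl
          refine ⟨v, ?_, hw, hno⟩
          by_contra hvS
          have huv : v ≠ u := by rintro rfl; exact hw.ne rfl
          obtain ⟨z, hz, h4, h5⟩ := I.full hn v hv
            (by rw [List.count_eq_zero, List.mem_cons]; tauto) _ hw.symm
          have := I.inj z hz u hu h5
          subst this
          rw [I.sym v (by omega) z (by omega) h4] at hno
          simp at hno

end FM

open SimpleGraph

namespace FM

theorem search_one : srch 10 [pairs 10] 40 1 [0] 0 0 = true := by decide +kernel

theorem search_two : srch 10 [pairs 10] 40 2 [0, 0, 1, 1] 0 0 = true := by decide +kernel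

theorem search_three : srch 13 [[(3, 1), (4, 1)], [(5, 2), (6, 2)]] 40 1 [0, 0] 0 0 = true := by
  decide +kernel

variable {W : Type} {K : SimpleGraph W}

lemma NB_zero (x : ℕ) : NB 0 x = ∅ := by
  rw [Finset.eq_empty_iff_forall_notMem]
  intro y hy
  have := (mem_NB.1 hy).2
  rw [tb_zero] at this
  simp at this

/-- The starting invariant, in which nothing is known but the degrees. -/
lemma Inv.start {n : ℕ} {f : ℕ → W} {k : ℕ} {S : List ℕ} (kn : k ≤ n)
    (inj : ∀ x < k, ∀ y < k, f x = f y → x = y)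
    (degL : ∀ x < k, S.count x = (K.neighborSet (f x)).ncard)
    (degU : ∀ w, (∀ x < k, f x ≠ w) → (K.neighborSet w).ncard = 3)
    (mem : ∀ x ∈ S, x < k) : Inv K n f k S 0 0 where
  kn := kn
  inj := inj
  degL := by
    intro x hx
    rw [NB_zero, Finset.card_empty, add_zero, degL x hx]
  degU := degU
  edge := by
    intro x _ y _ h
    rw [tb_zero] at h
    simp at h
  sym := by
    intro x _ y _ h
    rw [tb_zero] at h
    simp at h
  non := by
    intro x _ y _ h
    rw [tb_zero] at h
    simp at h
  fr := by
    intro x _ h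
    rw [tb_zero] at h
    simp at h
  mem := mem

lemma exists_def [Fintype W] (d : W → ℕ) (r : ℕ) (hd : ∀ w, d w ≤ 3)
    (hs : ∑ w, d w + (r + 1) = 3 * Fintype.card W) : ∃ w, d w ≠ 3 := by
  by_contra h
  push Not at h
  have : ∑ w, d w = ∑ w : W, 3 := Finset.sum_congr rfl fun w _ => h w
  rw [this, Finset.sum_const, Finset.card_univ, smul_eq_mul] at hs
  omega

/-- Raising one value of `d`. -/
lemma sum_raise [Fintype W] [DecidableEq W] (d : W → ℕ) (w : W) (hw : d w < 3) :
    ∑ x, (if x = w then 3 else d x) = ∑ x, d x + (3 - d w) := by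
  have h1 := Finset.add_sum_erase Finset.univ d (Finset.mem_univ w)
  have h2 := Finset.add_sum_erase Finset.univ (fun x => if x = w then 3 else d x)
    (Finset.mem_univ w)
  have h3 : ∑ x ∈ Finset.univ.erase w, (if x = w then 3 else d x)
      = ∑ x ∈ Finset.univ.erase w, d x := by
    refine Finset.sum_congr rfl fun x hx => ?_
    rw [if_neg (Finset.ne_of_mem_erase hx)]
  simp only [if_true] at h2
  omega

lemma le_raise [Fintype W] (d : W → ℕ) (hd : ∀ w, d w ≤ 3)
    (hs : ∑ w, d w = 3 * Fintype.card W) (w : W) : d w = 3 := by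
  classical
  by_contra hw
  have h1 := sum_raise d w (lt_of_le_of_ne (hd w) hw)
  have h2 : ∑ x, (if x = w then 3 else d x) ≤ ∑ x : W, 3 := by
    refine Finset.sum_le_sum fun x _ => ?_
    split_ifs
    · exact le_rfl
    · exact hd x
  rw [Finset.sum_const, Finset.card_univ, smul_eq_mul] at h2
  have := lt_of_le_of_ne (hd w) hw
  omega

/-- A total deficiency of one is concentrated in one vertex. -/
lemma one_def [Fintype W] (d : W → ℕ) (hd : ∀ w, d w ≤ 3)
    (hs : ∑ w, d w + 1 = 3 * Fintype.card W) : ∃ w, d w = 2 ∧ ∀ x, x ≠ w → d x = 3 := by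
  classical
  obtain ⟨w, hw⟩ := exists_def d 0 hd hs
  have hw' := lt_of_le_of_ne (hd w) hw
  have h1 := sum_raise d w hw'
  have hd2 : ∀ x, (if x = w then 3 else d x) ≤ 3 := by
    intro x
    split_ifs
    · exact le_rfl
    · exact hd x
  have h2 : ∑ x, (if x = w then 3 else d x) ≤ ∑ x : W, 3 := Finset.sum_le_sum fun x _ => hd2 x
  rw [Finset.sum_const, Finset.card_univ, smul_eq_mul] at h2
  refine ⟨w, by omega, fun x hx => ?_⟩
  have h3 := le_raise _ hd2 (by omega) x
  rwa [if_neg hx] at h3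

/-- A total deficiency of two. -/
lemma two_def [Fintype W] (d : W → ℕ) (hd : ∀ w, d w ≤ 3)
    (hs : ∑ w, d w + 2 = 3 * Fintype.card W) :
    (∃ w, d w = 1 ∧ ∀ x, x ≠ w → d x = 3) ∨
      ∃ w w', w ≠ w' ∧ d w = 2 ∧ d w' = 2 ∧ ∀ x, x ≠ w → x ≠ w' → d x = 3 := by
  classical
  obtain ⟨w, hw⟩ := exists_def d 1 hd hs
  have hw' := lt_of_le_of_ne (hd w) hw
  have h1 := sum_raise d w hw'
  have hd2 : ∀ x, (if x = w then 3 else d x) ≤ 3 := by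
    intro x
    split_ifs
    · exact le_rfl
    · exact hd x
  have h2 : ∑ x, (if x = w then 3 else d x) ≤ ∑ x : W, 3 := Finset.sum_le_sum fun x _ => hd2 x
  rw [Finset.sum_const, Finset.card_univ, smul_eq_mul] at h2
  rcases Nat.lt_or_ge (d w) 2 with h4 | h4
  · left
    refine ⟨w, by omega, fun x hx => ?_⟩
    have h3 := le_raise _ hd2 (by omega) x
    rwa [if_neg hx] at h3
  · right
    obtain ⟨w', h5, h6⟩ := one_def _ hd2 (by omega)
    have hne : w' ≠ w := by
      rintro rfl
      simp at h5
    rw [if_neg hne] at h5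
    refine ⟨w, w', hne.symm, by omega, h5, fun x hx hx' => ?_⟩
    have := h6 x hx'
    rwa [if_neg hx] at this

theorem thirteen [Fintype W] (hK : NoShort K) (hcard : Fintype.card W = 13)
    (hd : ∀ w, (K.neighborSet w).ncard ≤ 3) (hs : ∑ w, (K.neighborSet w).ncard = 38) :
    IsInF 4 3 K := by
  obtain ⟨w, h1, h2⟩ := one_def _ hd (by omega)
  refine srch_sound (by norm_num) hcard hK _ _ (fun _ => w) _ _ _ _ (Inv.start (by norm_num) ?_ ?_ ?_ ?_)
    search_three
  · intro x hx y hy _; omega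
  · intro x hx
    obtain rfl : x = 0 := by omega
    rw [h1]; rfl
  · intro x hx
    exact h2 x (hx 0 (by norm_num)).symm
  · simp

theorem ten [Fintype W] (hK : NoShort K) (hcard : Fintype.card W = 10)
    (hd : ∀ w, (K.neighborSet w).ncard ≤ 3) (hs : ∑ w, (K.neighborSet w).ncard = 28) :
    IsInF 4 2 K := by
  rcases two_def _ hd (by omega) with ⟨w, h1, h2⟩ | ⟨w, w', hne, h1, h1', h2⟩
  · refine srch_sound (by norm_num) hcard hK _ _ (fun _ => w) _ _ _ _
      (Inv.start (by norm_num) ?_ ?_ ?_ ?_) search_one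
    · intro x hx y hy _; omega
    · intro x hx
      obtain rfl : x = 0 := by omega
      rw [h1]; rfl
    · intro x hx
      exact h2 x (hx 0 (by norm_num)).symm
    · simp
  · refine srch_sound (by norm_num) hcard hK _ _ (fun i => if i = 0 then w else w') _ _ _ _
      (Inv.start (by norm_num) ?_ ?_ ?_ ?_) search_two
    · intro x hx y hy h
      interval_cases x <;> interval_cases y <;> simp_all
    · intro x hx
      interval_cases x
      · simp only [if_true, h1]; rfl
      · simp only [one_ne_zero, if_false, h1']; rfl
    · intro x hx
      have h3 := hx 0 (by norm_num)
      have h4 := hx 1 (by norm_num)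
      simp only [if_true, one_ne_zero, if_false] at h3 h4
      exact h2 x h3.symm h4.symm
    · simp

lemma girth_ge [Finite W] (hK : NoShort K) (hac : ¬ K.IsAcyclic) : 5 ≤ K.girth := by
  obtain ⟨a, c, hc, hlen⟩ := SimpleGraph.exists_girth_eq_length.2 hac
  rw [hlen]
  by_contra hlt
  have h3 := hc.three_le_length
  cases c with
  | nil => simp at h3
  | cons e1 p =>
    cases p with
    | nil => simp at h3
    | cons e2 p =>
      cases p with
      | nil => simp at h3
      | cons e3 p =>
        cases p with
        | nil => exact hK.1 _ _ _ e1 e2 e3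
        | cons e4 p =>
          cases p with
          | nil =>
            have hn := hc.support_nodup
            simp at hn
            refine hK.2 _ _ _ _ ?_ ?_ e1 e2 e3 e4
            · tauto
            · tauto
          | cons e5 p => simp at hlt

end FM

open SimpleGraph

namespace FM

section Deg

variable {W : Type} {K : SimpleGraph W}

lemma deg_sum [Fintype W] : ∑ w, (K.neighborSet w).ncard = 2 * K.edgeSet.ncard := by
  classical
  have h := K.sum_degrees_eq_twice_card_edges
  rw [← coe_edgeFinset, Set.ncard_coe_finset, ← h]
  refine Finset.sum_congr rfl fun w _ => ?_
  rw [← card_neighborSet_eq_degree, ← Nat.card_eq_fintype_card]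
  rfl

lemma not_acyclic [Fintype W] [Nonempty W]
    (h : 2 * Fintype.card W ≤ ∑ w, (K.neighborSet w).ncard) : ¬ K.IsAcyclic := by
  classical
  intro hac
  obtain ⟨T, hKT, hT⟩ := exists_maximal_isAcyclic_of_le_isAcyclic (G := ⊤) (le_top (a := K)) hac
  have hT' := (connected_top.maximal_le_isAcyclic_iff_isTree le_top).1 hT
  have h1 := hT'.card_edgeFinset
  rw [deg_sum] at h
  have h2 : K.edgeSet.ncard ≤ T.edgeSet.ncard :=
    Set.ncard_le_ncard (edgeSet_mono hKT) (Set.toFinite _)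
  rw [← coe_edgeFinset T, Set.ncard_coe_finset] at h2
  omega

lemma deg_lt [Fintype W] (w : W) : (K.neighborSet w).ncard + 1 ≤ Fintype.card W := by
  classical
  have h : K.neighborSet w ⊆ {w}ᶜ := fun x hx => by
    intro h
    exact (K.ne_of_adj hx) h.symm
  have h1 := Set.ncard_le_ncard h (Set.toFinite _)
  rw [Set.ncard_compl, Set.ncard_singleton, Nat.card_eq_fintype_card] at h1
  have : 0 < Fintype.card W := Fintype.card_pos_iff.2 ⟨w⟩
  omega

lemma sum_simple [Fintype W] : ∑ w, (K.neighborSet w).ncard + Fintype.card W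
    ≤ Fintype.card W * Fintype.card W := by
  have h : ∑ w, ((K.neighborSet w).ncard + 1) ≤ ∑ w : W, Fintype.card W :=
    Finset.sum_le_sum fun w _ => deg_lt w
  rw [Finset.sum_add_distrib] at h
  simpa using h

open Classical in
lemma deg_ind [Fintype W] (w : W) :
    (K.neighborSet w).ncard = ∑ x, if K.Adj w x then 1 else 0 := by
  rw [← Finset.card_filter, ← Set.ncard_coe_finset]
  congr 1
  ext x
  simp

open Classical in
/-- Two vertices in a graph without short cycles have few common neighbours. -/
lemma codeg [Fintype W] (hK : NoShort K) (v x : W) :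
    (∑ u, (if K.Adj u v then 1 else 0) * (if K.Adj u x then 1 else 0)) + (if K.Adj v x then 1 else 0)
      + (if v = x then 1 else 0) ≤ 1 + if v = x then (K.neighborSet v).ncard else 0 := by
  by_cases hvx : v = x
  · subst hvx
    rw [deg_ind]
    have h0 : (∑ u, (if K.Adj u v then 1 else 0) * (if K.Adj u v then 1 else 0)) =
        ∑ x, if K.Adj v x then 1 else 0 := by
      refine Finset.sum_congr rfl fun u _ => ?_
      rw [K.adj_comm v u]
      split_ifs <;> rfl
    rw [h0, if_neg K.irrefl, if_pos rfl, if_pos rfl]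
    omega
  · simp only [hvx, if_false, add_zero]
    have h1 : (∑ u, (if K.Adj u v then 1 else 0) * (if K.Adj u x then 1 else 0)) =
        (Finset.univ.filter fun u => K.Adj u v ∧ K.Adj u x).card := by
      rw [Finset.card_filter]
      refine Finset.sum_congr rfl fun u _ => ?_
      split_ifs <;> simp_all
    rw [h1]
    by_cases ha : K.Adj v x
    · have : (Finset.univ.filter fun u => K.Adj u v ∧ K.Adj u x) = ∅ := by
        rw [Finset.filter_eq_empty_iff]
        rintro u _ ⟨h2, h3⟩
        exact hK.1 _ _ _ h2 ha h3.symm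
      rw [this, if_pos ha, Finset.card_empty]
    · simp only [ha, if_false, add_zero]
      rw [Finset.card_le_one]
      intro a h2 b h3
      simp only [Finset.mem_filter, Finset.mem_univ, true_and] at h2 h3
      by_contra hab
      exact hK.2 _ _ _ _ hvx hab h2.1.symm h2.2 h3.2.symm h3.1

/-- Moore type bound. -/
lemma moore [Fintype W] (hK : NoShort K) :
    (∑ w, (K.neighborSet w).ncard) ^ 2 + Fintype.card W * Fintype.card W
      ≤ Fintype.card W * (Fintype.card W * Fintype.card W) := by
  classical
  have h1 : ∑ w, (K.neighborSet w).ncard ^ 2 + Fintype.card W ≤ Fintype.card W * Fintype.card W := by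
    have h2 : ∑ v : W, ∑ x : W, ((∑ u, (if K.Adj u v then 1 else 0) * (if K.Adj u x then 1 else 0)) +
        (if K.Adj v x then 1 else 0) + (if v = x then 1 else 0)) ≤
        ∑ v : W, ∑ x : W, (1 + if v = x then (K.neighborSet v).ncard else 0) :=
      Finset.sum_le_sum fun v _ => Finset.sum_le_sum fun x _ => codeg hK v x
    have h3 : ∑ w, (K.neighborSet w).ncard ^ 2 =
        ∑ v : W, ∑ x : W, ∑ u, (if K.Adj u v then 1 else 0) * (if K.Adj u x then 1 else 0) := by
      have h4 : ∀ w, (K.neighborSet w).ncard ^ 2 =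
          ∑ v : W, ∑ x : W, (if K.Adj w v then 1 else 0) * (if K.Adj w x then 1 else 0) := by
        intro w
        rw [sq, deg_ind, Finset.sum_mul_sum]
      rw [Finset.sum_congr rfl fun w _ => h4 w, Finset.sum_comm]
      refine Finset.sum_congr rfl fun v _ => ?_
      rw [Finset.sum_comm]
    simp only [Finset.sum_add_distrib] at h2
    rw [← h3] at h2
    simp only [← deg_ind] at h2
    simp at h2
    omega
  have h2 := sq_sum_le_card_mul_sum_sq (s := Finset.univ) (f := fun w => (K.neighborSet w).ncard)
  rw [Finset.card_univ] at h2
  nlinarith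

end Deg

section Part

variable {V : Type} {G : SimpleGraph V} {s : Set V}

lemma induce_deg [Finite V] (w : s) :
    ((G.induce s).neighborSet w).ncard = (G.neighborSet (w : V) ∩ s).ncard := by
  have h : Subtype.val '' ((G.induce s).neighborSet w) = G.neighborSet (w : V) ∩ s := by
    ext x
    simp only [Set.mem_image, Set.mem_inter_iff, mem_neighborSet]
    constructor
    · rintro ⟨y, hy, rfl⟩
      exact ⟨hy, y.2⟩
    · rintro ⟨h1, h2⟩
      exact ⟨⟨x, h2⟩, h1, rfl⟩
  rw [← h, Set.ncard_image_of_injective _ Subtype.val_injective]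

lemma induce_le [Finite V] (hsub : ∀ v : V, (G.neighborSet v).ncard ≤ 3) (w : s) :
    ((G.induce s).neighborSet w).ncard ≤ 3 := by
  rw [induce_deg]
  exact (Set.ncard_le_ncard Set.inter_subset_left (Set.toFinite _)).trans (hsub w)

lemma sum_le [Fintype V] [Fintype s] (hsub : ∀ v : V, (G.neighborSet v).ncard ≤ 3) :
    ∑ w : s, ((G.induce s).neighborSet w).ncard ≤ 3 * Fintype.card s := by
  have := Finset.sum_le_sum (s := Finset.univ) fun (w : s) _ => induce_le (G := G) hsub w
  simpa [mul_comm] using this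

lemma sum_lt [Fintype V] [Fintype s] (hconn : G.Connected)
    (hsub : ∀ v : V, (G.neighborSet v).ncard ≤ 3) (hne : s.Nonempty) (hs : s ≠ Set.univ) :
    ∑ w : s, ((G.induce s).neighborSet w).ncard + 1 ≤ 3 * Fintype.card s := by
  obtain ⟨a, ha⟩ := hne
  obtain ⟨b, hb⟩ := (Set.ne_univ_iff_exists_notMem s).1 hs
  obtain ⟨p⟩ := hconn.preconnected a b
  obtain ⟨d, -, h1, h2⟩ := p.exists_boundary_dart s ha hb
  have hlt : ∑ w : s, ((G.induce s).neighborSet w).ncard < ∑ w : s, 3 := by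
    refine Finset.sum_lt_sum (fun w _ => induce_le hsub w) ⟨⟨d.fst, h1⟩, Finset.mem_univ _, ?_⟩
    rw [induce_deg]
    refine lt_of_lt_of_le (Set.ncard_lt_ncard ?_ (Set.toFinite _)) (hsub d.fst)
    refine ⟨Set.inter_subset_left, fun h => h2 (h ?_).2⟩
    exact d.adj
  rw [Finset.sum_const, Finset.card_univ, smul_eq_mul] at hlt
  omega

/-- A part with four vertices and six edges is everything. -/
lemma is_K4 [Fintype V] [Fintype s] (hconn : G.Connected)
    (hsub : ∀ v : V, (G.neighborSet v).ncard ≤ 3) (h4 : Fintype.card s = 4)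
    (h12 : ∑ w : s, ((G.induce s).neighborSet w).ncard = 12) :
    Nonempty (G ≃g (⊤ : SimpleGraph (Fin 4))) := by
  have hne : s.Nonempty := by
    rw [← Set.nonempty_coe_sort, ← Fintype.card_pos_iff]; omega
  have hs : s = Set.univ := by
    by_contra h
    have := sum_lt hconn hsub hne h
    omega
  have hall := le_raise (fun w : s => ((G.induce s).neighborSet w).ncard) (induce_le hsub) (by omega)
  have hV : Fintype.card V = 4 := by
    rw [← h4]
    subst hs
    exact (Fintype.card_congr (Equiv.Set.univ V)).symm
  have hadj : ∀ v w, v ≠ w → G.Adj v w := by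
    intro v w hvw
    have h1 := hall ⟨v, by rw [hs]; trivial⟩
    simp only [induce_deg] at h1
    rw [hs, Set.inter_univ] at h1
    have hsubs : G.neighborSet v ⊆ {v}ᶜ := fun x hx h => (G.ne_of_adj hx) h.symm
    have h2 : G.neighborSet v = {v}ᶜ := by
      refine Set.eq_of_subset_of_ncard_le hsubs ?_ (Set.toFinite _)
      rw [Set.ncard_compl, Set.ncard_singleton, Nat.card_eq_fintype_card, hV, h1]
    have h3 : w ∈ G.neighborSet v := by
      rw [h2]
      exact hvw.symm
    exact h3
  exact ⟨{ toEquiv := Fintype.equivFinOfCardEq hV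
           map_rel_iff' := by
            intro a b
            rw [top_adj]
            constructor
            · intro h
              exact hadj a b fun h' => h (by rw [h'])
            · intro h h'
              exact h.ne ((Fintype.equivFinOfCardEq hV).injective h') }⟩

/-- A part with a short cycle gives a short cycle of the graph inside the part. -/
lemma short_cycle (h : ¬ NoShort (G.induce s)) :
    ∃ (u : V) (c : G.Walk u u), c.IsCycle ∧ c.length < 5 ∧ ∀ x ∈ c.support, x ∈ s := by
  classical
  rw [NoShort, not_and_or] at h
  rcases h with h | h
  · push Not at h
    obtain ⟨a, b, c, h1, h2, h3⟩ := h
    have h1' : G.Adj a b := h1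
    have h2' : G.Adj b c := h2
    have h3' : G.Adj c a := h3
    refine ⟨a, .cons h1' (.cons h2' (.cons h3' .nil)), ?_, by simp, ?_⟩
    · rw [Walk.cons_isCycle_iff]
      have := h1'.ne
      have := h2'.ne
      have := h3'.ne
      simp [Walk.isPath_def]
      tauto
    · simp
  · push Not at h
    obtain ⟨a, b, c, d, hac, hbd, h1, h2, h3, h4⟩ := h
    have h1' : G.Adj a b := h1
    have h2' : G.Adj b c := h2
    have h3' : G.Adj c d := h3
    have h4' : G.Adj d a := h4
    have hac' : (a : V) ≠ c := fun h => hac (Subtype.ext h)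
    have hbd' : (b : V) ≠ d := fun h => hbd (Subtype.ext h)
    refine ⟨a, .cons h1' (.cons h2' (.cons h3' (.cons h4' .nil))), ?_, by simp, ?_⟩
    · rw [Walk.cons_isCycle_iff]
      have := h1'.ne
      have := h2'.ne
      have := h3'.ne
      have := h4'.ne
      simp [Walk.isPath_def]
      tauto
    · simp

lemma mem_family [Fintype V] [Fintype s]
    (hF : ∀ (W : Type) (H : SimpleGraph W), InFamilyF H → ¬ ContainsInducedSubdivision G H)
    (hN : NoShort (G.induce s)) (hin : IsInF 4 2 (G.induce s) ∨ IsInF 4 3 (G.induce s))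
    (hne : 0 < Fintype.card s)
    (h : 2 * Fintype.card s ≤ ∑ w : s, ((G.induce s).neighborSet w).ncard) : False := by
  have : Nonempty s := Fintype.card_pos_iff.1 hne
  exact hF s (G.induce s) (Or.inl ⟨hin, girth_ge hN (not_acyclic h)⟩)
    ⟨s, s, G.induce s, .refl _, ⟨Iso.refl⟩⟩

lemma pair_count [Fintype V] [Fintype s] :
    {x : V × V | G.Adj x.1 x.2 ∧ x.1 ∈ s ∧ x.2 ∈ s}.ncard =
      ∑ w : s, ((G.induce s).neighborSet w).ncard := by
  rw [← Nat.card_coe_set_eq]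
  simp_rw [← Nat.card_coe_set_eq]
  rw [← Nat.card_sigma]
  refine Nat.card_congr
    { toFun := fun x => ⟨⟨x.1.1, x.2.2.1⟩, ⟨⟨x.1.2, x.2.2.2⟩, x.2.1⟩⟩
      invFun := fun y => ⟨(y.1.1, y.2.1.1), y.2.2, y.1.2, y.2.1.2⟩
      left_inv := fun x => rfl
      right_inv := fun y => rfl }

end Part

/-- Arithmetic for a part with short cycles or for the only part. -/
lemma arith_big (n e : ℕ) (h1 : 2 * e + n ≤ n * n) (h2 : 2 * e ≤ 3 * n) (hn : 0 < n)
    (h3 : ¬ (n = 4 ∧ 2 * e = 12)) : 3 * e + 3 + 7 * ((e + n + 1) % 2) ≤ 5 * n + 6 := by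
  rcases Nat.lt_or_ge n 8 with h | h
  · interval_cases n <;> omega
  · omega

lemma arith_even (n e : ℕ) (h1 : 2 * e + n ≤ n * n) (h2 : 2 * e ≤ 3 * n) (hn : 0 < n)
    (h : (e + n + 1) % 2 = 0) : 3 * e + 3 ≤ 5 * n := by
  rcases Nat.lt_or_ge n 8 with h | h
  · interval_cases n <;> omega
  · omega

/-- Arithmetic for a proper part without short cycles. -/
lemma arith_small (n e : ℕ) (h1 : 2 * e + n ≤ n * n) (h2 : 2 * e + 1 ≤ 3 * n) (hn : 0 < n)
    (h3 : (2 * e) ^ 2 + n * n ≤ n * (n * n))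
    (h4 : ¬ (n = 10 ∧ 2 * e = 28)) (h5 : ¬ (n = 13 ∧ 2 * e = 38)) :
    3 * e + 3 + 7 * ((e + n + 1) % 2) ≤ 5 * n := by
  rcases Nat.lt_or_ge n 17 with h | h
  · have he : ∀ k, k ≤ e → (2 * k) ^ 2 + n * n ≤ n * (n * n) := by
      intro k hk
      have : (2 * k) ^ 2 ≤ (2 * e) ^ 2 := Nat.pow_le_pow_left (by omega) 2
      omega
    have a3 := he 3
    have a4 := he 4
    have a7 := he 7
    have a8 := he 8
    have a9 := he 9
    have a13 := he 13
    clear h3 he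
    interval_cases n <;> norm_num at a3 a4 a7 a8 a9 a13 <;> omega
  · omega

theorem final_bound {V : Type} [Fintype V] (G : SimpleGraph V) (hconn : G.Connected)
    (hsub : ∀ v : V, (G.neighborSet v).ncard ≤ 3)
    (hcyc : ¬ HasTwoDisjointShortCycles G)
    (hF : ∀ (W : Type) (H : SimpleGraph W), InFamilyF H → ¬ ContainsInducedSubdivision G H)
    (hK4 : ¬ Nonempty (G ≃g (⊤ : SimpleGraph (Fin 4)))) :
    7 * phi G + Fintype.card V ≤ 2 * G.edgeSet.ncard + 5 := by
  classical
  obtain ⟨P, ec, cr, h1, -, hp, hm, hphi⟩ := OT.phi_bound G hconn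
  set I := Finset.univ.image P with hI
  set nn : ℕ → ℕ := fun c => {v | P v = c}.ncard with hnn
  have hn : ∑ c ∈ I, nn c = Fintype.card V := by
    have := Finset.card_eq_sum_card_image P Finset.univ
    rw [Finset.card_univ] at this
    rw [this]
    refine Finset.sum_congr rfl fun c _ => ?_
    rw [hnn, ← Set.ncard_coe_finset]
    simp
  have hcard : ∀ c, Fintype.card {v | P v = c} = nn c := by
    intro c
    rw [hnn, ← Nat.card_eq_fintype_card]
    rfl
  have hdeg : ∀ c, ∑ w : {v | P v = c}, ((G.induce {v | P v = c}).neighborSet w).ncard = 2 * ec c := by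
    intro c
    rw [← h1 c, ← pair_count]
    rfl
  have hpos : ∀ c ∈ I, {v | P v = c}.Nonempty := by
    intro c hc
    obtain ⟨v, -, hv⟩ := Finset.mem_image.1 hc
    exact ⟨v, hv⟩
  have hpos' : ∀ c ∈ I, 0 < nn c := fun c hc => (Set.ncard_pos (Set.toFinite _)).2 (hpos c hc)
  have hsimple : ∀ c, 2 * ec c + nn c ≤ nn c * nn c := by
    intro c
    rw [← hdeg, ← hcard]
    exact sum_simple
  have hthree : ∀ c, 2 * ec c ≤ 3 * nn c := by
    intro c
    rw [← hdeg, ← hcard]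
    exact sum_le hsub
  have hbig : ∀ c ∈ I, 3 * ec c + 3 + 7 * ((ec c + nn c + 1) % 2) ≤ 5 * nn c + 6 := by
    intro c hc
    refine arith_big _ _ (hsimple c) (hthree c) (hpos' c hc) ?_
    rw [← hdeg, ← hcard]
    exact fun h => hK4 (is_K4 hconn hsub h.1 h.2)
  have hsmall : ∀ c ∈ I, 1 < I.card → NoShort (G.induce {v | P v = c}) →
      3 * ec c + 3 + 7 * ((ec c + nn c + 1) % 2) ≤ 5 * nn c := by
    intro c hc hI1 hN
    have hlt : 2 * ec c + 1 ≤ 3 * nn c := by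
      rw [← hdeg, ← hcard]
      refine sum_lt hconn hsub (hpos c hc) ?_
      intro huniv
      obtain ⟨c', hc', hne⟩ := Finset.exists_mem_ne hI1 c
      obtain ⟨v, hv⟩ := hpos c' hc'
      have : v ∈ {v | P v = c} := by rw [huniv]; trivial
      exact hne (hv.symm.trans this)
    have hmoore := moore hN
    rw [hdeg, hcard] at hmoore
    refine arith_small _ _ (hsimple c) hlt (hpos' c hc) hmoore ?_ ?_
    · rintro ⟨h2, h3⟩
      refine mem_family hF hN (Or.inl (ten hN ?_ (induce_le hsub) ?_)) ?_ ?_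
      · rw [hcard, h2]
      · rw [hdeg, h3]
      · rw [hcard, h2]; norm_num
      · rw [hcard, hdeg, h2, h3]; norm_num
    · rintro ⟨h2, h3⟩
      refine mem_family hF hN (Or.inr (thirteen hN ?_ (induce_le hsub) ?_)) ?_ ?_
      · rw [hcard, h2]
      · rw [hdeg, h3]
      · rw [hcard, h2]; norm_num
      · rw [hcard, hdeg, h2, h3]; norm_num
  have hone : ∀ c ∈ I, ∀ c' ∈ I, c ≠ c' → ¬ NoShort (G.induce {v | P v = c}) →
      NoShort (G.induce {v | P v = c'}) := by
    intro c _ c' _ hne hN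
    by_contra hN'
    obtain ⟨u, w, hw1, hw2, hw3⟩ := short_cycle hN
    obtain ⟨u', w', hw1', hw2', hw3'⟩ := short_cycle hN'
    exact hcyc ⟨u, u', w, w', hw1, hw1', hw2, hw2', fun x hx hx' =>
      hne ((hw3 x hx).symm.trans (hw3' x hx'))⟩
  -- all parts together
  have hsum : ∑ c ∈ I, (3 * ec c + 3 + 7 * ((ec c + nn c + 1) % 2)) ≤ ∑ c ∈ I, 5 * nn c + 6 := by
    by_cases hex : ∃ c0 ∈ I, ∀ c ∈ I, c ≠ c0 →
        3 * ec c + 3 + 7 * ((ec c + nn c + 1) % 2) ≤ 5 * nn c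
    · obtain ⟨c0, hc0, h2⟩ := hex
      rw [← Finset.add_sum_erase I _ hc0, ← Finset.add_sum_erase I (fun c => 5 * nn c) hc0]
      have h3 := Finset.sum_le_sum (s := I.erase c0) fun c hc =>
        h2 c (Finset.mem_of_mem_erase hc) (Finset.ne_of_mem_erase hc)
      have h4 := hbig c0 hc0
      omega
    · exfalso
      obtain ⟨v⟩ := hconn.nonempty
      have hv : P v ∈ I := Finset.mem_image_of_mem P (Finset.mem_univ v)
      rcases Nat.lt_or_ge 1 I.card with hI1 | hI1
      · by_cases hall : ∀ c ∈ I, NoShort (G.induce {v | P v = c})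
        · exact hex ⟨P v, hv, fun c hc _ => hsmall c hc hI1 (hall c hc)⟩
        · push Not at hall
          obtain ⟨c0, hc0, hN⟩ := hall
          exact hex ⟨c0, hc0, fun c hc hne => hsmall c hc hI1 (hone c0 hc0 c hc hne.symm hN)⟩
      · exact hex ⟨P v, hv, fun c hc hne => absurd (Finset.card_le_one.1 hI1 c hc _ hv) hne⟩
  have e1 : ∑ c ∈ I, (3 * ec c + 3 + 7 * ((ec c + nn c + 1) % 2)) =
      3 * ∑ c ∈ I, ec c + 3 * I.card + 7 * ∑ c ∈ I, (ec c + nn c + 1) % 2 := by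
    rw [Finset.sum_add_distrib, Finset.sum_add_distrib, ← Finset.mul_sum, ← Finset.mul_sum,
      Finset.sum_const, smul_eq_mul, mul_comm I.card 3]
  have e2 : ∑ c ∈ I, 5 * nn c = 5 * Fintype.card V := by
    rw [← Finset.mul_sum, hn]
  rw [e1, e2] at hsum
  change 2 * phi G + Fintype.card V + cr ≤
    G.edgeSet.ncard + I.card + ∑ c ∈ I, (ec c + nn c + 1) % 2 at hphi
  omega

end FM

/-- If `G` is a finite connected subcubic simple graph on `n` vertices and `m`
edges with no two vertex-disjoint cycles each of length less than five, no induced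
subdivision of any member of `𝓕`, and `G` is not isomorphic to `K₄`, then
`φ(G) ≤ (2m − n + 5)/7`. -/
theorem statement_13 {V : Type} [Fintype V] (G : SimpleGraph V) (hconn : G.Connected)
    (hsub : ∀ v : V, (G.neighborSet v).ncard ≤ 3)
    (hcyc : ¬ HasTwoDisjointShortCycles G)
    (hF : ∀ (W : Type) (H : SimpleGraph W), InFamilyF H → ¬ ContainsInducedSubdivision G H)
    (hK4 : ¬ Nonempty (G ≃g (⊤ : SimpleGraph (Fin 4)))) :
    (phi G : ℝ) ≤ (2 * (G.edgeSet.ncard : ℝ) - (Nat.card V : ℝ) + 5) / 7 := by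
  have h := FM.final_bound G hconn hsub hcyc hF hK4
  rw [Nat.card_eq_fintype_card, le_div_iff₀ (by norm_num)]
  have h' : (7 : ℝ) * (phi G : ℝ) + (Fintype.card V : ℝ) ≤ 2 * (G.edgeSet.ncard : ℝ) + 5 := by
    exact_mod_cast h
  linarith
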